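/- The L_NFU-sentence asserting: for every n ∈ ℕ, if beth(n) ≠ ∅ and beth(n) ≤ T⁴(|V|), then for every 𝔞 ∈ M_n there exists 𝔟 ∈ BF with 𝔞 = T²(𝔟), holds in every model of NFU^{-AC} (V the universal set, T⁴ and T² iterates of T, M_n = E^{ω+n}, and κ ≤ μ meaning there are X ∈ κ, Y ∈ μ with an injection from X into Y). -/

import Mathlib

open FirstOrder Language

namespace NFUweak

/-! ## The language L_NFU -/

/-- Function symbols of `L_NFU`: a single binary (type-level) pairing function. -/
inductive NFUFunc : ℕ → Type
  | pair : NFUFunc 2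

/-- Relation symbols of `L_NFU`: binary membership `∈` and unary sethood `S`. -/
inductive NFURel : ℕ → Type
  | mem : NFURel 2
  | isSet : NFURel 1

/-- The language `L_NFU`. -/
def LNFU : Language := ⟨NFUFunc, NFURel⟩

/-- The membership relation symbol. -/
def memR : LNFU.Relations 2 := NFURel.mem

/-- The sethood relation symbol. -/
def setR : LNFU.Relations 1 := NFURel.isSet

/-- The pairing function symbol. -/
def pairF : LNFU.Functions 2 := NFUFunc.pair

/-! ## Stratification -/

/-- `termLevel σ t k` says that, relative to the assignment `σ` of levels (types)
to variables, the term `t` (and all of its subterms) receives level `k`. -/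
def termLevel {α : Type} (σ : α → ℕ) : LNFU.Term α → ℕ → Prop
  | Term.var v, k => σ v = k
  | Term.func _ ts, k => ∀ i, termLevel σ (ts i) k

/-- The stratification condition on an atomic formula `R(ts)`:
for `s ∈ t` the level of `t` is one more than that of `s`; `S(t)` imposes only
that `t` has a well-defined level. -/
def atomOK {α : Type} (σ : α → ℕ) : ∀ {l : ℕ}, LNFU.Relations l → (Fin l → LNFU.Term α) → Prop
  | _, NFURel.mem, ts => ∃ k, termLevel σ (ts 0) k ∧ termLevel σ (ts 1) (k + 1)
  | _, NFURel.isSet, ts => ∃ k, termLevel σ (ts 0) k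

/-- `stratifiedFrom σ φ` : the formula `φ` is stratified, where the free
variables receive the levels given by `σ` (each quantified variable may receive
any level). -/
def stratifiedFrom : ∀ {n : ℕ}, ((Empty ⊕ Fin n) → ℕ) → LNFU.BoundedFormula Empty n → Prop
  | _, _, BoundedFormula.falsum => True
  | _, σ, BoundedFormula.equal t s => ∃ k, termLevel σ t k ∧ termLevel σ s k
  | _, σ, BoundedFormula.rel R ts => atomOK σ R ts
  | _, σ, BoundedFormula.imp f g => stratifiedFrom σ f ∧ stratifiedFrom σ g
  | _, σ, BoundedFormula.all f =>
      ∃ k, stratifiedFrom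
        (Sum.elim (fun e => σ (Sum.inl e)) (Fin.snoc (fun i => σ (Sum.inr i)) k)) f

/-- A formula of `L_NFU` is stratified if some assignment of levels to its
variables witnesses the stratification conditions. -/
def IsStratified {n : ℕ} (φ : LNFU.BoundedFormula Empty n) : Prop :=
  ∃ σ, stratifiedFrom σ φ

/-! ## The axioms of NFU⁻ᴬᶜ -/

/-- Weak extensionality: sets with the same members are equal. -/
def weakExtAx : LNFU.Sentence :=
  ∀' ∀' ((setR.boundedFormula₁ &0 ⊓
          setR.boundedFormula₁ &1) ⟹
    (Term.bdEqual &0 &1 ⇔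
      ∀' (memR.boundedFormula₂ &2 &0 ⇔
          memR.boundedFormula₂ &2 &1)))

/-- The pairing axiom: `⟨x,y⟩ = ⟨w,z⟩ → x = w ∧ y = z`. -/
def pairingAx : LNFU.Sentence :=
  ∀' ∀' ∀' ∀' (Term.bdEqual
      (pairF.apply₂ &0 &1)
      (pairF.apply₂ &2 &3) ⟹
    (Term.bdEqual &0 &2 ⊓ Term.bdEqual &1 &3))

/-- The comprehension axiom for a formula `φ(x, z₀, …, z_{m-1})`, where the
variable `x` is (de Bruijn) variable `m` of `φ` and `z₀, …, z_{m-1}` are the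
parameters: `∀ z⃗ ∃ y (S(y) ∧ ∀ x (x ∈ y ↔ φ(x, z⃗)))`. -/
def comprehensionAx (m : ℕ) (φ : LNFU.BoundedFormula Empty (m + 1)) : LNFU.Sentence :=
  BoundedFormula.alls (∃'
    (setR.boundedFormula₁ (Term.var (Sum.inr ⟨m, by omega⟩)) ⊓
      ∀' (memR.boundedFormula₂
            (Term.var (Sum.inr ⟨m + 1, by omega⟩)) (Term.var (Sum.inr ⟨m, by omega⟩)) ⇔
          φ.liftAt 1 m)))

/-- The theory NFU⁻ᴬᶜ : weak extensionality, pairing and stratified comprehension. -/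
def NFUmAC : LNFU.Theory :=
  {weakExtAx, pairingAx} ∪
    {s | ∃ (m : ℕ) (φ : LNFU.BoundedFormula Empty (m + 1)),
      IsStratified φ ∧ s = comprehensionAx m φ}

/-- The axiom `∀x S(x)` ("everything is a set"), turning NFU⁻ᴬᶜ into NF. -/
def allSetAx : LNFU.Sentence :=
  ∀' (setR.boundedFormula₁ &0)

/-- The theory NF. -/
def NF : LNFU.Theory := NFUmAC ∪ {allSetAx}

end NFUweak
namespace NFUweak

/-! ## Semantic notions inside a model of NFU⁻ᴬᶜ -/

section Semantics

variable {M : Type} [LNFU.Structure M]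

/-- The membership relation of the model. -/
def smem (x y : M) : Prop := Structure.RelMap memR ![x, y]

/-- The sethood predicate of the model. -/
def sset (x : M) : Prop := Structure.RelMap setR ![x]

/-- The (type-level) pairing function of the model. -/
def spair (x y : M) : M := Structure.funMap pairF ![x, y]

/-- `s` is the singleton `{x}`. -/
def isSingletonOf (s x : M) : Prop := sset s ∧ ∀ z, smem z s ↔ z = x

/-- `e` is the empty set. -/
def isEmptySet (e : M) : Prop := sset e ∧ ∀ z, ¬ smem z e

/-- `v` is the universal set `V`. -/
def isUniverseOf (v : M) : Prop := sset v ∧ ∀ x, smem x v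

/-- `f` is an internal function from (the members of) `X` to `Y`, coded as a set of
type-level ordered pairs `⟨a, b⟩`. -/
def isFunc (f X Y : M) : Prop :=
  sset f ∧ (∀ p, smem p f → ∃ a b, p = spair a b ∧ smem a X ∧ smem b Y) ∧
    (∀ a, smem a X → ∃ b, smem (spair a b) f) ∧
    (∀ a b b', smem (spair a b) f → smem (spair a b') f → b = b')

/-- `f` is an internal injection from `X` into `Y`. -/
def isInjFunc (f X Y : M) : Prop :=
  isFunc f X Y ∧ ∀ a a' b, smem (spair a b) f → smem (spair a' b) f → a = a'

/-- `f` is an internal bijection between `X` and `Y`. -/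
def isBijFunc (f X Y : M) : Prop :=
  isInjFunc f X Y ∧ ∀ b, smem b Y → ∃ a, smem (spair a b) f

/-- `X` and `Y` are equipollent (internally). -/
def equipollent (X Y : M) : Prop := ∃ f, isBijFunc f X Y

/-- `c` is the cardinal `|X|`, i.e. the equivalence class of `X` under equipollence. -/
def isCardOf (c X : M) : Prop := sset c ∧ ∀ y, smem y c ↔ equipollent y X

/-- `c` is a cardinal. -/
def isCardinal (c : M) : Prop := ∃ X, sset X ∧ isCardOf c X

/-- `κ ≤ μ` for cardinals: some member of `κ` injects into some member of `μ`. -/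
def cardLe (κ μ : M) : Prop := ∃ X Y f, smem X κ ∧ smem Y μ ∧ isInjFunc f X Y

/-- `Y = ι``X` is the set of singletons of members of `X`. -/
def isIotaImageOf (Y X : M) : Prop :=
  sset Y ∧ ∀ z, smem z Y ↔ ∃ x, smem x X ∧ isSingletonOf z x

/-- `t = T(c)` for a cardinal `c`:  `T(|X|) = |ι``X|`. -/
def isTOf (t c : M) : Prop :=
  ∃ X Y, smem X c ∧ isIotaImageOf Y X ∧ isCardOf t Y

/-- `t = T⁴(c)`. -/
def isT4Of (t c : M) : Prop :=
  ∃ t₁ t₂ t₃, isTOf t₁ c ∧ isTOf t₂ t₁ ∧ isTOf t₃ t₂ ∧ isTOf t t₃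

/-- `z` is the cardinal `0`, the set of all objects with no members. -/
def isZeroCard (z : M) : Prop := sset z ∧ ∀ y, smem y z ↔ ∀ w, ¬ smem w y

/-- `s = S(x)` is the cardinal successor:  `S(x) = {y : (∃z∈y)(y∖{z} ∈ x)}`. -/
def isSuccOf (s x : M) : Prop :=
  sset s ∧ ∀ y, smem y s ↔
    ∃ z, smem z y ∧ ∃ d, sset d ∧ (∀ w, smem w d ↔ (smem w y ∧ w ≠ z)) ∧ smem d x

/-- `o` is the cardinal `1 = S(0)`. -/
def isOneCard (o : M) : Prop := ∃ z, isZeroCard z ∧ isSuccOf o z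

/-- `I` is an inductive set: it contains `0` and is closed under `S`. -/
def isInductiveSet (I : M) : Prop :=
  sset I ∧ (∀ z, isZeroCard z → smem z I) ∧ ∀ a b, smem a I → isSuccOf b a → smem b I

/-- `n` is an internal natural number: it belongs to every inductive set. -/
def isNat (n : M) : Prop := ∀ I, isInductiveSet I → smem n I

/-- `N` is the set `ℕ` of internal natural numbers. -/
def isNatSet (N : M) : Prop := sset N ∧ ∀ y, smem y N ↔ isNat y

/-- `m + k = n` on cardinals, via disjoint unions. -/
def cardAdd (m k n : M) : Prop :=
  ∃ x y u, smem x m ∧ smem y k ∧ (∀ w, ¬ (smem w x ∧ smem w y)) ∧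
    sset u ∧ (∀ w, smem w u ↔ (smem w x ∨ smem w y)) ∧ smem u n

/-- `P` is the cartesian product `x × y` (with type-level pairs). -/
def isProdOf (P x y : M) : Prop :=
  sset P ∧ ∀ p, smem p P ↔ ∃ a b, smem a x ∧ smem b y ∧ p = spair a b

/-- `k · m = n` on cardinals, via cartesian products. -/
def cardMul (k m n : M) : Prop :=
  ∃ x y P, smem x k ∧ smem y m ∧ isProdOf P x y ∧ smem P n

/-- `m ≤ n` on internal natural numbers: `∃k∈ℕ, m + k = n`. -/
def natLe (m n : M) : Prop := ∃ k, isNat k ∧ cardAdd m k n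

/-- The model satisfies `AxCount₍≥₎ : (∀n∈ℕ)(T(n) ≤ n)`. -/
def axCountGeqHolds (M : Type) [LNFU.Structure M] : Prop :=
  ∀ n : M, isNat n → ∀ t, isTOf t n → natLe t n

/-- The model satisfies `AxCount₍≤₎ : (∀n∈ℕ)(n ≤ T(n))`. -/
def axCountLeqHolds (M : Type) [LNFU.Structure M] : Prop :=
  ∀ n : M, isNat n → ∀ t, isTOf t n → natLe n t

/-- The model satisfies `AxCount : (∀n∈ℕ)(T(n) = n)`. -/
def axCountHolds (M : Type) [LNFU.Structure M] : Prop :=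
  ∀ n : M, isNat n → ∀ t, isTOf t n → t = n

/-- The model satisfies the Axiom of Choice: every set of pairwise disjoint
nonempty sets has a transversal. -/
def acHolds (M : Type) [LNFU.Structure M] : Prop :=
  ∀ X : M, sset X →
    (∀ y, smem y X → sset y ∧ ∃ z, smem z y) →
    (∀ y y', smem y X → smem y' X → y ≠ y' → ∀ z, ¬ (smem z y ∧ smem z y')) →
    ∃ t, sset t ∧ ∀ y, smem y X → ∃! z, smem z y ∧ smem z t

/-- `2^κ` is defined (i.e. `2^κ ≠ ∅`): there is a set `X` with `|ι``X| = κ`. -/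
def twoPowDefined (κ : M) : Prop := ∃ X Y, isIotaImageOf Y X ∧ isCardOf κ Y

/-- `P` is the power set of `X`. -/
def isPowerSetOf (P X : M) : Prop :=
  sset P ∧ ∀ z, smem z P ↔ (sset z ∧ ∀ w, smem w z → smem w X)

/-- `μ = 2^κ` (in the nonempty case): `μ = |P(X)|` for some `X` with `|ι``X| = κ`. -/
def isTwoPowOf (μ κ : M) : Prop :=
  ∃ X Y P, isIotaImageOf Y X ∧ isCardOf κ Y ∧ isPowerSetOf P X ∧ isCardOf μ P

/-- `f` is the internal function `beth : ℕ → NC ∪ {∅}` with `beth(0) = ℵ₀` and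
`beth(n+1) = 2^{beth(n)}` (with value `∅` once undefined). -/
def isBethFun (f : M) : Prop :=
  sset f ∧
    (∀ p, smem p f → ∃ n y, isNat n ∧ p = spair n y) ∧
    (∀ n, isNat n → ∃ y, smem (spair n y) f) ∧
    (∀ n y y', smem (spair n y) f → smem (spair n y') f → y = y') ∧
    (∀ z y, isZeroCard z → smem (spair z y) f → ∃ N, isNatSet N ∧ isCardOf y N) ∧
    (∀ n n' y y', isNat n → isSuccOf n' n →
      smem (spair n y) f → smem (spair n' y') f →
        ((isEmptySet y ∧ isEmptySet y') ∨
          (¬ isEmptySet y ∧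
            (isTwoPowOf y' y ∨ (isEmptySet y' ∧ ¬ twoPowDefined y)))))

end Semantics

end NFUweak
namespace NFUweak

/-! ## BFEXTs and the structure ⟨BF, E⟩ inside a model of NFU⁻ᴬᶜ -/

section BF

variable {M : Type} [LNFU.Structure M]

/-- `R` is an internal binary relation: a set of (type-level) ordered pairs. -/
def isRel (R : M) : Prop := sset R ∧ ∀ p, smem p R → ∃ x y, p = spair x y

/-- `x` belongs to the field `Dom(R) = dom(R) ∪ rng(R)` of the relation `R`. -/
def inField (x R : M) : Prop := ∃ y, smem (spair x y) R ∨ smem (spair y x) R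

/-- `D` is the field `Dom(R)` of `R`, as a set. -/
def isFieldSetOf (D R : M) : Prop := sset D ∧ ∀ x, smem x D ↔ inField x R

/-- `R` is a BFEXT: a binary relation that is well-founded (every nonempty
subset of its field has an `R`-minimal element) and extensional. -/
def isBFEXT (R : M) : Prop :=
  isRel R ∧
    (∀ B, sset B → (∃ b, smem b B) → (∀ b, smem b B → inField b R) →
      ∃ b, smem b B ∧ ∀ c, smem c B → ¬ smem (spair c b) R) ∧
    (∀ a b, inField a R → inField b R →
      (∀ c, smem (spair c a) R ↔ smem (spair c b) R) → a = b)

/-- `x` belongs to the smallest subset of `Dom(R)` containing `a` and closed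
under `R`-predecessors. -/
def inSeg (x R a : M) : Prop :=
  ∀ B, sset B → (∀ b, smem b B → inField b R) → smem a B →
    (∀ b c, smem b B → smem (spair c b) R → smem c B) → smem x B

/-- `s = seg_R(a)`: the restriction of `R` to the smallest subset of `Dom(R)`
containing `a` and closed under `R`-predecessors. -/
def isSegOf (s R a : M) : Prop :=
  sset s ∧ ∀ p, smem p s ↔
    (smem p R ∧ ∃ x y, p = spair x y ∧ inSeg x R a ∧ inSeg y R a)

/-- `R ∈ Ω`: `R` is a BFEXT with `R = seg_R(a)` for some `a ∈ Dom(R)`. -/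
def inOmega (R : M) : Prop := isBFEXT R ∧ ∃ a, inField a R ∧ isSegOf R R a

/-- `a = 1_R` is the (unique) top of `R ∈ Ω`. -/
def isTopOf (a R : M) : Prop := inField a R ∧ isSegOf R R a

/-- `f` is an internal isomorphism between the relations `R` and `S`. -/
def isIsoRel (f R S : M) : Prop :=
  sset f ∧
    (∀ p, smem p f → ∃ x y, p = spair x y ∧ inField x R ∧ inField y S) ∧
    (∀ x, inField x R → ∃ y, smem (spair x y) f) ∧
    (∀ x y y', smem (spair x y) f → smem (spair x y') f → y = y') ∧
    (∀ x x' y, smem (spair x y) f → smem (spair x' y) f → x = x') ∧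
    (∀ y, inField y S → ∃ x, smem (spair x y) f) ∧
    (∀ x y x' y', smem (spair x x') f → smem (spair y y') f →
      (smem (spair x y) R ↔ smem (spair x' y') S))

/-- `R` and `S` are isomorphic relations. -/
def relIso (R S : M) : Prop := ∃ f, isIsoRel f R S

/-- `t = [R]` is the set of all relations isomorphic to `R`. -/
def isTypeOf (t R : M) : Prop := sset t ∧ ∀ S, smem S t ↔ relIso S R

/-- `a ∈ BF`: `a = [R]` for some `R ∈ Ω`. -/
def inBF (a : M) : Prop := ∃ R, inOmega R ∧ isTypeOf a R

/-- `a E b` for `a, b ∈ BF`: for `R ∈ a`, `S ∈ b` there is `x ∈ Dom(S)` with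
`⟨x, 1_S⟩ ∈ S` and `R ≅ seg_S(x)`. -/
def erel (a b : M) : Prop :=
  ∃ R S, smem R a ∧ smem S b ∧
    ∃ x oneS, isTopOf oneS S ∧ smem (spair x oneS) S ∧
      ∃ sg, isSegOf sg S x ∧ relIso R sg

/-- `e` is the set `E ⊆ BF × BF`. -/
def isESet (e : M) : Prop :=
  sset e ∧ ∀ p, smem p e ↔ ∃ a b, p = spair a b ∧ inBF a ∧ inBF b ∧ erel a b

/-- `R' = T(R)`: the relation `{⟨{x},{y}⟩ : ⟨x,y⟩ ∈ R}`. -/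
def isTRelOf (R' R : M) : Prop :=
  sset R' ∧ ∀ p, smem p R' ↔
    ∃ x y sx sy, smem (spair x y) R ∧ isSingletonOf sx x ∧ isSingletonOf sy y ∧
      p = spair sx sy

/-- `t' = T(t)` for (isomorphism) types `t` of well-founded relations:
`T([R]) = [{⟨{x},{y}⟩ : ⟨x,y⟩ ∈ R}]`. -/
def isTTypeOf (t' t : M) : Prop :=
  ∃ R R', smem R t ∧ isTRelOf R' R ∧ isTypeOf t' R'

/-- `y = M₀ = E^ω`, the set of types of BFEXTs with finite domain. -/
def isM0Set (y : M) : Prop :=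
  sset y ∧ ∀ a, smem a y ↔
    (inBF a ∧ ∃ R D c, smem R a ∧ isFieldSetOf D R ∧ isCardOf c D ∧ isNat c)

/-- `g` is the internal function `n ↦ M_n = E^{ω+n}` on the internal naturals:
`M_0 = E^ω` and `M_{n+1} = {a ∈ BF : every E-predecessor of a lies in M_n}`. -/
def isMFun (g : M) : Prop :=
  sset g ∧
    (∀ p, smem p g → ∃ n y, isNat n ∧ p = spair n y) ∧
    (∀ n, isNat n → ∃ y, smem (spair n y) g) ∧
    (∀ n y y', smem (spair n y) g → smem (spair n y') g → y = y') ∧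
    (∀ z y, isZeroCard z → smem (spair z y) g → isM0Set y) ∧
    (∀ n n' y y', isNat n → isSuccOf n' n →
      smem (spair n y) g → smem (spair n' y') g →
        (sset y' ∧ ∀ a, smem a y' ↔ (inBF a ∧ ∀ b, inBF b → erel b a → smem b y)))

end BF

end NFUweak
namespace NFUweak

/-! ## The Simple Theory of Types with Infinity (TSTI) -/

/-- Formulae of the many-sorted language `L_TST`, with named variables:
`mem n i j` is `x^n_i ∈_n x^{n+1}_j`, `eq n i j` is `x^n_i = x^n_j`, and
`all n i φ` is `∀ x^n_i, φ`. -/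
inductive TSTFormula : Type
  | mem (n i j : ℕ)
  | eq (n i j : ℕ)
  | fal
  | imp (φ ψ : TSTFormula)
  | all (n i : ℕ) (φ : TSTFormula)

/-- Update a many-sorted valuation at variable `x^n_i`. -/
def tstUpd {M : ℕ → Type} (v : ∀ n, ℕ → M n) (n i : ℕ) (a : M n) : ∀ m, ℕ → M m :=
  fun m j => if h : m = n ∧ j = i then (congrArg M h.1).symm ▸ a else v m j

/-- Satisfaction of an `L_TST`-formula in the many-sorted structure `⟨M, E⟩`
under the valuation `v`. -/
def TSTFormula.Realize {M : ℕ → Type} (E : ∀ n, M n → M (n + 1) → Prop) :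
    TSTFormula → (∀ n, ℕ → M n) → Prop
  | .mem n i j, v => E n (v n i) (v (n + 1) j)
  | .eq n i j, v => v n i = v n j
  | .fal, _ => False
  | .imp φ ψ, v => φ.Realize E v → ψ.Realize E v
  | .all n i φ, v => ∀ a : M n, φ.Realize E (tstUpd v n i a)

/-- All sorts mentioned in the formula are `< k` (so it is an `L_k`-formula). -/
def TSTFormula.sortsLT : TSTFormula → ℕ → Prop
  | .mem n _ _, k => n + 1 < k
  | .eq n _ _, k => n < k
  | .fal, _ => True
  | .imp φ ψ, k => φ.sortsLT k ∧ ψ.sortsLT k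
  | .all n _ φ, k => n < k ∧ φ.sortsLT k

/-- `p : M 2` is the Kuratowski ordered pair `⟨a, b⟩ = {{a},{a,b}}`. -/
def isKPair {M : ℕ → Type} (E : ∀ n, M n → M (n + 1) → Prop)
    (p : M 2) (a b : M 0) : Prop :=
  ∀ s : M 1, E 1 s p ↔
    ((∀ z, E 0 z s ↔ z = a) ∨ (∀ z, E 0 z s ↔ (z = a ∨ z = b)))

/-- The axiom of Infinity: there are `x¹` and `f³` such that `f³` codes an
injective, non-surjective function from `x¹` to `x¹` (with Kuratowski pairs). -/
def TSTInfinity {M : ℕ → Type} (E : ∀ n, M n → M (n + 1) → Prop) : Prop :=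
  ∃ (X : M 1) (f : M 3),
    (∀ p : M 2, E 2 p f → ∃ a b, E 0 a X ∧ E 0 b X ∧ isKPair E p a b) ∧
    (∀ a, E 0 a X → ∃ b p, E 0 b X ∧ E 2 p f ∧ isKPair E p a b) ∧
    (∀ a b b' p p', E 2 p f → E 2 p' f → isKPair E p a b → isKPair E p' a b' → b = b') ∧
    (∀ a a' b p p', E 2 p f → E 2 p' f → isKPair E p a b → isKPair E p' a' b → a = a') ∧
    (∃ b, E 0 b X ∧ ∀ a p, E 2 p f → ¬ isKPair E p a b)

/-- `⟨M, E⟩` is a model of TSTI: all sorts are nonempty and Extensionality,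
Comprehension (for every `L_TST`-formula) and Infinity hold. -/
def IsTSTIModel (M : ℕ → Type) (E : ∀ n, M n → M (n + 1) → Prop) : Prop :=
  (∀ n, Nonempty (M n)) ∧
    (∀ n, ∀ x y : M (n + 1), (∀ z, E n z x ↔ E n z y) → x = y) ∧
    (∀ (φ : TSTFormula) (n i : ℕ) (v : ∀ m, ℕ → M m),
      ∃ y : M (n + 1), ∀ x : M n, E n x y ↔ φ.Realize E (tstUpd v n i x)) ∧
    TSTInfinity E

/-- `⟨M, E⟩` is a model of the fragment TSTI_k, which only refers to the sorts
`< k` (so `k ≥ 4` is needed for the axiom of Infinity to be expressible). -/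
def IsTSTIModelBelow (k : ℕ) (M : ℕ → Type) (E : ∀ n, M n → M (n + 1) → Prop) : Prop :=
  (∀ n, n < k → Nonempty (M n)) ∧
    (∀ n, n + 1 < k → ∀ x y : M (n + 1), (∀ z, E n z x ↔ E n z y) → x = y) ∧
    (∀ (φ : TSTFormula), φ.sortsLT k → ∀ (n i : ℕ), n + 1 < k →
      ∀ v : ∀ m, ℕ → M m,
        ∃ y : M (n + 1), ∀ x : M n, E n x y ↔ φ.Realize E (tstUpd v n i x)) ∧
    TSTInfinity E

/-! ## The language of arithmetic and the internal arithmetic of a model -/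

/-- Function symbols of `L_PA`: `0`, `1`, `+` and `·`. -/
inductive PAFunc : ℕ → Type
  | zero : PAFunc 0
  | one : PAFunc 0
  | add : PAFunc 2
  | mul : PAFunc 2

/-- The language `L_PA` of arithmetic. -/
def LPA : Language := ⟨PAFunc, fun _ => Empty⟩

/-- The type of internal natural numbers of a model of NFU⁻ᴬᶜ. -/
def NatSub (M : Type) [LNFU.Structure M] : Type := {n : M // isNat n}

/-- An `L_PA`-structure on the internal natural numbers of `M` is the internal
arithmetic if its operations are given by the internal graphs of `0`, `1`,
cardinal addition and cardinal multiplication. -/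
def InternalArithOn (M : Type) [LNFU.Structure M] (A : LPA.Structure (NatSub M)) : Prop :=
  isZeroCard (A.funMap PAFunc.zero ![]).val ∧
    isOneCard (A.funMap PAFunc.one ![]).val ∧
    (∀ a b : NatSub M, cardAdd a.val b.val (A.funMap PAFunc.add ![a, b]).val) ∧
    (∀ a b : NatSub M, cardMul a.val b.val (A.funMap PAFunc.mul ![a, b]).val)

/-- `φ^ℕ` holds in `M`: the sentence `φ` of `L_PA` is true in the internal
arithmetic `⟨ℕ, +, ·, 0, 1⟩` of `M`. -/
def internalPASat (M : Type) [LNFU.Structure M] (φ : LPA.Sentence) : Prop :=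
  ∀ A : LPA.Structure (NatSub M), InternalArithOn M A →
    @Sentence.Realize LPA (NatSub M) A φ

end NFUweak
open FirstOrder Language
namespace NFUweak

/-! ## Stratified formulas with parameters -/

/-- Terms with parameters; a parameter carries a level of its own. -/
inductive PTm (M : Type) (n : ℕ) : Type
  | var (i : Fin n)
  | cst (a : M) (k : ℕ)
  | pair (s t : PTm M n)

/-- Formulas with parameters. -/
inductive PFm (M : Type) : ℕ → Type
  | fal {n} : PFm M n
  | eq {n} (s t : PTm M n) : PFm M n
  | mem {n} (s t : PTm M n) : PFm M n
  | st {n} (s : PTm M n) : PFm M n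
  | imp {n} (p q : PFm M n) : PFm M n
  | all {n} (p : PFm M (n + 1)) : PFm M n

section Machinery
variable {M : Type} [LNFU.Structure M]

def PTm.ev {n : ℕ} (v : Fin n → M) : PTm M n → M
  | .var i => v i
  | .cst a _ => a
  | .pair s t => spair (s.ev v) (t.ev v)

def PTm.lev {n : ℕ} (τ : Fin n → ℕ) : PTm M n → ℕ → Prop
  | .var i, k => τ i = k
  | .cst _ j, k => j = k
  | .pair s t, k => s.lev τ k ∧ t.lev τ k

def PTm.par {n : ℕ} : PTm M n → List (M × ℕ)
  | .var _ => []
  | .cst a j => [(a, j)]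
  | .pair s t => s.par ++ t.par

def PFm.ev : ∀ {n : ℕ}, (Fin n → M) → PFm M n → Prop
  | _, _, .fal => False
  | _, v, .eq s t => s.ev v = t.ev v
  | _, v, .mem s t => smem (s.ev v) (t.ev v)
  | _, v, .st s => sset (s.ev v)
  | _, v, .imp p q => p.ev v → q.ev v
  | _, v, .all p => ∀ a : M, p.ev (Fin.snoc v a)

def PFm.strat : ∀ {n : ℕ}, (Fin n → ℕ) → PFm M n → Prop
  | _, _, .fal => True
  | _, τ, .eq s t => ∃ k, s.lev τ k ∧ t.lev τ k
  | _, τ, .mem s t => ∃ k, s.lev τ k ∧ t.lev τ (k + 1)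
  | _, τ, .st s => ∃ k, s.lev τ k
  | _, τ, .imp p q => p.strat τ ∧ q.strat τ
  | _, τ, .all p => ∃ k, p.strat (Fin.snoc τ k)

def PFm.par : ∀ {n : ℕ}, PFm M n → List (M × ℕ)
  | _, .fal => []
  | _, .eq s t => s.par ++ t.par
  | _, .mem s t => s.par ++ t.par
  | _, .st s => s.par
  | _, .imp p q => p.par ++ q.par
  | _, .all p => p.par

def PTm.conv {n m : ℕ} (ix : M × ℕ → Fin m) : PTm M n → LNFU.Term (Empty ⊕ Fin (m + n))
  | .var i => Term.var (Sum.inr (Fin.natAdd m i))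
  | .cst a k => Term.var (Sum.inr (Fin.castAdd n (ix (a, k))))
  | .pair s t => pairF.apply₂ (s.conv ix) (t.conv ix)

def PFm.conv {m : ℕ} (ix : M × ℕ → Fin m) :
    ∀ {n : ℕ}, PFm M n → LNFU.BoundedFormula Empty (m + n)
  | _, .fal => BoundedFormula.falsum
  | _, .eq s t => BoundedFormula.equal (s.conv ix) (t.conv ix)
  | _, .mem s t => memR.boundedFormula₂ (s.conv ix) (t.conv ix)
  | _, .st s => setR.boundedFormula₁ (s.conv ix)
  | _, .imp p q => BoundedFormula.imp (p.conv ix) (q.conv ix)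
  | n, .all p => BoundedFormula.all (n := m + n) (p.conv ix)

theorem PTm.conv_ev {n m : ℕ} (ix : M × ℕ → Fin m) (xs : Fin (m + n) → M) (v : Fin n → M)
    (e : Empty → M) (h1 : ∀ i, xs (Fin.natAdd m i) = v i) (t : PTm M n)
    (h2 : ∀ p ∈ t.par, xs (Fin.castAdd n (ix p)) = p.1) :
    (t.conv ix).realize (Sum.elim e xs) = t.ev v := by
  induction t with
  | var i => simp [PTm.conv, PTm.ev, h1]
  | cst a k => simpa [PTm.conv, PTm.ev] using h2 (a, k) (by simp [PTm.par])
  | pair s t ihs iht =>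
    simp only [PTm.par, List.mem_append] at h2
    simp only [PTm.conv, PTm.ev, spair, Term.realize_functions_apply₂]
    rw [ihs (fun p hp => h2 p (Or.inl hp)), iht (fun p hp => h2 p (Or.inr hp))]

theorem PTm.conv_lev {n m : ℕ} (ix : M × ℕ → Fin m) (σ : Empty ⊕ Fin (m + n) → ℕ) (τ : Fin n → ℕ)
    (h1 : ∀ i, σ (Sum.inr (Fin.natAdd m i)) = τ i) (t : PTm M n)
    (h2 : ∀ p ∈ t.par, σ (Sum.inr (Fin.castAdd n (ix p))) = p.2) (k : ℕ) (h : t.lev τ k) :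
    termLevel σ (t.conv ix) k := by
  induction t with
  | var i => exact (h1 i).trans h
  | cst a j =>
    have := h2 (a, j) (by simp [PTm.par])
    simp only [PTm.conv, termLevel, this]; exact h
  | pair s t ihs iht =>
    simp only [PTm.par, List.mem_append] at h2
    have a := ihs (fun p hp => h2 p (Or.inl hp)) h.1
    have b := iht (fun p hp => h2 p (Or.inr hp)) h.2
    simp only [PTm.conv, Functions.apply₂, termLevel]
    intro i
    fin_cases i
    · exact a
    · exact b

theorem PFm.conv_ev {m : ℕ} (ix : M × ℕ → Fin m) (e : Empty → M) {n : ℕ} (φ : PFm M n) :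
    ∀ (xs : Fin (m + n) → M) (v : Fin n → M) (_ : ∀ i, xs (Fin.natAdd m i) = v i)
    (_ : ∀ p ∈ φ.par, xs (Fin.castAdd n (ix p)) = p.1),
    (φ.conv ix).Realize e xs ↔ φ.ev v := by
  induction φ with
  | fal => intro xs v h1 h2; exact Iff.rfl
  | eq s t =>
    intro xs v h1 h2
    simp only [PFm.par, List.mem_append] at h2
    simp only [PFm.conv, PFm.ev, BoundedFormula.Realize]
    rw [PTm.conv_ev ix xs v e h1 s (fun p hp => h2 p (Or.inl hp)),
      PTm.conv_ev ix xs v e h1 t (fun p hp => h2 p (Or.inr hp))]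
  | mem s t =>
    intro xs v h1 h2
    simp only [PFm.par, List.mem_append] at h2
    simp only [PFm.conv, PFm.ev, BoundedFormula.realize_rel₂, smem]
    rw [PTm.conv_ev ix xs v e h1 s (fun p hp => h2 p (Or.inl hp)),
      PTm.conv_ev ix xs v e h1 t (fun p hp => h2 p (Or.inr hp))]
  | st s =>
    intro xs v h1 h2
    simp only [PFm.conv, PFm.ev, BoundedFormula.realize_rel₁, sset]
    rw [PTm.conv_ev ix xs v e h1 s h2]
  | imp p q ihp ihq =>
    intro xs v h1 h2
    simp only [PFm.par, List.mem_append] at h2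
    simp only [PFm.conv, PFm.ev, BoundedFormula.Realize]
    rw [ihp xs v h1 (fun p hp => h2 p (Or.inl hp)), ihq xs v h1 (fun p hp => h2 p (Or.inr hp))]
  | @all n p ih =>
    intro xs v h1 h2
    simp only [PFm.conv, PFm.ev, BoundedFormula.Realize]
    refine forall_congr' fun a => ih (Fin.snoc xs a) (Fin.snoc v a) ?_ ?_
    · intro i
      refine Fin.lastCases ?_ (fun j => ?_) i
      · rw [Fin.snoc_last]
        have : Fin.natAdd m (Fin.last n) = Fin.last (m + n) := rfl
        rw [this]
        exact Fin.snoc_last (α := fun _ => M) a xs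
      · rw [Fin.snoc_castSucc]
        have : Fin.natAdd m (Fin.castSucc j) = Fin.castSucc (Fin.natAdd m j) := rfl
        rw [this, Fin.snoc_castSucc, h1]
    · intro p hp
      have : Fin.castAdd (n + 1) (ix p) = Fin.castSucc (Fin.castAdd n (ix p)) := rfl
      rw [this, Fin.snoc_castSucc, h2 p hp]

theorem PFm.conv_strat {m : ℕ} (ix : M × ℕ → Fin m) {n : ℕ} (φ : PFm M n) :
    ∀ (σ : Empty ⊕ Fin (m + n) → ℕ) (τ : Fin n → ℕ)
    (_ : ∀ i, σ (Sum.inr (Fin.natAdd m i)) = τ i)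
    (_ : ∀ p ∈ φ.par, σ (Sum.inr (Fin.castAdd n (ix p))) = p.2),
    φ.strat τ → stratifiedFrom σ (φ.conv ix) := by
  induction φ with
  | fal => intro σ τ h1 h2 _; trivial
  | eq s t =>
    rintro σ τ h1 h2 ⟨k, hs, ht⟩
    simp only [PFm.par, List.mem_append] at h2
    exact ⟨k, PTm.conv_lev ix σ τ h1 s (fun p hp => h2 p (Or.inl hp)) k hs,
      PTm.conv_lev ix σ τ h1 t (fun p hp => h2 p (Or.inr hp)) k ht⟩
  | mem s t =>
    rintro σ τ h1 h2 ⟨k, hs, ht⟩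
    simp only [PFm.par, List.mem_append] at h2
    exact ⟨k, PTm.conv_lev ix σ τ h1 s (fun p hp => h2 p (Or.inl hp)) k hs,
      PTm.conv_lev ix σ τ h1 t (fun p hp => h2 p (Or.inr hp)) _ ht⟩
  | st s =>
    rintro σ τ h1 h2 ⟨k, hs⟩
    exact ⟨k, PTm.conv_lev ix σ τ h1 s h2 k hs⟩
  | imp p q ihp ihq =>
    rintro σ τ h1 h2 ⟨hs, ht⟩
    simp only [PFm.par, List.mem_append] at h2
    exact ⟨ihp σ τ h1 (fun p hp => h2 p (Or.inl hp)) hs,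
      ihq σ τ h1 (fun p hp => h2 p (Or.inr hp)) ht⟩
  | @all n p ih =>
    rintro σ τ h1 h2 ⟨k, hk⟩
    refine ⟨k, ih _ (Fin.snoc τ k) ?_ ?_ hk⟩
    · intro i
      refine Fin.lastCases ?_ (fun j => ?_) i
      · rw [Fin.snoc_last]
        have : Fin.natAdd m (Fin.last n) = Fin.last (m + n) := rfl
        rw [this, Sum.elim_inr, Fin.snoc_last]
      · rw [Fin.snoc_castSucc]
        have : Fin.natAdd m (Fin.castSucc j) = Fin.castSucc (Fin.natAdd m j) := rfl
        rw [this, Sum.elim_inr, Fin.snoc_castSucc, h1]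
    · intro p hp
      have : Fin.castAdd (n + 1) (ix p) = Fin.castSucc (Fin.castAdd n (ix p)) := rfl
      rw [this, Sum.elim_inr, Fin.snoc_castSucc, h2 p hp]

/-- The class of models of `NFU⁻ᴬᶜ`. -/
class NFUModel (M : Type) [LNFU.Structure M] : Prop where
  out : M ⊨ NFUmAC
  ne : Nonempty M

theorem PFm.comprehension [NFUModel M] (φ : PFm M 1) (τ : Fin 1 → ℕ) (h : φ.strat τ) :
    ∃ y : M, sset y ∧ ∀ x : M, smem x y ↔ φ.ev (fun _ => x) := by
  classical
  obtain ⟨d⟩ := NFUModel.ne (M := M)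
  set L := φ.par with hL
  let m := L.length + 1
  let ix : M × ℕ → Fin m := fun p => ⟨min (L.idxOf p) L.length, by omega⟩
  let pr : Fin m → M × ℕ := fun i => L.getD i (d, 0)
  have hpr : ∀ p ∈ L, pr (ix p) = p := by
    intro p hp
    have hlt := List.idxOf_lt_length_of_mem hp
    simp only [pr, ix]
    rw [min_eq_left hlt.le, List.getD_eq_getElem _ _ hlt]
    exact List.getElem_idxOf hlt
  let σ : Empty ⊕ Fin (m + 1) → ℕ := Sum.elim (fun e => e.elim) (Fin.append (fun i => (pr i).2) τ)
  have hs : stratifiedFrom σ (φ.conv ix) := by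
    refine φ.conv_strat ix σ τ ?_ ?_ h
    · intro i; simp [σ]
    · intro p hp
      simp [σ, hpr p hp]
  have hax := (NFUModel.out (M := M)).realize_of_mem
      (comprehensionAx m (φ.conv ix)) (Or.inr ⟨m, _, ⟨σ, hs⟩, rfl⟩)
  simp only [comprehensionAx, Sentence.Realize] at hax
  rw [BoundedFormula.realize_alls] at hax
  have hax := hax (fun i => (pr i).1)
  rw [BoundedFormula.realize_ex] at hax
  obtain ⟨y, hy⟩ := hax
  refine ⟨y, ?_⟩
  rw [BoundedFormula.realize_inf, BoundedFormula.realize_rel₁] at hy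
  obtain ⟨hy1, hy2⟩ := hy
  constructor
  · have : (⟨m, by omega⟩ : Fin (m + 1)) = Fin.last m := rfl
    rw [this] at hy1
    simpa [sset] using hy1
  · intro x
    rw [BoundedFormula.realize_all] at hy2
    have := hy2 x
    rw [BoundedFormula.realize_iff, BoundedFormula.realize_rel₂,
      BoundedFormula.realize_liftAt_one (by omega)] at this
    have e1 : (⟨m + 1, by omega⟩ : Fin (m + 1 + 1)) = Fin.last (m + 1) := rfl
    have e2 : (⟨m, by omega⟩ : Fin (m + 1 + 1)) = Fin.castSucc (Fin.last m) := rfl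
    rw [e1, e2] at this
    simp only [Term.realize_var, Sum.elim_inr, Fin.snoc_last, Fin.snoc_castSucc] at this
    rw [PFm.conv_ev ix _ φ _ (fun _ => x)] at this
    · exact this
    · intro i
      have hi : i = 0 := Subsingleton.elim _ _
      subst hi
      have : (Fin.natAdd m (0 : Fin 1)) = Fin.last m := rfl
      rw [this]
      simp only [Function.comp, Fin.val_last, lt_irrefl, if_false, Fin.succ_last, Fin.snoc_last]
    · intro p hp
      have h3 : ((Fin.castAdd 1 (ix p) : Fin (m + 1)) : ℕ) < m := (ix p).2
      have h4 : (Fin.castAdd 1 (ix p) : Fin (m + 1)) = Fin.castSucc (ix p) := rfl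
      simp only [Function.comp, h3, if_true]
      rw [Fin.snoc_castSucc, h4, Fin.snoc_castSucc, hpr p hp]

end Machinery
end NFUweak

open FirstOrder Language
namespace NFUweak

/-! ## Definability rules -/
section Rules
set_option linter.all false
variable {M : Type} [LNFU.Structure M]

def up {n : ℕ} (w : Fin (n + 1) → M) : Fin n → M := Fin.init w
def lst {n : ℕ} (w : Fin (n + 1) → M) : M := w (Fin.last n)
def lsnoc {n : ℕ} (τ : Fin n → ℕ) (k : ℕ) : Fin (n + 1) → ℕ := Fin.snoc (α := fun _ => ℕ) τ k

theorem up_snoc {n : ℕ} (v : Fin n → M) (a : M) : up (Fin.snoc v a : Fin (n + 1) → M) = v :=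
  Fin.init_snoc ..
theorem lst_snoc {n : ℕ} (v : Fin n → M) (a : M) : lst (Fin.snoc v a : Fin (n + 1) → M) = a :=
  Fin.snoc_last ..

def TDef {n : ℕ} (τ : Fin n → ℕ) (k : ℕ) (t : (Fin n → M) → M) : Prop :=
  ∃ s : PTm M n, s.lev τ k ∧ ∀ v, s.ev v = t v
def SDef {n : ℕ} (τ : Fin n → ℕ) (P : (Fin n → M) → Prop) : Prop :=
  ∃ φ : PFm M n, φ.strat τ ∧ ∀ v, φ.ev v ↔ P v

def PTm.wk {n : ℕ} : PTm M n → PTm M (n + 1)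
  | .var i => .var i.castSucc
  | .cst a k => .cst a k
  | .pair s t => .pair s.wk t.wk

theorem PTm.wk_ev {n : ℕ} (s : PTm M n) (w : Fin (n + 1) → M) : s.wk.ev w = s.ev (up w) := by
  induction s with
  | var i => rfl
  | cst a k => rfl
  | pair s t ihs iht => simp only [PTm.wk, PTm.ev, ihs, iht]

theorem PTm.wk_lev {n : ℕ} (s : PTm M n) (τ : Fin n → ℕ) (k j : ℕ) (h : s.lev τ k) :
    s.wk.lev (lsnoc τ j) k := by
  induction s with
  | var i => exact (Fin.snoc_castSucc (α := fun _ => ℕ) j τ i).trans h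
  | cst a k => exact h
  | pair s t ihs iht => exact ⟨ihs h.1, iht h.2⟩

variable {n : ℕ} {τ : Fin n → ℕ} {k k0 k1 k2 k3 k4 k5 k6 k7 k8 k9 : ℕ}

theorem tdef_cst (a : M) : TDef τ k (fun _ => a) := ⟨.cst a k, rfl, fun _ => rfl⟩
theorem tdef_pair {s t : (Fin n → M) → M} (hs : TDef τ k s) (ht : TDef τ k t) :
    TDef τ k (fun v => spair (s v) (t v)) := by
  obtain ⟨s', hs, hs'⟩ := hs
  obtain ⟨t', ht, ht'⟩ := ht
  exact ⟨.pair s' t', ⟨hs, ht⟩, fun v => by simp only [PTm.ev, hs', ht']⟩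
theorem tdef_v0 : TDef (M := M) (lsnoc τ k) k (fun w => lst w) :=
  ⟨.var (Fin.last _), Fin.snoc_last (α := fun _ => ℕ) .., fun _ => rfl⟩
theorem tdef_w0 {s : (Fin n → M) → M} (hs : TDef τ k s) : TDef τ k s := hs
theorem tdef_w1 {s : (Fin n → M) → M} (hs : TDef τ k s) :
    TDef (lsnoc τ k0) k (fun w => s (up w)) := by
  obtain ⟨s', hs, hs'⟩ := hs
  exact ⟨s'.wk, s'.wk_lev _ _ _ hs, fun w => by rw [PTm.wk_ev, hs']⟩
theorem tdef_w2 {s : (Fin n → M) → M} (hs : TDef τ k s) :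
    TDef (lsnoc (lsnoc τ k0) k1) k (fun w => s (up (up w))) := tdef_w1 (tdef_w1 hs)
theorem tdef_w3 {s : (Fin n → M) → M} (hs : TDef τ k s) :
    TDef (lsnoc (lsnoc (lsnoc τ k0) k1) k2) k (fun w => s (up (up (up w)))) := tdef_w1 (tdef_w2 hs)
theorem tdef_w4 {s : (Fin n → M) → M} (hs : TDef τ k s) :
    TDef (lsnoc (lsnoc (lsnoc (lsnoc τ k0) k1) k2) k3) k (fun w => s (up (up (up (up w))))) := tdef_w1 (tdef_w3 hs)
theorem tdef_w5 {s : (Fin n → M) → M} (hs : TDef τ k s) :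
    TDef (lsnoc (lsnoc (lsnoc (lsnoc (lsnoc τ k0) k1) k2) k3) k4) k (fun w => s (up (up (up (up (up w)))))) := tdef_w1 (tdef_w4 hs)
theorem tdef_w6 {s : (Fin n → M) → M} (hs : TDef τ k s) :
    TDef (lsnoc (lsnoc (lsnoc (lsnoc (lsnoc (lsnoc τ k0) k1) k2) k3) k4) k5) k (fun w => s (up (up (up (up (up (up w))))))) := tdef_w1 (tdef_w5 hs)
theorem tdef_w7 {s : (Fin n → M) → M} (hs : TDef τ k s) :
    TDef (lsnoc (lsnoc (lsnoc (lsnoc (lsnoc (lsnoc (lsnoc τ k0) k1) k2) k3) k4) k5) k6) k (fun w => s (up (up (up (up (up (up (up w)))))))) := tdef_w1 (tdef_w6 hs)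
theorem tdef_w8 {s : (Fin n → M) → M} (hs : TDef τ k s) :
    TDef (lsnoc (lsnoc (lsnoc (lsnoc (lsnoc (lsnoc (lsnoc (lsnoc τ k0) k1) k2) k3) k4) k5) k6) k7) k (fun w => s (up (up (up (up (up (up (up (up w))))))))) := tdef_w1 (tdef_w7 hs)
theorem tdef_w9 {s : (Fin n → M) → M} (hs : TDef τ k s) :
    TDef (lsnoc (lsnoc (lsnoc (lsnoc (lsnoc (lsnoc (lsnoc (lsnoc (lsnoc τ k0) k1) k2) k3) k4) k5) k6) k7) k8) k (fun w => s (up (up (up (up (up (up (up (up (up w)))))))))) := tdef_w1 (tdef_w8 hs)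
theorem tdef_w10 {s : (Fin n → M) → M} (hs : TDef τ k s) :
    TDef (lsnoc (lsnoc (lsnoc (lsnoc (lsnoc (lsnoc (lsnoc (lsnoc (lsnoc (lsnoc τ k0) k1) k2) k3) k4) k5) k6) k7) k8) k9) k (fun w => s (up (up (up (up (up (up (up (up (up (up w))))))))))) := tdef_w1 (tdef_w9 hs)
theorem tdef_v1 : TDef (M := M) (lsnoc (lsnoc τ k) k0) k (fun w => lst (up w)) :=
  tdef_w1 tdef_v0
theorem tdef_v2 : TDef (M := M) (lsnoc (lsnoc (lsnoc τ k) k0) k1) k (fun w => lst (up (up w))) :=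
  tdef_w2 tdef_v0
theorem tdef_v3 : TDef (M := M) (lsnoc (lsnoc (lsnoc (lsnoc τ k) k0) k1) k2) k (fun w => lst (up (up (up w)))) :=
  tdef_w3 tdef_v0
theorem tdef_v4 : TDef (M := M) (lsnoc (lsnoc (lsnoc (lsnoc (lsnoc τ k) k0) k1) k2) k3) k (fun w => lst (up (up (up (up w))))) :=
  tdef_w4 tdef_v0
theorem tdef_v5 : TDef (M := M) (lsnoc (lsnoc (lsnoc (lsnoc (lsnoc (lsnoc τ k) k0) k1) k2) k3) k4) k (fun w => lst (up (up (up (up (up w)))))) :=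
  tdef_w5 tdef_v0
theorem tdef_v6 : TDef (M := M) (lsnoc (lsnoc (lsnoc (lsnoc (lsnoc (lsnoc (lsnoc τ k) k0) k1) k2) k3) k4) k5) k (fun w => lst (up (up (up (up (up (up w))))))) :=
  tdef_w6 tdef_v0
theorem tdef_v7 : TDef (M := M) (lsnoc (lsnoc (lsnoc (lsnoc (lsnoc (lsnoc (lsnoc (lsnoc τ k) k0) k1) k2) k3) k4) k5) k6) k (fun w => lst (up (up (up (up (up (up (up w)))))))) :=
  tdef_w7 tdef_v0
theorem tdef_v8 : TDef (M := M) (lsnoc (lsnoc (lsnoc (lsnoc (lsnoc (lsnoc (lsnoc (lsnoc (lsnoc τ k) k0) k1) k2) k3) k4) k5) k6) k7) k (fun w => lst (up (up (up (up (up (up (up (up w))))))))) :=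
  tdef_w8 tdef_v0
theorem tdef_v9 : TDef (M := M) (lsnoc (lsnoc (lsnoc (lsnoc (lsnoc (lsnoc (lsnoc (lsnoc (lsnoc (lsnoc τ k) k0) k1) k2) k3) k4) k5) k6) k7) k8) k (fun w => lst (up (up (up (up (up (up (up (up (up w)))))))))) :=
  tdef_w9 tdef_v0
theorem tdef_v10 : TDef (M := M) (lsnoc (lsnoc (lsnoc (lsnoc (lsnoc (lsnoc (lsnoc (lsnoc (lsnoc (lsnoc (lsnoc τ k) k0) k1) k2) k3) k4) k5) k6) k7) k8) k9) k (fun w => lst (up (up (up (up (up (up (up (up (up (up w))))))))))) :=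
  tdef_w10 tdef_v0

theorem sdef_mem {s t : (Fin n → M) → M} (hs : TDef τ k s) (ht : TDef τ (k + 1) t) :
    SDef τ (fun v => smem (s v) (t v)) := by
  obtain ⟨s', hs, hs'⟩ := hs
  obtain ⟨t', ht, ht'⟩ := ht
  exact ⟨.mem s' t', ⟨k, hs, ht⟩, fun v => by simp only [PFm.ev, hs', ht']⟩
theorem sdef_eq {s t : (Fin n → M) → M} (hs : TDef τ k s) (ht : TDef τ k t) :
    SDef τ (fun v => s v = t v) := by
  obtain ⟨s', hs, hs'⟩ := hs
  obtain ⟨t', ht, ht'⟩ := ht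
  exact ⟨.eq s' t', ⟨k, hs, ht⟩, fun v => by simp only [PFm.ev, hs', ht']⟩
theorem sdef_sset {s : (Fin n → M) → M} (hs : TDef τ k s) : SDef τ (fun v => sset (s v)) := by
  obtain ⟨s', hs, hs'⟩ := hs
  exact ⟨.st s', ⟨k, hs⟩, fun v => by simp only [PFm.ev, hs']⟩
theorem sdef_imp {P Q : (Fin n → M) → Prop} (hP : SDef τ P) (hQ : SDef τ Q) :
    SDef τ (fun v => P v → Q v) := by
  obtain ⟨s', hs, hs'⟩ := hP
  obtain ⟨t', ht, ht'⟩ := hQ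
  exact ⟨.imp s' t', ⟨hs, ht⟩, fun v => by simp only [PFm.ev, hs', ht']⟩
theorem sdef_prop (p : Prop) : SDef (M := M) τ (fun _ => p) := by
  by_cases h : p
  · exact ⟨.imp .fal .fal, ⟨trivial, trivial⟩, fun v => by simp [PFm.ev, h]⟩
  · exact ⟨.fal, trivial, fun v => by simp [PFm.ev, h]⟩
theorem SDef.congr {P Q : (Fin n → M) → Prop} (hP : SDef τ P) (h : ∀ v, P v ↔ Q v) : SDef τ Q := by
  obtain ⟨s', hs, hs'⟩ := hP
  exact ⟨s', hs, fun v => (hs' v).trans (h v)⟩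
theorem sdef_not {P : (Fin n → M) → Prop} (hP : SDef τ P) : SDef τ (fun v => ¬ P v) :=
  sdef_imp hP (sdef_prop False)
theorem sdef_ne {s t : (Fin n → M) → M} (hs : TDef τ k s) (ht : TDef τ k t) :
    SDef τ (fun v => s v ≠ t v) := sdef_not (sdef_eq hs ht)
theorem sdef_and {P Q : (Fin n → M) → Prop} (hP : SDef τ P) (hQ : SDef τ Q) :
    SDef τ (fun v => P v ∧ Q v) :=
  (sdef_not (sdef_imp hP (sdef_not hQ))).congr fun v => by tauto
theorem sdef_or {P Q : (Fin n → M) → Prop} (hP : SDef τ P) (hQ : SDef τ Q) :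
    SDef τ (fun v => P v ∨ Q v) :=
  (sdef_imp (sdef_not hP) hQ).congr fun v => by tauto
theorem sdef_iff {P Q : (Fin n → M) → Prop} (hP : SDef τ P) (hQ : SDef τ Q) :
    SDef τ (fun v => P v ↔ Q v) :=
  (sdef_and (sdef_imp hP hQ) (sdef_imp hQ hP)).congr fun v => by tauto
theorem sdef_all {P : (Fin n → M) → M → Prop} (k : ℕ)
    (h : SDef (lsnoc τ k) (fun w => P (up w) (lst w))) : SDef τ (fun v => ∀ y, P v y) := by
  obtain ⟨s', hs, hs'⟩ := h
  refine ⟨.all s', ⟨k, hs⟩, fun v => ?_⟩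
  simp only [PFm.ev, hs', up_snoc, lst_snoc]
theorem sdef_ex {P : (Fin n → M) → M → Prop} (k : ℕ)
    (h : SDef (lsnoc τ k) (fun w => P (up w) (lst w))) : SDef τ (fun v => ∃ y, P v y) :=
  (sdef_not (sdef_all (P := fun v y => ¬ P v y) k (sdef_not h))).congr fun v => by simp


theorem by_rules {p : Prop} (h : p := by
    repeat' with_reducible first
      | (apply tdef_w0; assumption) | (apply tdef_cst; done)
      | apply tdef_v0 | apply tdef_v1 | apply tdef_v2 | apply tdef_v3 | apply tdef_v4 | apply tdef_v5 | apply tdef_v6 | apply tdef_v7 | apply tdef_v8 | apply tdef_v9 | apply tdef_v10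
      | apply tdef_pair
      | (apply tdef_w1; assumption) | (apply tdef_w2; assumption) | (apply tdef_w3; assumption) | (apply tdef_w4; assumption) | (apply tdef_w5; assumption)
      | (apply tdef_w6; assumption) | (apply tdef_w7; assumption) | (apply tdef_w8; assumption) | (apply tdef_w9; assumption) | (apply tdef_w10; assumption)
      | apply sdef_prop | apply sdef_all | apply sdef_ex | apply sdef_and | apply sdef_or
      | apply sdef_iff | apply sdef_not | apply sdef_ne | apply sdef_mem | apply sdef_eq
      | apply sdef_sset
      | apply sdef_imp
    all_goals exact (0 : ℕ)) : p := h

section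
variable {s t r q u : (Fin n → M) → M}
theorem sdef_isSingletonOf (hs : TDef τ (k + 1) s) (ht : TDef τ (k) t) :
    SDef τ (fun v => isSingletonOf (s v) (t v)) := by
  unfold isSingletonOf
  exact by_rules
theorem sdef_isEmptySet (hs : TDef τ (k + 1) s) :
    SDef τ (fun v => isEmptySet (s v)) := by
  unfold isEmptySet
  exact by_rules
theorem sdef_isFunc (hs : TDef τ (k + 1) s) (ht : TDef τ (k + 1) t) (hr : TDef τ (k + 1) r) :
    SDef τ (fun v => isFunc (s v) (t v) (r v)) := by
  unfold isFunc
  exact by_rules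
theorem sdef_isInjFunc (hs : TDef τ (k + 1) s) (ht : TDef τ (k + 1) t) (hr : TDef τ (k + 1) r) :
    SDef τ (fun v => isInjFunc (s v) (t v) (r v)) := by
  unfold isInjFunc isFunc
  exact by_rules
theorem sdef_isBijFunc (hs : TDef τ (k + 1) s) (ht : TDef τ (k + 1) t) (hr : TDef τ (k + 1) r) :
    SDef τ (fun v => isBijFunc (s v) (t v) (r v)) := by
  unfold isBijFunc isInjFunc isFunc
  exact by_rules
theorem sdef_equipollent (hs : TDef τ (k + 1) s) (ht : TDef τ (k + 1) t) :
    SDef τ (fun v => equipollent (s v) (t v)) := by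
  unfold equipollent isBijFunc isInjFunc isFunc
  exact by_rules
theorem sdef_isIotaImageOf (hs : TDef τ (k + 1 + 1) s) (ht : TDef τ (k + 1) t) :
    SDef τ (fun v => isIotaImageOf (s v) (t v)) := by
  unfold isIotaImageOf isSingletonOf
  exact by_rules
theorem sdef_isZeroCard (hs : TDef τ (k + 1 + 1) s) :
    SDef τ (fun v => isZeroCard (s v)) := by
  unfold isZeroCard
  exact by_rules
theorem sdef_isSuccOf (hs : TDef τ (k + 1 + 1) s) (ht : TDef τ (k + 1 + 1) t) :
    SDef τ (fun v => isSuccOf (s v) (t v)) := by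
  unfold isSuccOf
  exact by_rules
theorem sdef_isInductiveSet (hs : TDef τ (k + 1 + 1 + 1) s) :
    SDef τ (fun v => isInductiveSet (s v)) := by
  unfold isInductiveSet isZeroCard isSuccOf
  exact by_rules
theorem sdef_isPowerSetOf (hs : TDef τ (k + 1 + 1) s) (ht : TDef τ (k + 1) t) :
    SDef τ (fun v => isPowerSetOf (s v) (t v)) := by
  unfold isPowerSetOf
  exact by_rules
theorem sdef_isRel (hs : TDef τ (k + 1) s) :
    SDef τ (fun v => isRel (s v)) := by
  unfold isRel
  exact by_rules
theorem sdef_inField (hs : TDef τ (k) s) (ht : TDef τ (k + 1) t) :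
    SDef τ (fun v => inField (s v) (t v)) := by
  unfold inField
  exact by_rules
theorem sdef_isFieldSetOf (hs : TDef τ (k + 1) s) (ht : TDef τ (k + 1) t) :
    SDef τ (fun v => isFieldSetOf (s v) (t v)) := by
  unfold isFieldSetOf inField
  exact by_rules
theorem sdef_isBFEXT (hs : TDef τ (k + 1) s) :
    SDef τ (fun v => isBFEXT (s v)) := by
  unfold isBFEXT isRel inField
  exact by_rules
theorem sdef_inSeg (hs : TDef τ (k) s) (ht : TDef τ (k + 1) t) (hr : TDef τ (k) r) :
    SDef τ (fun v => inSeg (s v) (t v) (r v)) := by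
  unfold inSeg inField
  exact by_rules
theorem sdef_isSegOf (hs : TDef τ (k + 1) s) (ht : TDef τ (k + 1) t) (hr : TDef τ (k) r) :
    SDef τ (fun v => isSegOf (s v) (t v) (r v)) := by
  unfold isSegOf inSeg inField
  exact by_rules
theorem sdef_isTopOf (hs : TDef τ (k) s) (ht : TDef τ (k + 1) t) :
    SDef τ (fun v => isTopOf (s v) (t v)) := by
  unfold isTopOf isSegOf inSeg inField
  exact by_rules
theorem sdef_isIsoRel (hs : TDef τ (k + 1) s) (ht : TDef τ (k + 1) t) (hr : TDef τ (k + 1) r) :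
    SDef τ (fun v => isIsoRel (s v) (t v) (r v)) := by
  unfold isIsoRel inField
  exact by_rules
theorem sdef_relIso (hs : TDef τ (k + 1) s) (ht : TDef τ (k + 1) t) :
    SDef τ (fun v => relIso (s v) (t v)) := by
  unfold relIso isIsoRel inField
  exact by_rules

theorem by_rules2 {p : Prop} (h : p := by
    repeat' with_reducible first
      | (apply tdef_w0; assumption) | (apply tdef_cst; done)
      | apply tdef_v0 | apply tdef_v1 | apply tdef_v2 | apply tdef_v3 | apply tdef_v4 | apply tdef_v5 | apply tdef_v6 | apply tdef_v7 | apply tdef_v8 | apply tdef_v9 | apply tdef_v10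
      | apply tdef_pair
      | (apply tdef_w1; assumption) | (apply tdef_w2; assumption) | (apply tdef_w3; assumption) | (apply tdef_w4; assumption) | (apply tdef_w5; assumption)
      | (apply tdef_w6; assumption) | (apply tdef_w7; assumption) | (apply tdef_w8; assumption) | (apply tdef_w9; assumption) | (apply tdef_w10; assumption)
      | apply sdef_prop | apply sdef_all | apply sdef_ex | apply sdef_and | apply sdef_or
      | apply sdef_iff | apply sdef_not | apply sdef_ne | apply sdef_mem | apply sdef_eq
      | apply sdef_sset
      | apply sdef_equipollent | apply sdef_isInductiveSet | apply sdef_isBFEXT | apply sdef_isSegOf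
      | apply sdef_inField | apply sdef_isTopOf | apply sdef_relIso
      | apply sdef_imp
    all_goals exact (0 : ℕ)) : p := h
theorem sdef_isCardOf (hs : TDef τ (k + 1 + 1) s) (ht : TDef τ (k + 1) t) :
    SDef τ (fun v => isCardOf (s v) (t v)) := by
  unfold isCardOf
  exact by_rules2
theorem sdef_isNat (hs : TDef τ (k + 1 + 1) s) :
    SDef τ (fun v => isNat (s v)) := by
  unfold isNat
  exact by_rules2
theorem sdef_inOmega (hs : TDef τ (k + 1) s) :
    SDef τ (fun v => inOmega (s v)) := by
  unfold inOmega
  exact by_rules2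
theorem sdef_isTypeOf (hs : TDef τ (k + 1 + 1) s) (ht : TDef τ (k + 1) t) :
    SDef τ (fun v => isTypeOf (s v) (t v)) := by
  unfold isTypeOf
  exact by_rules2
theorem sdef_inBF (hs : TDef τ (k + 1 + 1) s) :
    SDef τ (fun v => inBF (s v)) := by
  unfold inBF inOmega isTypeOf
  exact by_rules2
theorem sdef_erel (hs : TDef τ (k + 1 + 1) s) (ht : TDef τ (k + 1 + 1) t) :
    SDef τ (fun v => erel (s v) (t v)) := by
  unfold erel
  exact by_rules2
end

theorem comp [NFUModel M] (P : M → Prop)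
    (h : ∃ k, SDef (lsnoc (fun _ : Fin 0 => 0) k) (fun w : Fin 1 → M => P (lst w)) := by
      apply Exists.intro
      beta_reduce
      repeat' with_reducible first
        | (apply tdef_w0; assumption) | (apply tdef_cst; done)
        | apply tdef_v0 | apply tdef_v1 | apply tdef_v2 | apply tdef_v3 | apply tdef_v4 | apply tdef_v5 | apply tdef_v6 | apply tdef_v7 | apply tdef_v8 | apply tdef_v9 | apply tdef_v10
        | apply tdef_pair
        | (apply tdef_w1; assumption) | (apply tdef_w2; assumption) | (apply tdef_w3; assumption) | (apply tdef_w4; assumption) | (apply tdef_w5; assumption)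
        | (apply tdef_w6; assumption) | (apply tdef_w7; assumption) | (apply tdef_w8; assumption) | (apply tdef_w9; assumption) | (apply tdef_w10; assumption)
        | apply sdef_prop | apply sdef_all | apply sdef_ex | apply sdef_and | apply sdef_or
        | apply sdef_iff | apply sdef_not | apply sdef_ne | apply sdef_mem | apply sdef_eq
        | apply sdef_sset
        | apply sdef_isSingletonOf | apply sdef_isEmptySet | apply sdef_isFunc | apply sdef_isInjFunc
        | apply sdef_isBijFunc | apply sdef_equipollent | apply sdef_isCardOf | apply sdef_isIotaImageOf
        | apply sdef_isZeroCard | apply sdef_isSuccOf | apply sdef_isInductiveSet | apply sdef_isNat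
        | apply sdef_isPowerSetOf | apply sdef_isRel | apply sdef_inField | apply sdef_isFieldSetOf
        | apply sdef_isBFEXT | apply sdef_inSeg | apply sdef_isSegOf | apply sdef_inOmega
        | apply sdef_isTopOf | apply sdef_isIsoRel | apply sdef_relIso | apply sdef_isTypeOf
        | apply sdef_inBF | apply sdef_erel
        | apply sdef_imp
      all_goals exact (0 : ℕ)) :
    ∃ y : M, sset y ∧ ∀ x, smem x y ↔ P x := by
  obtain ⟨k, φ, h1, h2⟩ := h
  obtain ⟨y, hy, hy'⟩ := φ.comprehension _ h1
  exact ⟨y, hy, fun x => (hy' x).trans (h2 _)⟩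

theorem ext [NFUModel M] {x y : M} (hx : sset x) (hy : sset y) (h : ∀ z, smem z x ↔ smem z y) :
    x = y := by
  have h1 := (NFUModel.out (M := M)).realize_of_mem weakExtAx (Or.inl (Or.inl rfl))
  simp [weakExtAx, Sentence.Realize, Formula.Realize, BoundedFormula.realize_rel₁,
    BoundedFormula.realize_rel₂] at h1
  have h2 := h1 x y
  simp [Fin.snoc] at h2
  exact (h2 hx hy).2 h

theorem spair_inj [NFUModel M] {x y z w : M} (h : spair x y = spair z w) : x = z ∧ y = w := by
  have h1 := (NFUModel.out (M := M)).realize_of_mem pairingAx (Or.inl (Or.inr rfl))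
  simp [pairingAx, Sentence.Realize, Formula.Realize, BoundedFormula.realize_rel₁,
    BoundedFormula.realize_rel₂] at h1
  have h2 := h1 x y z w
  simp [Fin.snoc] at h2
  exact h2 h

theorem spair_iff [NFUModel M] {x y z w : M} : spair x y = spair z w ↔ x = z ∧ y = w :=
  ⟨spair_inj, fun h => by rw [h.1, h.2]⟩


end Rules
end NFUweak

open FirstOrder Language
namespace NFUweak

notation "⦅" x "," y "⦆" => spair x y
infix:50 "ε" => smem

/-! ## Basic sets, equipollence and natural numbers -/
section Nats
set_option linter.all false
variable {M : Type} [LNFU.Structure M] [NFUModel M]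

theorem compR (Q : M → M → Prop)
    (h : ∃ y : M, sset y ∧ ∀ x, x ε y ↔ ∃ a b, x = ⦅a,b⦆ ∧ Q a b := by exact comp _) :
    ∃ f : M, sset f ∧ (∀ p, p ε f → ∃ a b, p = ⦅a,b⦆ ∧ Q a b) ∧ ∀ a b, ⦅a,b⦆ ε f ↔ Q a b := by
  obtain ⟨f, h1, h2⟩ := h
  refine ⟨f, h1, fun p hp => (h2 p).1 hp, fun a b => ⟨fun h => ?_, fun h => (h2 _).2 ⟨a, b, rfl, h⟩⟩⟩
  obtain ⟨a', b', e, hq⟩ := (h2 _).1 h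
  obtain ⟨rfl, rfl⟩ := spair_inj e
  exact hq

theorem ex_sing (x : M) : ∃ s : M, isSingletonOf s x := comp _
theorem ex_empty : ∃ e : M, isEmptySet e := by
  obtain ⟨e, h1, h2⟩ := comp (M := M) (fun _ => False)
  exact ⟨e, h1, fun z hz => (h2 z).1 hz⟩
theorem sing_inj {s x y : M} (h : isSingletonOf s x) (h' : isSingletonOf s y) : x = y :=
  (h'.2 x).1 ((h.2 x).2 rfl)
theorem sing_uniq {s t x : M} (h : isSingletonOf s x) (h' : isSingletonOf t x) : s = t :=
  ext h.1 h'.1 fun z => (h.2 z).trans (h'.2 z).symm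
theorem empty_uniq {s t : M} (h : isEmptySet s) (h' : isEmptySet t) : s = t :=
  ext h.1 h'.1 fun z => ⟨fun a => (h.2 z a).elim, fun a => (h'.2 z a).elim⟩

theorem mkInj {X Y : M} (Q : M → M → Prop) (h1 : ∀ a b, Q a b → a ε X ∧ b ε Y)
    (h2 : ∀ a, a ε X → ∃ b, Q a b) (h3 : ∀ a b b', Q a b → Q a b' → b = b')
    (h4 : ∀ a a' b, Q a b → Q a' b → a = a')
    (h : ∃ y : M, sset y ∧ ∀ x, x ε y ↔ ∃ a b, x = ⦅a,b⦆ ∧ Q a b := by exact comp _) :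
    ∃ f, isInjFunc f X Y ∧ ∀ a b, ⦅a,b⦆ ε f ↔ Q a b := by
  obtain ⟨f, f1, f2, f3⟩ := compR Q h
  refine ⟨f, ⟨⟨f1, ?_, ?_, ?_⟩, ?_⟩, f3⟩
  · intro p hp; obtain ⟨a, b, rfl, hq⟩ := f2 p hp; exact ⟨a, b, rfl, h1 _ _ hq⟩
  · intro a ha; obtain ⟨b, hb⟩ := h2 a ha; exact ⟨b, (f3 _ _).2 hb⟩
  · intro a b b' x y; exact h3 a b b' ((f3 _ _).1 x) ((f3 _ _).1 y)
  · intro a b b' x y; exact h4 a b b' ((f3 _ _).1 x) ((f3 _ _).1 y)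

theorem mkBij {X Y : M} (Q : M → M → Prop) (h1 : ∀ a b, Q a b → a ε X ∧ b ε Y)
    (h2 : ∀ a, a ε X → ∃ b, Q a b) (h3 : ∀ a b b', Q a b → Q a b' → b = b')
    (h4 : ∀ a a' b, Q a b → Q a' b → a = a') (h5 : ∀ b, b ε Y → ∃ a, Q a b)
    (h : ∃ y : M, sset y ∧ ∀ x, x ε y ↔ ∃ a b, x = ⦅a,b⦆ ∧ Q a b := by exact comp _) :
    equipollent X Y := by
  obtain ⟨f, hf, hf'⟩ := mkInj Q h1 h2 h3 h4 h
  refine ⟨f, hf, fun b hb => ?_⟩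
  obtain ⟨a, ha⟩ := h5 b hb
  exact ⟨a, (hf' _ _).2 ha⟩

theorem bij_mem {f X Y a b : M} (h : isInjFunc f X Y) (hab : ⦅a,b⦆ ε f) : a ε X ∧ b ε Y := by
  obtain ⟨a', b', e, h1, h2⟩ := h.1.2.1 _ hab
  obtain ⟨rfl, rfl⟩ := spair_inj e
  exact ⟨h1, h2⟩

theorem eqp_refl (X : M) : equipollent X X :=
  mkBij (fun a b => a ε X ∧ a = b) (by rintro a b ⟨h, rfl⟩; exact ⟨h, h⟩) (fun a h => ⟨a, h, rfl⟩)
    (by rintro a b b' ⟨_, rfl⟩ ⟨_, rfl⟩; rfl) (by rintro a b b' ⟨_, rfl⟩ ⟨_, rfl⟩; rfl)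
    (fun a h => ⟨a, h, rfl⟩)
theorem eqp_symm {X Y : M} (h : equipollent X Y) : equipollent Y X := by
  obtain ⟨f, hf⟩ := h
  exact mkBij (fun a b => ⦅b,a⦆ ε f) (fun a b h => (bij_mem hf.1 h).symm)
    hf.2 (fun a b b' => hf.1.2 _ _ _) (fun a a' b => hf.1.1.2.2.2 _ _ _) hf.1.1.2.2.1
theorem eqp_trans {X Y Z : M} (h : equipollent X Y) (h' : equipollent Y Z) : equipollent X Z := by
  obtain ⟨f, hf⟩ := h
  obtain ⟨g, hg⟩ := h'
  refine mkBij (fun a c => ∃ b, ⦅a,b⦆ ε f ∧ ⦅b,c⦆ ε g) ?_ ?_ ?_ ?_ ?_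
  · rintro a c ⟨b, h1, h2⟩; exact ⟨(bij_mem hf.1 h1).1, (bij_mem hg.1 h2).2⟩
  · intro a ha; obtain ⟨b, hb⟩ := hf.1.1.2.2.1 a ha
    obtain ⟨c, hc⟩ := hg.1.1.2.2.1 b (bij_mem hf.1 hb).2
    exact ⟨c, b, hb, hc⟩
  · rintro a c c' ⟨b, h1, h2⟩ ⟨b', h3, h4⟩
    obtain rfl := hf.1.1.2.2.2 _ _ _ h1 h3
    exact hg.1.1.2.2.2 _ _ _ h2 h4
  · rintro a c c' ⟨b, h1, h2⟩ ⟨b', h3, h4⟩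
    obtain rfl := hg.1.2 _ _ _ h2 h4
    exact hf.1.2 _ _ _ h1 h3
  · intro c hc; obtain ⟨b, hb⟩ := hg.2 c hc
    obtain ⟨a, ha⟩ := hf.2 b (bij_mem hg.1 hb).1
    exact ⟨a, b, ha, hb⟩
theorem eqp_empty {X Y : M} (h : equipollent X Y) (hY : ∀ w, ¬ w ε Y) : ∀ w, ¬ w ε X := by
  intro w hw
  obtain ⟨f, hf⟩ := h
  obtain ⟨b, hb⟩ := hf.1.1.2.2.1 w hw
  exact hY _ (bij_mem hf.1 hb).2
theorem eqp_empties {X Y : M} (hX : ∀ w, ¬ w ε X) (hY : ∀ w, ¬ w ε Y) : equipollent X Y :=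
  mkBij (fun a b => a ε X ∧ b ε Y) (fun a b h => h) (fun a h => (hX a h).elim)
    (fun a b b' h => (hX _ h.1).elim) (fun a b b' h => (hX _ h.1).elim) (fun a h => (hY a h).elim)
/-- same members, so equipollent -/
theorem eqp_same {X Y : M} (h : ∀ w, w ε X ↔ w ε Y) : equipollent X Y :=
  mkBij (fun a b => a ε X ∧ a = b) (by rintro a b ⟨h', rfl⟩; exact ⟨h', (h _).1 h'⟩)
    (fun a h => ⟨a, h, rfl⟩)
    (by rintro a b b' ⟨_, rfl⟩ ⟨_, rfl⟩; rfl) (by rintro a b b' ⟨_, rfl⟩ ⟨_, rfl⟩; rfl)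
    (fun a h' => ⟨a, (h _).2 h', rfl⟩)

theorem eqp_remove {A B A' B' z w : M} (h : equipollent A B) (hz : z ε A) (hw : w ε B)
    (hA : ∀ x, x ε A' ↔ x ε A ∧ x ≠ z) (hB : ∀ x, x ε B' ↔ x ε B ∧ x ≠ w) : equipollent A' B' := by
  obtain ⟨f, hf⟩ := h
  obtain ⟨⟨⟨_, _, ft, ff⟩, fi⟩, fs⟩ := id hf
  refine mkBij (fun a b => a ε A' ∧ b ε B' ∧ (⦅a,b⦆ ε f ∨ (⦅a,w⦆ ε f ∧ ⦅z,b⦆ ε f)))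
    (fun a b h => ⟨h.1, h.2.1⟩) ?_ ?_ ?_ ?_
  · intro a ha
    obtain ⟨b, hb⟩ := ft a ((hA a).1 ha).1
    obtain ⟨c, hc⟩ := ft z hz
    by_cases e : b = w
    · subst e
      refine ⟨c, ha, (hB c).2 ⟨(bij_mem hf.1 hc).2, ?_⟩, Or.inr ⟨hb, hc⟩⟩
      rintro rfl
      exact ((hA a).1 ha).2 (fi _ _ _ hb hc)
    · exact ⟨b, ha, (hB b).2 ⟨(bij_mem hf.1 hb).2, e⟩, Or.inl hb⟩
  · rintro a b b' ⟨h1, h2, h3⟩ ⟨h4, h5, h6⟩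
    rcases h3 with h3 | ⟨h3, h3'⟩ <;> rcases h6 with h6 | ⟨h6, h6'⟩
    · exact ff _ _ _ h3 h6
    · exact (((hB b).1 h2).2 (ff _ _ _ h3 h6)).elim
    · exact (((hB b').1 h5).2 (ff _ _ _ h6 h3)).elim
    · exact ff _ _ _ h3' h6'
  · rintro a a' b ⟨h1, h2, h3⟩ ⟨h4, h5, h6⟩
    rcases h3 with h3 | ⟨h3, h3'⟩ <;> rcases h6 with h6 | ⟨h6, h6'⟩
    · exact fi _ _ _ h3 h6
    · exact (((hA a).1 h1).2 (fi _ _ _ h3 h6')).elim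
    · exact (((hA a').1 h4).2 (fi _ _ _ h6 h3')).elim
    · exact fi _ _ _ h3 h6
  · intro b hb
    obtain ⟨a, ha⟩ := fs b ((hB b).1 hb).1
    by_cases e : a = z
    · subst e
      obtain ⟨c, hc⟩ := fs w hw
      refine ⟨c, (hA c).2 ⟨(bij_mem hf.1 hc).1, ?_⟩, hb, Or.inr ⟨hc, ha⟩⟩
      rintro rfl
      exact ((hB b).1 hb).2 (ff _ _ _ ha hc)
    · exact ⟨a, (hA a).2 ⟨(bij_mem hf.1 ha).1, e⟩, hb, Or.inl ha⟩

theorem eqp_extend {A B A' B' z w : M} (h : equipollent A B) (hz : ¬ z ε A) (hw : ¬ w ε B)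
    (hA : ∀ x, x ε A' ↔ x ε A ∨ x = z) (hB : ∀ x, x ε B' ↔ x ε B ∨ x = w) : equipollent A' B' := by
  obtain ⟨f, hf⟩ := h
  have hm := fun a b => bij_mem (a := a) (b := b) hf.1
  obtain ⟨⟨⟨_, _, ft, ff⟩, fi⟩, fs⟩ := hf
  refine mkBij (fun a b => ⦅a,b⦆ ε f ∨ (a = z ∧ b = w)) ?_ ?_ ?_ ?_ ?_
  · rintro a b (h | ⟨rfl, rfl⟩)
    · exact ⟨(hA _).2 (Or.inl (hm _ _ h).1), (hB _).2 (Or.inl (hm _ _ h).2)⟩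
    · exact ⟨(hA _).2 (Or.inr rfl), (hB _).2 (Or.inr rfl)⟩
  · intro a ha
    rcases (hA a).1 ha with h | rfl
    · obtain ⟨b, hb⟩ := ft a h; exact ⟨b, Or.inl hb⟩
    · exact ⟨w, Or.inr ⟨rfl, rfl⟩⟩
  · rintro a b b' (h | ⟨rfl, rfl⟩) (h' | ⟨h1, rfl⟩)
    · exact ff _ _ _ h h'
    · subst h1; exact (hz (hm _ _ h).1).elim
    · exact (hz (hm _ _ h').1).elim
    · rfl
  · rintro a a' b (h | ⟨rfl, rfl⟩) (h' | ⟨rfl, h1⟩)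
    · exact fi _ _ _ h h'
    · subst h1; exact (hw (hm _ _ h).2).elim
    · exact (hw (hm _ _ h').2).elim
    · rfl
  · intro b hb
    rcases (hB b).1 hb with h | rfl
    · obtain ⟨a, ha⟩ := fs b h; exact ⟨a, Or.inl ha⟩
    · exact ⟨z, Or.inr ⟨rfl, rfl⟩⟩

theorem ex_card (X : M) : ∃ c : M, isCardOf c X := comp _
theorem card_uniq {c c' X : M} (h : isCardOf c X) (h' : isCardOf c' X) : c = c' :=
  ext h.1 h'.1 fun z => (h.2 z).trans (h'.2 z).symm
theorem card_of_eqp {c X Y : M} (h : isCardOf c X) (e : equipollent X Y) : isCardOf c Y :=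
  ⟨h.1, fun y => (h.2 y).trans ⟨fun a => eqp_trans a e, fun a => eqp_trans a (eqp_symm e)⟩⟩
theorem card_of_mem {c X Y : M} (h : isCardOf c X) (e : Y ε c) : isCardOf c Y :=
  card_of_eqp h (eqp_symm ((h.2 Y).1 e))
theorem card_self {c X : M} (h : isCardOf c X) : X ε c := (h.2 X).2 (eqp_refl X)

theorem ex_zero : ∃ z : M, isZeroCard z := comp _
theorem zero_uniq {z z' : M} (h : isZeroCard z) (h' : isZeroCard z') : z = z' :=
  ext h.1 h'.1 fun y => (h.2 y).trans (h'.2 y).symm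
theorem ex_succ (n : M) : ∃ s : M, isSuccOf s n := comp _
theorem succ_uniq {n s s' : M} (h : isSuccOf s n) (h' : isSuccOf s' n) : s = s' :=
  ext h.1 h'.1 fun y => (h.2 y).trans (h'.2 y).symm
theorem nat_zero {z : M} (h : isZeroCard z) : isNat z := fun I hI => hI.2.1 z h
theorem nat_succ {n s : M} (hn : isNat n) (h : isSuccOf s n) : isNat s :=
  fun I hI => hI.2.2 n s (hn I hI) h

theorem nat_ind (P : M → Prop) (h0 : ∀ z, isZeroCard z → P z)
    (hs : ∀ n s, isNat n → isSuccOf s n → P n → P s)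
    (hc : ∃ y : M, sset y ∧ ∀ x, x ε y ↔ isNat x ∧ P x := by exact comp _) :
    ∀ n, isNat n → P n := by
  obtain ⟨I, h1, h2⟩ := hc
  intro n hn
  refine ((h2 n).1 (hn I ⟨h1, fun z hz => (h2 z).2 ⟨nat_zero hz, h0 z hz⟩, ?_⟩)).2
  intro a b ha hb
  obtain ⟨h3, h4⟩ := (h2 a).1 ha
  exact (h2 b).2 ⟨nat_succ h3 hb, hs a b h3 hb h4⟩

theorem ex_adj (A d : M) : ∃ B : M, sset B ∧ ∀ x, x ε B ↔ x ε A ∨ x = d := comp _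
theorem ex_del (A d : M) : ∃ B : M, sset B ∧ ∀ x, x ε B ↔ x ε A ∧ x ≠ d := comp _

theorem zero_card {z A : M} (hz : isZeroCard z) (hA : ∀ w, ¬ w ε A) : isCardOf z A :=
  ⟨hz.1, fun y => (hz.2 y).trans ⟨fun h => eqp_empties h hA, fun h => eqp_empty h hA⟩⟩

theorem succ_card {n s A B d : M} (hn : isCardOf n A) (hd : ¬ d ε A) (hs : isSuccOf s n)
    (hB : ∀ x, x ε B ↔ x ε A ∨ x = d) : isCardOf s B := by
  refine ⟨hs.1, fun y => (hs.2 y).trans ⟨?_, ?_⟩⟩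
  · rintro ⟨z, hz, e, he, he', hen⟩
    refine eqp_extend (z := z) (w := d) ((hn.2 e).1 hen) (fun h => ((he' z).1 h).2 rfl) hd ?_ hB
    intro x
    rw [he']
    constructor
    · intro hx; by_cases h : x = z
      · exact Or.inr h
      · exact Or.inl ⟨hx, h⟩
    · rintro (h | rfl)
      · exact h.1
      · exact hz
  · intro h
    obtain ⟨f, hf⟩ := id h
    obtain ⟨z, hz⟩ := hf.2 d ((hB d).2 (Or.inr rfl))
    obtain ⟨e, he, he'⟩ := ex_del y z
    refine ⟨z, (bij_mem hf.1 hz).1, e, he, he', (hn.2 e).2 ?_⟩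
    refine eqp_remove h (bij_mem hf.1 hz).1 ((hB d).2 (Or.inr rfl)) he' ?_
    intro x
    rw [hB]
    constructor
    · intro hx; exact ⟨Or.inl hx, fun e => hd (e ▸ hx)⟩
    · rintro ⟨h | h, h'⟩
      · exact h
      · exact (h' h).elim

end Nats
end NFUweak

open FirstOrder Language
namespace NFUweak

/-! ## Infinity, finite sets -/
section Fins
set_option linter.all false
variable {M : Type} [LNFU.Structure M] [NFUModel M]

theorem ex_univ : ∃ v : M, sset v ∧ ∀ x, x ε v := by
  obtain ⟨v, h1, h2⟩ := comp (M := M) (fun _ => True)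
  exact ⟨v, h1, fun x => (h2 x).2 trivial⟩

theorem nat_room : ∀ n : M, isNat n → ∃ A d, isCardOf n A ∧ ¬ d ε A := by
  obtain ⟨e, he⟩ := ex_empty (M := M)
  obtain ⟨v, hv, hv'⟩ := ex_univ (M := M)
  have hev : v ≠ e := fun h => he.2 e (h ▸ hv' e)
  have key : ∀ n : M, isNat n → ∃ A d, isCardOf n A ∧ ¬ d ε A ∧ (∀ x, ⦅e,x⦆ ε A → x ε A) ∧
      (d = ⦅v,e⦆ ∨ ∃ x, x ε A ∧ d = ⦅e,x⦆) := by
    refine nat_ind _ ?_ ?_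
    · intro z hz
      exact ⟨e, ⦅v,e⦆, zero_card hz he.2, he.2 _, fun x hx => (he.2 _ hx).elim, Or.inl rfl⟩
    · rintro n s hn hs ⟨A, d, h1, h2, h3, h4⟩
      obtain ⟨B, hB, hB'⟩ := ex_adj A d
      refine ⟨B, ⦅e,d⦆, succ_card h1 h2 hs hB', ?_, ?_, Or.inr ⟨d, (hB' d).2 (Or.inr rfl), rfl⟩⟩
      · intro h
        rcases (hB' _).1 h with h | h
        · exact h2 (h3 _ h)
        · rcases h4 with h4 | ⟨x, hx, h4⟩
          · exact hev (spair_inj (h4.symm.trans h.symm)).1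
          · obtain ⟨_, h5⟩ := spair_inj (h.trans h4)
            exact h2 (h5 ▸ hx)
      · intro x h
        refine (hB' x).2 (Or.inl ?_)
        rcases (hB' _).1 h with h | h
        · exact h3 _ h
        · rcases h4 with h4 | ⟨y, hx, h4⟩
          · exact (hev (spair_inj (h4.symm.trans h.symm)).1).elim
          · obtain ⟨_, h5⟩ := spair_inj (h.trans h4)
            exact h5 ▸ hx
  intro n hn
  obtain ⟨A, d, h1, h2, _⟩ := key n hn
  exact ⟨A, d, h1, h2⟩

theorem succ_ne_zero {n s : M} (hn : isNat n) (hs : isSuccOf s n) : ¬ isZeroCard s := by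
  intro hz
  obtain ⟨A, d, h1, h2⟩ := nat_room n hn
  obtain ⟨B, hB, hB'⟩ := ex_adj A d
  exact (hz.2 B).1 (card_self (succ_card h1 h2 hs hB')) d ((hB' d).2 (Or.inr rfl))

theorem succ_inj {n m s : M} (hn : isNat n) (hm : isNat m) (hs : isSuccOf s n) (hs' : isSuccOf s m) :
    n = m := by
  obtain ⟨A, d, h1, h2⟩ := nat_room n hn
  obtain ⟨B, hB, hB'⟩ := ex_adj A d
  obtain ⟨A', d', h1', h2'⟩ := nat_room m hm
  obtain ⟨C, hC, hC'⟩ := ex_adj A' d'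
  have e1 := succ_card h1 h2 hs hB'
  have e2 := succ_card h1' h2' hs' hC'
  have e3 := (e2.2 B).1 (card_self e1)
  have e4 : equipollent A A' := by
    refine eqp_remove e3 ((hB' d).2 (Or.inr rfl)) ((hC' d').2 (Or.inr rfl)) ?_ ?_
    · intro x; rw [hB']
      exact ⟨fun h => ⟨Or.inl h, fun e => h2 (e ▸ h)⟩, fun h => h.1.resolve_right h.2⟩
    · intro x; rw [hC']
      exact ⟨fun h => ⟨Or.inl h, fun e => h2' (e ▸ h)⟩, fun h => h.1.resolve_right h.2⟩
  exact card_uniq (card_of_eqp h1 e4) h1'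

theorem nat_card_mem {n D : M} (hn : isNat n) (h : D ε n) : isCardOf n D := by
  obtain ⟨A, d, h1, h2⟩ := nat_room n hn
  exact card_of_mem h1 h

abbrev isFin (D : M) : Prop := ∃ n, isNat n ∧ D ε n

theorem fin_ind (P : M → Prop) (h0 : ∀ D, (∀ w, ¬ w ε D) → P D)
    (hs : ∀ D d D', isFin D → d ε D' → (∀ x, x ε D ↔ x ε D' ∧ x ≠ d) → P D → P D')
    (hc : ∃ y : M, sset y ∧ ∀ x, x ε y ↔ isNat x ∧ ∀ D, D ε x → P D := by exact comp _) :
    ∀ D, isFin D → P D := by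
  have := nat_ind _ ?_ ?_ hc
  · rintro D ⟨n, hn, hD⟩; exact this n hn D hD
  · intro z hz D hD; exact h0 D ((hz.2 D).1 hD)
  · intro n s hn hs' ih D' hD'
    obtain ⟨z, hz, d, hd, hd', hdn⟩ := (hs'.2 D').1 hD'
    exact hs d z D' ⟨n, hn, hdn⟩ hz hd' (ih d hdn)

theorem fin_empty {D : M} (h : ∀ w, ¬ w ε D) : isFin D := by
  obtain ⟨z, hz⟩ := ex_zero (M := M)
  exact ⟨z, nat_zero hz, (hz.2 _).2 h⟩
theorem fin_same {D D' : M} (h : isFin D) (e : ∀ w, w ε D' ↔ w ε D) : isFin D' := by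
  obtain ⟨n, hn, hD⟩ := h
  exact ⟨n, hn, ((nat_card_mem hn hD).2 D').2 (eqp_same e)⟩
theorem fin_eqp {D D' : M} (h : isFin D) (e : equipollent D' D) : isFin D' := by
  obtain ⟨n, hn, hD⟩ := h
  exact ⟨n, hn, ((nat_card_mem hn hD).2 D').2 e⟩
theorem fin_adj {D D' d : M} (h : isFin D) (e : ∀ w, w ε D' ↔ w ε D ∨ w = d) : isFin D' := by
  by_cases hd : d ε D
  · exact fin_same h fun w => (e w).trans ⟨fun h => h.elim id fun e => e ▸ hd, Or.inl⟩
  obtain ⟨n, hn, hD⟩ := h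
  obtain ⟨s, hs⟩ := ex_succ n
  exact ⟨s, nat_succ hn hs, card_self (succ_card (nat_card_mem hn hD) hd hs e)⟩

theorem fin_sub : ∀ D : M, isFin D → ∀ B, (∀ w, w ε B → w ε D) → isFin B := by
  refine fin_ind _ ?_ ?_
  · intro D hD B hB; exact fin_empty fun w hw => hD w (hB w hw)
  · intro D d D' hD hd hDD ih B hB
    obtain ⟨C, hC, hC'⟩ := ex_del B d
    have hfC := ih C fun w hw => (hDD w).2 ⟨hB w ((hC' w).1 hw).1, ((hC' w).1 hw).2⟩
    by_cases hdB : d ε B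
    · refine fin_adj (d := d) hfC fun w => ?_
      rw [hC']
      constructor
      · intro h; by_cases e : w = d
        · exact Or.inr e
        · exact Or.inl ⟨h, e⟩
      · rintro (h | rfl)
        · exact h.1
        · exact hdB
    · refine fin_same hfC fun w => ?_
      rw [hC']
      exact ⟨fun h => ⟨h, fun e => hdB (e ▸ h)⟩, fun h => h.1⟩

theorem fin_inj {N : M} (hN : isNatSet N) : ∀ D : M, isFin D → ∃ h, isInjFunc h D N := by
  refine fin_ind _ ?_ ?_
  · intro D hD
    obtain ⟨h, hh, _⟩ := mkInj (X := D) (Y := N) (fun a b => a ε D ∧ b ε N) (fun a b h => h)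
      (fun a h => (hD a h).elim)
      (fun a b b' h => (hD _ h.1).elim) (fun a b b' h => (hD _ h.1).elim)
    exact ⟨h, hh⟩
  · rintro D d D' hD hd hDD ⟨h, hh⟩
    have hm := fun a b => bij_mem (a := a) (b := b) hh
    obtain ⟨⟨_, _, ft, ff⟩, fi⟩ := hh
    obtain ⟨z, hz⟩ := ex_zero (M := M)
    refine (mkInj (X := D') (Y := N)
      (fun a b => (∃ c, ⦅a,c⦆ ε h ∧ isSuccOf b c) ∨ (a = d ∧ b = z)) ?_ ?_ ?_ ?_).imp fun _ x => x.1
    · rintro a b (⟨c, hc, hb⟩ | ⟨rfl, rfl⟩)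
      · exact ⟨((hDD a).1 (hm _ _ hc).1).1, (hN.2 _).2 (nat_succ ((hN.2 _).1 (hm _ _ hc).2) hb)⟩
      · exact ⟨hd, (hN.2 _).2 (nat_zero hz)⟩
    · intro a ha
      by_cases e : a = d
      · exact ⟨z, Or.inr ⟨e, rfl⟩⟩
      · obtain ⟨c, hc⟩ := ft a ((hDD a).2 ⟨ha, e⟩)
        obtain ⟨b, hb⟩ := ex_succ c
        exact ⟨b, Or.inl ⟨c, hc, hb⟩⟩
    · rintro a b b' (⟨c, hc, hb⟩ | ⟨rfl, rfl⟩) (⟨c', hc', hb'⟩ | ⟨h1, rfl⟩)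
      · obtain rfl := ff _ _ _ hc hc'; exact succ_uniq hb hb'
      · subst h1; exact (((hDD _).1 (hm _ _ hc).1).2 rfl).elim
      · exact (((hDD _).1 (hm _ _ hc').1).2 rfl).elim
      · rfl
    · rintro a a' b (⟨c, hc, hb⟩ | ⟨rfl, rfl⟩) (⟨c', hc', hb'⟩ | ⟨rfl, h1⟩)
      · obtain rfl := succ_inj ((hN.2 _).1 (hm _ _ hc).2) ((hN.2 _).1 (hm _ _ hc').2) hb hb'
        exact fi _ _ _ hc hc'
      · subst h1; exact (succ_ne_zero ((hN.2 _).1 (hm _ _ hc).2) hb hz).elim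
      · exact (succ_ne_zero ((hN.2 _).1 (hm _ _ hc').2) hb' hz).elim
      · rfl

/-! ## Least fixed points and coding -/

theorem lfp_ex (B : M → Prop) (St : M → M → Prop)
    (h : ∃ y : M, sset y ∧ ∀ x, x ε y ↔ ∀ I, (∀ u, B u → u ε I) →
      (∀ u u', u ε I → St u u' → u' ε I) → x ε I := by exact comp _)
    (hinv : ∀ Q : M, ∃ y : M, sset y ∧ ∀ x, x ε y ↔ B x ∨ ∃ u, u ε Q ∧ St u x := by
      exact fun Q => comp _) :
    ∃ Q : M, (∀ u, B u → u ε Q) ∧ (∀ u u', u ε Q → St u u' → u' ε Q) ∧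
      (∀ u, u ε Q → B u ∨ ∃ u', u' ε Q ∧ St u' u) ∧
      ∀ P : M → Prop, (∃ y : M, sset y ∧ ∀ x, x ε y ↔ P x) → (∀ u, B u → P u) →
        (∀ u u', u ε Q → P u → St u u' → P u') → ∀ u, u ε Q → P u := by
  obtain ⟨Q, hQ, h⟩ := h
  have h1 : ∀ u, B u → u ε Q := fun u hu => (h u).2 fun I h1 h2 => h1 u hu
  have h2 : ∀ u u', u ε Q → St u u' → u' ε Q :=
    fun u u' hu hs => (h u').2 fun I h1 h2 => h2 u u' ((h u).1 hu I h1 h2) hs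
  have h3 : ∀ P : M → Prop, (∃ y : M, sset y ∧ ∀ x, x ε y ↔ P x) → (∀ u, B u → P u) →
        (∀ u u', u ε Q → P u → St u u' → P u') → ∀ u, u ε Q → P u := by
    rintro P ⟨I, _, hI⟩ hB hS u hu
    obtain ⟨J, hJ, hJ'⟩ := comp (fun x => x ε Q ∧ x ε I)
    refine (hI u).1 ((hJ' u).1 ((h u).1 hu J
      (fun u hu => (hJ' u).2 ⟨h1 u hu, (hI u).2 (hB u hu)⟩) ?_)).2
    intro u u' hu hs
    obtain ⟨h3, h4⟩ := (hJ' u).1 hu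
    exact (hJ' u').2 ⟨h2 _ _ h3 hs, (hI _).2 (hS _ _ h3 ((hI _).1 h4) hs)⟩
  exact ⟨Q, h1, h2, h3 _ (hinv Q) (fun u hu => Or.inl hu) fun u u' hu _ hs => Or.inr ⟨u, hu, hs⟩, h3⟩

end Fins
end NFUweak

open FirstOrder Language
namespace NFUweak

section Coding
set_option linter.all false
variable {M : Type} [LNFU.Structure M] [NFUModel M]

theorem dbl : ∃ o e : M, (∀ m, isNat m → ∃ q, ⦅m,q⦆ ε o) ∧ (∀ m, isNat m → ∃ q, ⦅m,q⦆ ε e) ∧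
    (∀ m q, ⦅m,q⦆ ε o → isNat m ∧ isNat q ∧ ¬ isZeroCard q) ∧
    (∀ m q, ⦅m,q⦆ ε e → isNat m ∧ isNat q ∧ ¬ isZeroCard q) ∧
    (∀ m m' q, ⦅m,q⦆ ε o → ⦅m',q⦆ ε o → m = m') ∧
    (∀ m m' q, ⦅m,q⦆ ε e → ⦅m',q⦆ ε e → m = m') ∧
    (∀ m m' q, ⦅m,q⦆ ε o → ⦅m',q⦆ ε e → False) := by
  obtain ⟨c1, hc1⟩ := ex_empty (M := M)
  obtain ⟨c2, hc2, hc2'⟩ := ex_univ (M := M)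
  have hne : c1 ≠ c2 := by rintro rfl; exact hc1.2 _ (hc2' c1)
  obtain ⟨z, hz⟩ := ex_zero (M := M)
  obtain ⟨n1, h1⟩ := ex_succ z
  obtain ⟨n2, h2⟩ := ex_succ n1
  have nz := nat_zero hz
  have nn1 := nat_succ nz h1
  have nn2 := nat_succ nn1 h2
  have ne12 : n1 ≠ n2 := by
    rintro rfl
    exact succ_ne_zero nz h1 ((succ_inj nz nn1 h1 h2) ▸ hz)
  obtain ⟨F, fB, fS, fI, fP⟩ := lfp_ex (M := M)
    (fun u => u = ⦅⦅c1,z⦆,n1⦆ ∨ u = ⦅⦅c2,z⦆,n2⦆)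
    (fun u u' => ∃ b m q m' r q', u = ⦅⦅b,m⦆,q⦆ ∧ isSuccOf m' m ∧ isSuccOf r q ∧ isSuccOf q' r ∧
      u' = ⦅⦅b,m'⦆,q'⦆)
  have ty : ∀ u, u ε F → ∃ b m q, u = ⦅⦅b,m⦆,q⦆ ∧ isNat m ∧ isNat q ∧ ¬ isZeroCard q := by
    refine fP _ (comp _) ?_ ?_
    · rintro u (rfl | rfl)
      · exact ⟨_, _, _, rfl, nz, nn1, succ_ne_zero nz h1⟩
      · exact ⟨_, _, _, rfl, nz, nn2, succ_ne_zero nn1 h2⟩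
    · rintro u u' hu ⟨b, m, q, rfl, h3, h4, h5⟩ ⟨b', m', q', m'', r, q'', e, h6, h7, h8, rfl⟩
      simp only [spair_iff] at e
      obtain ⟨⟨rfl, rfl⟩, rfl⟩ := e
      exact ⟨_, _, _, rfl, nat_succ h3 h6, nat_succ (nat_succ h4 h7) h8, succ_ne_zero (nat_succ h4 h7) h8⟩
  have ty' : ∀ b m q, ⦅⦅b,m⦆,q⦆ ε F → isNat m ∧ isNat q ∧ ¬ isZeroCard q := by
    intro b m q h
    obtain ⟨b', m', q', e, h⟩ := ty _ h
    simp only [spair_iff] at e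
    obtain ⟨⟨rfl, rfl⟩, rfl⟩ := e
    exact h
  have det : ∀ u, u ε F → ∀ p p' q, u = ⦅p,q⦆ → ⦅p',q⦆ ε F → p = p' := by
    refine fP _ (comp _) ?_ ?_
    · rintro u hu p p' q rfl hp'
      rcases fI _ hp' with hb | ⟨u', hu', b, m, q', m', r, q'', rfl, h6, h7, h8, e⟩
      · simp only [spair_iff] at hu hb
        rcases hu with ⟨rfl, rfl⟩ | ⟨rfl, rfl⟩ <;> rcases hb with ⟨rfl, e⟩ | ⟨rfl, e⟩
        · rfl
        · exact (ne12 e).elim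
        · exact (ne12 e.symm).elim
        · rfl
      · exfalso
        obtain ⟨a1, a2, a3⟩ := ty' _ _ _ hu'
        have a4 := nat_succ a2 h7
        simp only [spair_iff] at hu e
        obtain ⟨_, rfl⟩ := e
        rcases hu with ⟨rfl, rfl⟩ | ⟨rfl, rfl⟩
        · exact succ_ne_zero a2 h7 (succ_inj nz a4 h1 h8 ▸ hz)
        · exact a3 (succ_inj nz a2 h1 (succ_inj nn1 a4 h2 h8 ▸ h7) ▸ hz)
    · rintro u u' hu ih ⟨b', m', q', m'', r, q'', rfl, h6, h7, h8, rfl⟩ p p' q e hp'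
      simp only [spair_iff] at e
      obtain ⟨rfl, rfl⟩ := e
      obtain ⟨a1, a2, a3⟩ := ty' _ _ _ hu
      have a4 := nat_succ a2 h7
      rcases fI _ hp' with hb | ⟨u', hu', b, m, qq, mm', rr, qq'', rfl, g6, g7, g8, e⟩
      · exfalso
        simp only [spair_iff] at hb
        rcases hb with ⟨rfl, rfl⟩ | ⟨rfl, rfl⟩
        · exact succ_ne_zero a2 h7 (succ_inj nz a4 h1 h8 ▸ hz)
        · exact a3 (succ_inj nz a2 h1 (succ_inj nn1 a4 h2 h8 ▸ h7) ▸ hz)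
      · obtain ⟨b1, b2, b3⟩ := ty' _ _ _ hu'
        have b4 := nat_succ b2 g7
        simp only [spair_iff] at e
        obtain ⟨rfl, rfl⟩ := e
        obtain rfl := succ_inj a4 b4 h8 g8
        obtain rfl := succ_inj a2 b2 h7 g7
        have := ih _ _ _ rfl hu'
        simp only [spair_iff] at this
        obtain ⟨rfl, rfl⟩ := this
        rw [succ_uniq h6 g6]
  have tot : ∀ b, (b = c1 ∨ b = c2) → ∀ m, isNat m → ∃ q, ⦅⦅b,m⦆,q⦆ ε F := by
    intro b hb
    refine nat_ind _ ?_ ?_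
    · intro z' hz'
      obtain rfl := zero_uniq hz hz'
      rcases hb with rfl | rfl
      · exact ⟨_, fB _ (Or.inl rfl)⟩
      · exact ⟨_, fB _ (Or.inr rfl)⟩
    · rintro n s hn hs ⟨q, hq⟩
      obtain ⟨r, hr⟩ := ex_succ q
      obtain ⟨t, ht⟩ := ex_succ r
      exact ⟨t, fS _ _ hq ⟨_, _, _, _, _, _, rfl, hs, hr, ht, rfl⟩⟩
  obtain ⟨o, _, _, ho⟩ := compR (fun m q => ⦅⦅c1,m⦆,q⦆ ε F)
  obtain ⟨e, _, _, he⟩ := compR (fun m q => ⦅⦅c2,m⦆,q⦆ ε F)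
  refine ⟨o, e, ?_, ?_, ?_, ?_, ?_, ?_, ?_⟩ <;> simp only [ho, he]
  · exact tot _ (Or.inl rfl)
  · exact tot _ (Or.inr rfl)
  · exact ty' _
  · exact ty' _
  · intro m m' q h h'; exact (spair_inj (det _ h _ _ _ rfl h')).2
  · intro m m' q h h'; exact (spair_inj (det _ h _ _ _ rfl h')).2
  · intro m m' q h h'; exact hne (spair_inj (det _ h _ _ _ rfl h')).1

theorem pairing : ∃ pr : M, (∀ i j, isNat i → isNat j → ∃ q, ⦅⦅i,j⦆,q⦆ ε pr) ∧
    (∀ p q, ⦅p,q⦆ ε pr → isNat q ∧ ¬ isZeroCard q) ∧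
    (∀ p p' q, ⦅p,q⦆ ε pr → ⦅p',q⦆ ε pr → p = p') := by
  obtain ⟨o, e, ot, et, oy, ey, od, ed, oe⟩ := dbl (M := M)
  obtain ⟨z, hz⟩ := ex_zero (M := M)
  obtain ⟨F, fB, fS, fI, fP⟩ := lfp_ex (M := M)
    (fun u => ∃ j q, ⦅j,q⦆ ε o ∧ u = ⦅⦅z,j⦆,q⦆)
    (fun u u' => ∃ i j q i' q', u = ⦅⦅i,j⦆,q⦆ ∧ isSuccOf i' i ∧ ⦅q,q'⦆ ε e ∧ u' = ⦅⦅i',j⦆,q'⦆)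
  have ty : ∀ u, u ε F → ∃ p q, u = ⦅p,q⦆ ∧ isNat q ∧ ¬ isZeroCard q := by
    refine fP _ (comp _) ?_ ?_
    · rintro u ⟨j, q, h, rfl⟩
      exact ⟨_, _, rfl, (oy _ _ h).2⟩
    · rintro u u' hu _ ⟨i, j, q, i', q', rfl, h6, h7, rfl⟩
      exact ⟨_, _, rfl, (ey _ _ h7).2⟩
  have ty' : ∀ p q, ⦅p,q⦆ ε F → isNat q ∧ ¬ isZeroCard q := by
    intro p q h
    obtain ⟨p', q', e, h⟩ := ty _ h
    simp only [spair_iff] at e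
    obtain ⟨rfl, rfl⟩ := e
    exact h
  refine ⟨F, ?_, ty', ?_⟩
  · intro i j hi hj
    revert i
    refine nat_ind _ ?_ ?_
    · intro z' hz'
      obtain rfl := zero_uniq hz hz'
      obtain ⟨q, hq⟩ := ot j hj
      exact ⟨q, fB _ ⟨j, q, hq, rfl⟩⟩
    · rintro n s hn hs ⟨q, hq⟩
      obtain ⟨t, ht⟩ := et q (ty' _ _ hq).1
      exact ⟨t, fS _ _ hq ⟨_, _, _, _, _, rfl, hs, ht, rfl⟩⟩
  · have det : ∀ u, u ε F → ∀ p p' q, u = ⦅p,q⦆ → ⦅p',q⦆ ε F → p = p' := by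
      refine fP _ (comp _) ?_ ?_
      · rintro u ⟨j, q, h, rfl⟩ p p' q' e' hp'
        simp only [spair_iff] at e'
        obtain ⟨rfl, rfl⟩ := e'
        rcases fI _ hp' with ⟨j', q', h', e'⟩ | ⟨u', hu', i, j, q', i', q'', rfl, h6, h7, e'⟩
        · simp only [spair_iff] at e'
          obtain ⟨rfl, rfl⟩ := e'
          rw [od _ _ _ h h']
        · simp only [spair_iff] at e'
          obtain ⟨rfl, rfl⟩ := e'
          exact (oe _ _ _ h h7).elim
      · rintro u u' hu ih ⟨i, j, q, i', q', rfl, h6, h7, rfl⟩ p p' q'' e' hp'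
        simp only [spair_iff] at e'
        obtain ⟨rfl, rfl⟩ := e'
        rcases fI _ hp' with ⟨j', q', h', e'⟩ | ⟨u', hu', i1, j1, q1, i1', q1', rfl, g6, g7, e'⟩
        · simp only [spair_iff] at e'
          obtain ⟨rfl, rfl⟩ := e'
          exact (oe _ _ _ h' h7).elim
        · simp only [spair_iff] at e'
          obtain ⟨rfl, rfl⟩ := e'
          obtain rfl := ed _ _ _ h7 g7
          have := ih _ _ _ rfl hu'
          simp only [spair_iff] at this
          obtain ⟨rfl, rfl⟩ := this
          rw [succ_uniq h6 g6]
    intro p p' q h h'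
    exact det _ h _ _ _ rfl h'

theorem coding : ∃ Ed : M, (∃ q, isNat q ∧ ∀ p, ¬ ⦅q,p⦆ ε Ed) ∧
    ∀ q i j, isNat q → isNat i → isNat j → ∃ q', isNat q' ∧
      ∀ p, ⦅q',p⦆ ε Ed ↔ ⦅q,p⦆ ε Ed ∨ p = ⦅i,j⦆ := by
  obtain ⟨pr, pt, py, pd⟩ := pairing (M := M)
  obtain ⟨z, hz⟩ := ex_zero (M := M)
  obtain ⟨F, fB, fS, fI, fP⟩ := lfp_ex (M := M)
    (fun u => ∃ q p r q', ⦅p,r⦆ ε pr ∧ ⦅⦅r,q⦆,q'⦆ ε pr ∧ u = ⦅q',p⦆)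
    (fun u u' => ∃ q p r q' s, ⦅p,r⦆ ε pr ∧ ⦅⦅r,q⦆,q'⦆ ε pr ∧ u = ⦅q,s⦆ ∧ u' = ⦅q',s⦆)
  refine ⟨F, ⟨z, nat_zero hz, ?_⟩, ?_⟩
  · intro p hp
    rcases fI _ hp with ⟨q, p, r, q', h1, h2, e⟩ | ⟨u, hu, q, p, r, q', s, h1, h2, h3, e⟩ <;>
    · simp only [spair_iff] at e
      obtain ⟨rfl, rfl⟩ := e
      exact (py _ _ h2).2 hz
  · intro q i j hq hi hj
    obtain ⟨r, hr⟩ := pt i j hi hj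
    obtain ⟨q', hq'⟩ := pt r q (py _ _ hr).1 hq
    refine ⟨q', (py _ _ hq').1, fun p => ⟨fun hp => ?_, ?_⟩⟩
    · rcases fI _ hp with ⟨q1, p1, r1, q1', h1, h2, e⟩ | ⟨u, hu, q1, p1, r1, q1', s1, h1, h2, h3, e⟩ <;>
      · simp only [spair_iff] at e
        obtain ⟨rfl, rfl⟩ := e
        have := pd _ _ _ hq' h2
        simp only [spair_iff] at this
        obtain ⟨rfl, rfl⟩ := this
        have := pd _ _ _ hr h1
        subst this
        first
        | exact Or.inr rfl
        | exact Or.inl (h3 ▸ hu)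
    · rintro (h | rfl)
      · exact fS _ _ h ⟨_, _, _, _, _, hr, hq', rfl, rfl⟩
      · exact fB _ ⟨_, _, _, _, hr, hq', rfl⟩

end Coding
end NFUweak

open FirstOrder Language
namespace NFUweak

section Coding2
set_option linter.all false
variable {M : Type} [LNFU.Structure M] [NFUModel M]

theorem fin_code_aux {Ed : M} (hEd : ∀ q i j, isNat q → isNat i → isNat j → ∃ q', isNat q' ∧
      ∀ p, ⦅q',p⦆ ε Ed ↔ ⦅q,p⦆ ε Ed ∨ p = ⦅i,j⦆) (R h y j q0 : M) (hj : isNat j) (hq0 : isNat q0)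
    (hf : ∀ a b b', ⦅a,b⦆ ε h → ⦅a,b'⦆ ε h → b = b') :
    ∀ D, isFin D → (∀ x, x ε D → ∃ i, isNat i ∧ ⦅x,i⦆ ε h) →
      ∃ q, isNat q ∧ ∀ p, ⦅q,p⦆ ε Ed ↔ ⦅q0,p⦆ ε Ed ∨
        ∃ x i, x ε D ∧ ⦅x,y⦆ ε R ∧ ⦅x,i⦆ ε h ∧ p = ⦅i,j⦆ := by
  refine fin_ind _ ?_ ?_
  · intro D hD _
    refine ⟨q0, hq0, fun p => ⟨Or.inl, ?_⟩⟩
    rintro (h | ⟨x, i, hx, _⟩)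
    · exact h
    · exact (hD x hx).elim
  · intro D d D' hD hd hDD ih htot
    obtain ⟨q, hq, hq'⟩ := ih fun x hx => htot x ((hDD x).1 hx).1
    obtain ⟨i, hi, hdi⟩ := htot d hd
    by_cases hR : ⦅d,y⦆ ε R
    · obtain ⟨q1, h1, h2⟩ := hEd q i j hq hi hj
      refine ⟨q1, h1, fun p => ?_⟩
      rw [h2, hq']
      constructor
      · rintro ((h | ⟨x, i', hx, h⟩) | rfl)
        · exact Or.inl h
        · exact Or.inr ⟨x, i', ((hDD x).1 hx).1, h⟩
        · exact Or.inr ⟨d, i, hd, hR, hdi, rfl⟩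
      · rintro (h | ⟨x, i', hx, h, h', rfl⟩)
        · exact Or.inl (Or.inl h)
        · by_cases e : x = d
          · subst e; right; rw [hf _ _ _ h' hdi]
          · exact Or.inl (Or.inr ⟨x, i', (hDD x).2 ⟨hx, e⟩, h, h', rfl⟩)
    · refine ⟨q, hq, fun p => ?_⟩
      rw [hq']
      constructor
      · rintro (h | ⟨x, i', hx, h⟩)
        · exact Or.inl h
        · exact Or.inr ⟨x, i', ((hDD x).1 hx).1, h⟩
      · rintro (h | ⟨x, i', hx, h, h', rfl⟩)
        · exact (Or.inl h)
        · by_cases e : x = d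
          · subst e; exact (hR h).elim
          · exact (Or.inr ⟨x, i', (hDD x).2 ⟨hx, e⟩, h, h', rfl⟩)

theorem fin_code {Ed : M} (hEd0 : ∃ q, isNat q ∧ ∀ p, ¬ ⦅q,p⦆ ε Ed)
    (hEd : ∀ q i j, isNat q → isNat i → isNat j → ∃ q', isNat q' ∧
      ∀ p, ⦅q',p⦆ ε Ed ↔ ⦅q,p⦆ ε Ed ∨ p = ⦅i,j⦆) (R h D : M) (hD : isFin D)
    (ht : ∀ x, x ε D → ∃ i, isNat i ∧ ⦅x,i⦆ ε h)
    (hf : ∀ a b b', ⦅a,b⦆ ε h → ⦅a,b'⦆ ε h → b = b') :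
      ∃ q, isNat q ∧ ∀ p, ⦅q,p⦆ ε Ed ↔
        ∃ x y i j, x ε D ∧ y ε D ∧ ⦅x,y⦆ ε R ∧ ⦅x,i⦆ ε h ∧ ⦅y,j⦆ ε h ∧ p = ⦅i,j⦆ := by
  have key : ∀ D', isFin D' → (∀ w, w ε D' → w ε D) → ∃ q, isNat q ∧ ∀ p, ⦅q,p⦆ ε Ed ↔
        ∃ x y i j, x ε D ∧ y ε D' ∧ ⦅x,y⦆ ε R ∧ ⦅x,i⦆ ε h ∧ ⦅y,j⦆ ε h ∧ p = ⦅i,j⦆ := by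
    refine fin_ind _ ?_ ?_
    · intro D' hD' _
      obtain ⟨q, hq, hq'⟩ := hEd0
      refine ⟨q, hq, fun p => ⟨fun h => (hq' p h).elim, ?_⟩⟩
      rintro ⟨x, y, i, j, _, h, _⟩
      exact (hD' y h).elim
    · intro D1 d D' hD1 hd hDD ih hsub
      obtain ⟨q, hq, hq'⟩ := ih fun w hw => hsub w ((hDD w).1 hw).1
      obtain ⟨j, hj, hdj⟩ := ht d (hsub d hd)
      obtain ⟨q1, h1, h2⟩ := fin_code_aux hEd R h d j q hj hq hf D hD ht
      refine ⟨q1, h1, fun p => ?_⟩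
      rw [h2, hq']
      constructor
      · rintro (⟨x, y, i, j, hx, hy, h⟩ | ⟨x, i, hx, hR, h, rfl⟩)
        · exact ⟨x, y, i, j, hx, ((hDD y).1 hy).1, h⟩
        · exact ⟨x, d, i, j, hx, hd, hR, h, hdj, rfl⟩
      · rintro ⟨x, y, i, j', hx, hy, hR, hi, hj', rfl⟩
        by_cases e : y = d
        · subst e
          obtain rfl := hf _ _ _ hj' hdj
          exact Or.inr ⟨x, i, hx, hR, hi, rfl⟩
        · exact Or.inl ⟨x, y, i, j', hx, (hDD y).2 ⟨hy, e⟩, hR, hi, hj', rfl⟩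
  exact key D hD fun _ h => h

end Coding2
end NFUweak

open FirstOrder Language
namespace NFUweak

section Relations
set_option linter.all false
variable {M : Type} [LNFU.Structure M] [NFUModel M]

abbrev Bis (R S W : M) : Prop :=
  ∀ x y, ⦅x,y⦆ ε W → (∀ x', ⦅x',x⦆ ε R → ∃ y', ⦅y',y⦆ ε S ∧ ⦅x',y'⦆ ε W) ∧
    (∀ y', ⦅y',y⦆ ε S → ∃ x', ⦅x',x⦆ ε R ∧ ⦅x',y'⦆ ε W)

abbrev sim (R x S y : M) : Prop := ∃ W, Bis R S W ∧ ⦅x,y⦆ ε W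

theorem sim_fwd {R x S y x' : M} (h : sim R x S y) (hx : ⦅x',x⦆ ε R) :
    ∃ y', ⦅y',y⦆ ε S ∧ sim R x' S y' := by
  obtain ⟨W, hW, hxy⟩ := h
  obtain ⟨y', h1, h2⟩ := (hW x y hxy).1 x' hx
  exact ⟨y', h1, W, hW, h2⟩

theorem sim_bwd {R x S y y' : M} (h : sim R x S y) (hy : ⦅y',y⦆ ε S) :
    ∃ x', ⦅x',x⦆ ε R ∧ sim R x' S y' := by
  obtain ⟨W, hW, hxy⟩ := h
  obtain ⟨x', h1, h2⟩ := (hW x y hxy).2 y' hy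
  exact ⟨x', h1, W, hW, h2⟩

theorem sim_symm {R x S y : M} (h : sim R x S y) : sim S y R x := by
  obtain ⟨W, hW, hxy⟩ := h
  obtain ⟨W', -, -, hW'⟩ := compR (fun a b => ⦅b,a⦆ ε W)
  refine ⟨W', fun a b hab => ?_, (hW' _ _).2 hxy⟩
  simp only [hW'] at hab ⊢
  exact ⟨(hW b a hab).2, (hW b a hab).1⟩

theorem sim_intro {R x S y : M} (h1 : ∀ x', ⦅x',x⦆ ε R → ∃ y', ⦅y',y⦆ ε S ∧ sim R x' S y')
    (h2 : ∀ y', ⦅y',y⦆ ε S → ∃ x', ⦅x',x⦆ ε R ∧ sim R x' S y') : sim R x S y := by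
  obtain ⟨W', -, -, hW'⟩ := compR (fun a b => sim R a S b ∨ (a = x ∧ b = y))
  refine ⟨W', fun a b hab => ?_, (hW' _ _).2 (Or.inr ⟨rfl, rfl⟩)⟩
  rcases (hW' _ _).1 hab with h | ⟨rfl, rfl⟩
  · refine ⟨fun x' hx' => ?_, fun y' hy' => ?_⟩
    · obtain ⟨y', h3, h4⟩ := sim_fwd h hx'
      exact ⟨y', h3, (hW' _ _).2 (Or.inl h4)⟩
    · obtain ⟨y', h3, h4⟩ := sim_bwd h hy'
      exact ⟨y', h3, (hW' _ _).2 (Or.inl h4)⟩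
  · refine ⟨fun x' hx' => ?_, fun y' hy' => ?_⟩
    · obtain ⟨y', h3, h4⟩ := h1 x' hx'
      exact ⟨y', h3, (hW' _ _).2 (Or.inl h4)⟩
    · obtain ⟨y', h3, h4⟩ := h2 y' hy'
      exact ⟨y', h3, (hW' _ _).2 (Or.inl h4)⟩

theorem sim_trans {R x S y Q z : M} (h : sim R x S y) (h' : sim S y Q z) : sim R x Q z := by
  obtain ⟨W, -, -, hW⟩ := compR (fun a c => ∃ b, sim R a S b ∧ sim S b Q c)
  refine ⟨W, fun a c hab => ?_, (hW _ _).2 ⟨y, h, h'⟩⟩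
  obtain ⟨b, hb, hb'⟩ := (hW _ _).1 hab
  refine ⟨fun x' hx' => ?_, fun z' hz' => ?_⟩
  · obtain ⟨y', h3, h4⟩ := sim_fwd hb hx'
    obtain ⟨z', h5, h6⟩ := sim_fwd hb' h3
    exact ⟨z', h5, (hW _ _).2 ⟨y', h4, h6⟩⟩
  · obtain ⟨y', h3, h4⟩ := sim_bwd hb' hz'
    obtain ⟨x', h5, h6⟩ := sim_bwd hb h3
    exact ⟨x', h5, (hW _ _).2 ⟨y', h6, h4⟩⟩

theorem sim_refl (R x : M) : sim R x R x := by
  obtain ⟨W, -, -, hW⟩ := compR (fun a c : M => a = c)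
  refine ⟨W, fun a c hab => ?_, (hW _ _).2 rfl⟩
  obtain rfl := (hW _ _).1 hab
  exact ⟨fun x hx => ⟨x, hx, (hW _ _).2 rfl⟩, fun x hx => ⟨x, hx, (hW _ _).2 rfl⟩⟩

theorem field_l {R x y : M} (h : ⦅x,y⦆ ε R) : inField x R := ⟨y, Or.inl h⟩
theorem field_r {R x y : M} (h : ⦅x,y⦆ ε R) : inField y R := ⟨x, Or.inr h⟩

theorem wf_ind {R : M} (hR : isBFEXT R) (P : M → Prop)
    (hP : ∃ y : M, sset y ∧ ∀ x, x ε y ↔ (inField x R ∧ ¬ P x))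
    (hs : ∀ x, inField x R → (∀ c, ⦅c,x⦆ ε R → P c) → P x) : ∀ x, inField x R → P x := by
  obtain ⟨B, hB, hB'⟩ := hP
  intro x hx
  by_contra hn
  obtain ⟨b, hb, hb'⟩ := hR.2.1 B hB ⟨x, (hB' x).2 ⟨hx, hn⟩⟩ fun b hb => ((hB' b).1 hb).1
  obtain ⟨h1, h2⟩ := (hB' b).1 hb
  refine h2 (hs b h1 fun c hc => ?_)
  by_contra h3
  exact hb' c ((hB' c).2 ⟨field_l hc, h3⟩) hc

theorem sim_eq_aux {S : M} (hS : isBFEXT S) : ∀ y, inField y S → ∀ y', inField y' S → sim S y S y' → y = y' := by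
  refine wf_ind hS _ (comp _) ?_
  intro x hx ih y hy hxy
  refine hS.2.2 x y hx hy fun c => ⟨fun hc => ?_, fun hc => ?_⟩
  · obtain ⟨c', h1, h2⟩ := sim_fwd hxy hc
    rwa [ih c hc c' (field_l h1) h2]
  · obtain ⟨c', h1, h2⟩ := sim_bwd hxy hc
    rwa [← ih c' h1 c (field_l hc) h2]

theorem sim_eq {R x S y y' : M} (hS : isBFEXT S) (hy : inField y S) (hy' : inField y' S)
    (h : sim R x S y) (h' : sim R x S y') : y = y' :=
  sim_eq_aux hS y hy y' hy' (sim_trans (sim_symm h) h')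

theorem sim_eq' {R x S x' y : M} (hR : isBFEXT R) (hy : inField x R) (hy' : inField x' R)
    (h : sim R x S y) (h' : sim R x' S y) : x = x' :=
  sim_eq hR hy hy' (sim_symm h) (sim_symm h')

theorem iso_sim {f R S x y : M} (hf : isIsoRel f R S) (h : ⦅x,y⦆ ε f) : sim R x S y := by
  obtain ⟨h1, h2, h3, h4, h5, h6, h7⟩ := hf
  refine ⟨f, fun x y hxy => ⟨fun x' hx' => ?_, fun y' hy' => ?_⟩, h⟩
  · obtain ⟨y', hy'⟩ := h3 x' (field_l hx')
    exact ⟨y', (h7 _ _ _ _ hy' hxy).1 hx', hy'⟩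
  · obtain ⟨x', hx'⟩ := h6 y' (field_l hy')
    exact ⟨x', (h7 _ _ _ _ hx' hxy).2 hy', hx'⟩

theorem iso_field {f R S x y : M} (hf : isIsoRel f R S) (h : ⦅x,y⦆ ε f) : inField x R ∧ inField y S := by
  obtain ⟨a, b, e, h1, h2⟩ := hf.2.1 _ h
  obtain ⟨rfl, rfl⟩ := spair_inj e
  exact ⟨h1, h2⟩

theorem mkIso {R S : M} (Q : M → M → Prop)
    (hQ : ∃ f : M, sset f ∧ (∀ p, p ε f → ∃ a b, p = ⦅a,b⦆ ∧ Q a b) ∧ ∀ a b, ⦅a,b⦆ ε f ↔ Q a b)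
    (h2 : ∀ x y, Q x y → inField x R ∧ inField y S)
    (h3 : ∀ x, inField x R → ∃ y, Q x y) (h4 : ∀ x y y', Q x y → Q x y' → y = y')
    (h5 : ∀ x x' y, Q x y → Q x' y → x = x') (h6 : ∀ y, inField y S → ∃ x, Q x y)
    (h7 : ∀ x y x' y', Q x x' → Q y y' → (⦅x,y⦆ ε R ↔ ⦅x',y'⦆ ε S)) : relIso R S := by
  obtain ⟨f, hf, hf1, hf2⟩ := hQ
  refine ⟨f, hf, fun p hp => ?_, ?_, ?_, ?_, ?_, ?_⟩
  · obtain ⟨a, b, rfl, h⟩ := hf1 p hp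
    exact ⟨a, b, rfl, h2 a b h⟩
  all_goals simp only [hf2]; assumption

theorem iso_refl (R : M) : relIso R R := by
  refine mkIso (fun x y => inField x R ∧ x = y) (compR _) ?_ ?_ ?_ ?_ ?_ ?_
  · rintro x y ⟨h, rfl⟩; exact ⟨h, h⟩
  · intro x h; exact ⟨x, h, rfl⟩
  · rintro x y y' ⟨_, rfl⟩ ⟨_, rfl⟩; rfl
  · rintro x y y' ⟨_, rfl⟩ ⟨_, rfl⟩; rfl
  · intro x h; exact ⟨x, h, rfl⟩
  · rintro x y x' y' ⟨_, rfl⟩ ⟨_, rfl⟩; rfl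

theorem iso_symm {R S : M} (h : relIso R S) : relIso S R := by
  obtain ⟨f, hf⟩ := h
  refine mkIso (fun x y => ⦅y,x⦆ ε f) (compR _) ?_ ?_ ?_ ?_ ?_ ?_
  · intro x y h; exact (iso_field hf h).symm
  · exact hf.2.2.2.2.2.1
  · intro x y y' h h'; exact hf.2.2.2.2.1 _ _ _ h h'
  · intro x y y' h h'; exact hf.2.2.2.1 _ _ _ h h'
  · exact hf.2.2.1
  · intro x y x' y' h h'; exact (hf.2.2.2.2.2.2 _ _ _ _ h h').symm

theorem iso_trans {R S Q : M} (h : relIso R S) (h' : relIso S Q) : relIso R Q := by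
  obtain ⟨f, hf⟩ := h
  obtain ⟨g, hg⟩ := h'
  refine mkIso (fun x z => ∃ y, ⦅x,y⦆ ε f ∧ ⦅y,z⦆ ε g) (compR _) ?_ ?_ ?_ ?_ ?_ ?_
  · rintro x z ⟨y, h1, h2⟩; exact ⟨(iso_field hf h1).1, (iso_field hg h2).2⟩
  · intro x hx
    obtain ⟨y, hy⟩ := hf.2.2.1 x hx
    obtain ⟨z, hz⟩ := hg.2.2.1 y (iso_field hf hy).2
    exact ⟨z, y, hy, hz⟩
  · rintro x z z' ⟨y, h1, h2⟩ ⟨y', h1', h2'⟩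
    obtain rfl := hf.2.2.2.1 _ _ _ h1 h1'
    exact hg.2.2.2.1 _ _ _ h2 h2'
  · rintro x z z' ⟨y, h1, h2⟩ ⟨y', h1', h2'⟩
    obtain rfl := hg.2.2.2.2.1 _ _ _ h2 h2'
    exact hf.2.2.2.2.1 _ _ _ h1 h1'
  · intro z hz
    obtain ⟨y, hy⟩ := hg.2.2.2.2.2.1 z hz
    obtain ⟨x, hx⟩ := hf.2.2.2.2.2.1 y (iso_field hg hy).1
    exact ⟨x, y, hx, hy⟩
  · rintro x y x' y' ⟨u, h1, h2⟩ ⟨v, h1', h2'⟩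
    exact (hf.2.2.2.2.2.2 _ _ _ _ h1 h1').trans (hg.2.2.2.2.2.2 _ _ _ _ h2 h2')

theorem seg_self (R a : M) : inSeg a R a := fun _ _ _ h _ => h

theorem seg_step {x y R a : M} (h : inSeg y R a) (hx : ⦅x,y⦆ ε R) : inSeg x R a :=
  fun B h1 h2 h3 h4 => h4 y x (h B h1 h2 h3 h4) hx

theorem seg_trans {x y R a : M} (h : inSeg x R y) (h' : inSeg y R a) : inSeg x R a :=
  fun B h1 h2 h3 h4 => h B h1 h2 (h' B h1 h2 h3 h4) h4

theorem seg_ind {R a : M} (ha : inField a R) (P : M → Prop)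
    (hP : ∃ y : M, sset y ∧ ∀ x, x ε y ↔ (inField x R ∧ P x)) (h0 : P a)
    (hs : ∀ b c, inField b R → P b → ⦅c,b⦆ ε R → P c) : ∀ x, inSeg x R a → inField x R ∧ P x := by
  obtain ⟨B, hB, hB'⟩ := hP
  intro x hx
  refine (hB' x).1 (hx B hB (fun b hb => ((hB' b).1 hb).1) ((hB' a).2 ⟨ha, h0⟩) fun b c hb hc => ?_)
  have := (hB' b).1 hb
  exact (hB' c).2 ⟨field_l hc, hs b c this.1 this.2 hc⟩

theorem seg_field {R a x : M} (ha : inField a R) (h : inSeg x R a) : inField x R :=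
  (seg_ind ha (fun _ => True) (comp _) trivial (fun _ _ _ _ _ => trivial) x h).1

theorem seg_inv1 {R a x : M} (ha : inField a R) (h : inSeg x R a) :
    x = a ∨ ∃ y, ⦅x,y⦆ ε R ∧ inSeg y R a := by
  have := (seg_ind ha (fun x => (x = a ∨ ∃ y, ⦅x,y⦆ ε R ∧ inSeg y R a)) (comp _) (Or.inl rfl) ?_ x h).2
  · exact this
  · rintro b c hb (rfl | ⟨y, h1, h2⟩) hc
    · exact Or.inr ⟨b, hc, seg_self _ _⟩
    · exact Or.inr ⟨b, hc, seg_step h2 h1⟩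

theorem seg_inv2 {R a x : M} (ha : inField a R) (h : inSeg x R a) :
    x = a ∨ ∃ c, ⦅c,a⦆ ε R ∧ inSeg x R c := by
  have := (seg_ind ha (fun x => (x = a ∨ ∃ c, ⦅c,a⦆ ε R ∧ inSeg x R c)) (comp _) (Or.inl rfl) ?_ x h).2
  · exact this
  · rintro b c hb (rfl | ⟨y, h1, h2⟩) hc
    · exact Or.inr ⟨c, hc, seg_self _ _⟩
    · exact Or.inr ⟨y, h1, seg_step h2 hc⟩

theorem ex_seg (R a : M) : ∃ s, isSegOf s R a := comp _

theorem seg_rel {s R a x y : M} (hs : isSegOf s R a) : ⦅x,y⦆ ε s ↔ ⦅x,y⦆ ε R ∧ inSeg y R a := by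
  rw [hs.2]
  constructor
  · rintro ⟨h, x', y', e, h1, h2⟩
    obtain ⟨rfl, rfl⟩ := spair_inj e
    exact ⟨h, h2⟩
  · rintro ⟨h, h1⟩
    exact ⟨h, x, y, rfl, seg_step h1 h, h1⟩

theorem seg_isRel {s R a : M} (hs : isSegOf s R a) : isRel s :=
  ⟨hs.1, fun p hp => by
    obtain ⟨-, x, y, e, -⟩ := (hs.2 p).1 hp
    exact ⟨x, y, e⟩⟩

theorem seg_field_seg {s R a x : M} (hs : isSegOf s R a) (h : inField x s) : inSeg x R a := by
  obtain ⟨y, h | h⟩ := h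
  · exact seg_step ((seg_rel hs).1 h).2 ((seg_rel hs).1 h).1
  · exact ((seg_rel hs).1 h).2

theorem seg_seg_field {s R a x c : M} (hs : isSegOf s R a) (ha : ⦅c,a⦆ ε R) (h : inSeg x R a) :
    inField x s := by
  rcases seg_inv1 (field_r ha) h with rfl | ⟨y, h1, h2⟩
  · exact field_r ((seg_rel hs).2 ⟨ha, seg_self _ _⟩)
  · exact field_l ((seg_rel hs).2 ⟨h1, h2⟩)

theorem seg_sim {s R a x : M} (hs : isSegOf s R a) (h : inSeg x R a) : sim s x R x := by
  obtain ⟨W, -, -, hW⟩ := compR (fun x y => inSeg x R a ∧ x = y)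
  refine ⟨W, fun x y hab => ?_, (hW _ _).2 ⟨h, rfl⟩⟩
  obtain ⟨h, rfl⟩ := (hW _ _).1 hab
  refine ⟨fun x' hx' => ?_, fun x' hx' => ?_⟩
  · rw [seg_rel hs] at hx'
    exact ⟨x', hx'.1, (hW _ _).2 ⟨seg_step h hx'.1, rfl⟩⟩
  · exact ⟨x', (seg_rel hs).2 ⟨hx', h⟩, (hW _ _).2 ⟨seg_step h hx', rfl⟩⟩

theorem seg_top {s R a c : M} (hs : isSegOf s R a) (ha : ⦅c,a⦆ ε R) : isTopOf a s := by
  have hc := (seg_rel hs).2 ⟨ha, seg_self _ _⟩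
  refine ⟨field_r hc, hs.1, fun p => ⟨fun hp => ?_, fun h => h.1⟩⟩
  have key : ∀ x, inSeg x R a → inField x R ∧ (inSeg x R a ∧ inSeg x s a) := by
    refine seg_ind (field_r ha) _ (comp _) ⟨seg_self _ _, seg_self _ _⟩ ?_
    rintro b c hb ⟨h1, h2⟩ hc
    exact ⟨seg_step h1 hc, seg_step h2 ((seg_rel hs).2 ⟨hc, h1⟩)⟩
  obtain ⟨-, x, y, e, hx, hy⟩ := (hs.2 p).1 hp
  exact ⟨hp, x, y, e, (key x hx).2.2, (key y hy).2.2⟩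

theorem seg_bfext {s R a : M} (hR : isBFEXT R) (ha : inField a R) (hs : isSegOf s R a) : isBFEXT s := by
  refine ⟨seg_isRel hs, fun B hB hne hsub => ?_, fun u v hu hv huv => ?_⟩
  · obtain ⟨b, hb, hb'⟩ := hR.2.1 B hB hne fun b hb => seg_field ha (seg_field_seg hs (hsub b hb))
    exact ⟨b, hb, fun c hc h => hb' c hc ((seg_rel hs).1 h).1⟩
  · have hu' := seg_field_seg hs hu
    have hv' := seg_field_seg hs hv
    refine hR.2.2 u v (seg_field ha hu') (seg_field ha hv') fun c => ?_
    have := huv c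
    rw [seg_rel hs, seg_rel hs] at this
    tauto

theorem seg_omega {s R a c : M} (hR : isBFEXT R) (ha : ⦅c,a⦆ ε R) (hs : isSegOf s R a) : inOmega s :=
  ⟨seg_bfext hR (field_r ha) hs, a, seg_top hs ha⟩

theorem top_all {r R x : M} (hr : isTopOf r R) (hx : inField x R) : inSeg x R r :=
  seg_field_seg hr.2 hx

theorem top_nosucc {r R y : M} (hR : isBFEXT R) (hr : isTopOf r R) : ¬ ⦅r,y⦆ ε R := by
  intro h
  obtain ⟨B, hB, hB'⟩ := comp (fun z => inField z R ∧ ∃ c, ⦅c,z⦆ ε R ∧ inSeg z R c)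
  have hrB : ∃ c, ⦅c,r⦆ ε R ∧ inSeg r R c := by
    rcases seg_inv2 hr.1 (top_all hr (field_r h)) with rfl | ⟨c, h4, h5⟩
    · exact ⟨y, h, seg_self _ _⟩
    · exact ⟨c, h4, seg_step h5 h⟩
  obtain ⟨b, hb, hb'⟩ := hR.2.1 B hB ⟨r, (hB' r).2 ⟨hr.1, hrB⟩⟩ fun b hb => ((hB' b).1 hb).1
  obtain ⟨h1, c, h2, h3⟩ := (hB' b).1 hb
  refine hb' c ((hB' c).2 ⟨field_l h2, ?_⟩) h2
  rcases seg_inv2 (field_l h2) h3 with rfl | ⟨c', h4, h5⟩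
  · exact ⟨b, h2, h3⟩
  · exact ⟨c', h4, seg_step h5 h2⟩

theorem top_pred {r R : M} (hR : isBFEXT R) (hr : isTopOf r R) : ∃ c, ⦅c,r⦆ ε R := by
  obtain ⟨y, h | h⟩ := hr.1
  · exact (top_nosucc hR hr h).elim
  · exact ⟨y, h⟩

theorem iso_top {f Q S q s : M} (hf : isIsoRel f Q S) (hQ : isBFEXT Q) (hq : isTopOf q Q)
    (hs : isTopOf s S) : ⦅q,s⦆ ε f := by
  obtain ⟨s', hs'⟩ := hf.2.2.1 q hq.1
  rcases seg_inv1 hs.1 (top_all hs (iso_field hf hs').2) with rfl | ⟨y, h, -⟩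
  · exact hs'
  · obtain ⟨y0, hy0⟩ := hf.2.2.2.2.2.1 y (field_r h)
    exact (top_nosucc hQ hq ((hf.2.2.2.2.2.2 _ _ _ _ hs' hy0).2 h)).elim

theorem top_uniq {Q q s : M} (hQ : isBFEXT Q) (hq : isTopOf q Q) (hs : isTopOf s Q) : q = s := by
  rcases seg_inv1 hs.1 (top_all hs hq.1) with h | ⟨y, h, -⟩
  · exact h
  · exact (top_nosucc hQ hq h).elim

theorem sim_total {R S r s : M} (hr : isTopOf r R) (hs : isTopOf s S)
    (h : sim R r S s) : ∀ x, inField x R → ∃ y, inField y S ∧ sim R x S y := by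
  intro x hx
  refine (seg_ind hr.1 (fun x => ∃ y, inField y S ∧ sim R x S y) (comp _) ⟨s, hs.1, h⟩ ?_ x (top_all hr hx)).2
  rintro b c hb ⟨y, hy, hby⟩ hc
  obtain ⟨y', h1, h2⟩ := sim_fwd hby hc
  exact ⟨y', field_l h1, h2⟩

theorem sim_iso {R S r s : M} (hR : isBFEXT R) (hS : isBFEXT S) (hr : isTopOf r R) (hs : isTopOf s S)
    (h : sim R r S s) : relIso R S := by
  refine mkIso (fun x y => inField x R ∧ inField y S ∧ sim R x S y) (compR _) ?_ ?_ ?_ ?_ ?_ ?_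
  · exact fun x y h => ⟨h.1, h.2.1⟩
  · intro x hx
    obtain ⟨y, h1, h2⟩ := sim_total hr hs h x hx
    exact ⟨y, hx, h1, h2⟩
  · intro x y y' h1 h2
    exact sim_eq hS h1.2.1 h2.2.1 h1.2.2 h2.2.2
  · intro x x' y h1 h2
    exact sim_eq' hR h1.1 h2.1 h1.2.2 h2.2.2
  · intro y hy
    obtain ⟨x, h1, h2⟩ := sim_total hs hr (sim_symm h) y hy
    exact ⟨x, h1, hy, sim_symm h2⟩
  · rintro x y x' y' ⟨h1, h2, h3⟩ ⟨h4, h5, h6⟩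
    constructor
    · intro hxy
      obtain ⟨z, h7, h8⟩ := sim_fwd h6 hxy
      rwa [sim_eq hS h2 (field_l h7) h3 h8]
    · intro hxy
      obtain ⟨z, h7, h8⟩ := sim_bwd h6 hxy
      rwa [sim_eq' hR h1 (field_l h7) h3 h8]

end Relations
end NFUweak

open FirstOrder Language
namespace NFUweak

section Types
set_option linter.all false
variable {M : Type} [LNFU.Structure M] [NFUModel M]

abbrev bit (a : M) : Prop := ∃ R r c, R ε a ∧ isTopOf r R ∧ ⦅c,r⦆ ε R ∧ ∀ d, ¬ ⦅d,c⦆ ε R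

theorem ex_type (R : M) : ∃ a, isTypeOf a R := comp _

theorem type_mem {a R : M} (h : isTypeOf a R) : R ε a := (h.2 R).2 (iso_refl R)

theorem type_eq {a a' R R' : M} (h : isTypeOf a R) (h' : isTypeOf a' R') (e : relIso R R') : a = a' :=
  ext h.1 h'.1 fun S => by
    rw [h.2, h'.2]
    exact ⟨fun k => iso_trans k e, fun k => iso_trans k (iso_symm e)⟩

theorem type_of_iso {a R R' : M} (h : isTypeOf a R) (e : relIso R R') : isTypeOf a R' :=
  ⟨h.1, fun S => by
    rw [h.2]
    exact ⟨fun k => iso_trans k e, fun k => iso_trans k (iso_symm e)⟩⟩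

theorem bf_mk {b s R x c : M} (hR : isBFEXT R) (hx : ⦅c,x⦆ ε R) (hs : isSegOf s R x) (hb : isTypeOf b s) :
    inBF b := ⟨s, seg_omega hR hx hs, hb⟩

theorem bf_top {a : M} (h : inBF a) : ∃ R r, isBFEXT R ∧ isTypeOf a R ∧ isTopOf r R := by
  obtain ⟨R, ⟨h1, r, h2⟩, h3⟩ := h
  exact ⟨R, r, h1, h3, h2⟩

theorem erel_char {a b R Q r q : M} (hR : isBFEXT R) (ha : isTypeOf a R) (hr : isTopOf r R)
    (hQ : isBFEXT Q) (hb : isTypeOf b Q) (hq : isTopOf q Q) :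
    erel b a ↔ ∃ x, ⦅x,r⦆ ε R ∧ sim Q q R x := by
  constructor
  · rintro ⟨R', S', hR', hS', x, o, ho, hx, sg, hsg, hiso⟩
    obtain ⟨g, hg⟩ := iso_symm ((ha.2 _).1 hS')
    have hro := iso_top hg hR hr ho
    obtain ⟨x0, hx0⟩ := hg.2.2.2.2.2.1 x (field_l hx)
    have hx0r := (hg.2.2.2.2.2.2 _ _ _ _ hx0 hro).2 hx
    obtain ⟨h, hh⟩ := iso_trans (iso_symm ((hb.2 _).1 hR')) hiso
    obtain ⟨c, hc⟩ := top_pred hQ hq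
    obtain ⟨q1, hq1⟩ := hh.2.2.1 q hq.1
    obtain ⟨c1, hc1⟩ := hh.2.2.1 c (field_l hc)
    have h1 := (hh.2.2.2.2.2.2 _ _ _ _ hc1 hq1).1 hc
    rw [seg_rel hsg] at h1
    have h2 : ∃ d, ⦅d,x⦆ ε S' := by
      rcases seg_inv2 (field_l hx) h1.2 with rfl | ⟨d, hd, -⟩
      · exact ⟨_, h1.1⟩
      · exact ⟨d, hd⟩
    obtain ⟨d, hd⟩ := h2
    have h3 := iso_top hh hQ hq (seg_top hsg hd)
    exact ⟨x0, hx0r, sim_trans (iso_sim hh h3) (sim_trans (seg_sim hsg (seg_self _ _))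
      (sim_symm (iso_sim hg hx0)))⟩
  · rintro ⟨x, hx, h⟩
    obtain ⟨c, hc⟩ := top_pred hQ hq
    obtain ⟨d, hd, -⟩ := sim_fwd h hc
    obtain ⟨sg, hsg⟩ := ex_seg R x
    exact ⟨Q, R, type_mem hb, type_mem ha, x, r, hr, hx, sg, hsg,
      sim_iso hQ (seg_bfext hR (field_l hx) hsg) hq (seg_top hsg hd)
        (sim_trans h (sim_symm (seg_sim hsg (seg_self _ _))))⟩

theorem bit_char {a R r : M} (hR : isBFEXT R) (ha : isTypeOf a R) (hr : isTopOf r R) :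
    bit a ↔ ∃ c, ⦅c,r⦆ ε R ∧ ∀ d, ¬ ⦅d,c⦆ ε R := by
  constructor
  · rintro ⟨S, s, c, hS, hs, hc, hm⟩
    obtain ⟨g, hg⟩ := iso_symm ((ha.2 _).1 hS)
    have hro := iso_top hg hR hr hs
    obtain ⟨c0, hc0⟩ := hg.2.2.2.2.2.1 c (field_l hc)
    refine ⟨c0, (hg.2.2.2.2.2.2 _ _ _ _ hc0 hro).2 hc, fun d hd => ?_⟩
    obtain ⟨d', hd', -⟩ := sim_fwd (iso_sim hg hc0) hd
    exact hm _ hd'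
  · rintro ⟨c, h1, h2⟩
    exact ⟨R, r, c, type_mem ha, hr, h1, h2⟩

theorem sim_min {R x S y : M} (h : ∀ d, ¬ ⦅d,x⦆ ε R) (h' : ∀ d, ¬ ⦅d,y⦆ ε S) : sim R x S y :=
  sim_intro (fun d hd => (h d hd).elim) (fun d hd => (h' d hd).elim)

theorem erel_seg {a b R r s sg x c : M} (hR : isBFEXT R) (hs : isSegOf s R r) (ha : isTypeOf a s)
    (hx : ⦅x,r⦆ ε R) (hc : ⦅c,x⦆ ε R) (hsg : isSegOf sg R x) (hb : isTypeOf b sg) : erel b a := by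
  refine (erel_char (seg_bfext hR (field_r hx) hs) ha (seg_top hs hx)
    (seg_bfext hR (field_l hx) hsg) hb (seg_top hsg hc)).2 ⟨x, ?_, ?_⟩
  · exact (seg_rel hs).2 ⟨hx, seg_self _ _⟩
  · exact sim_trans (seg_sim hsg (seg_self _ _)) (sim_symm (seg_sim hs (seg_step (seg_self _ _) hx)))

theorem eext_aux {a a' R R' r r' : M} (hR : isBFEXT R) (ha : isTypeOf a R) (hr : isTopOf r R)
    (hR' : isBFEXT R') (ha' : isTypeOf a' R') (hr' : isTopOf r' R')
    (h : ∀ b, inBF b → erel b a → erel b a') (hbit : bit a → bit a') :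
    ∀ x, ⦅x,r⦆ ε R → ∃ x', ⦅x',r'⦆ ε R' ∧ sim R x R' x' := by
  intro x hx
  by_cases hm : ∃ c, ⦅c,x⦆ ε R
  · obtain ⟨c, hc⟩ := hm
    obtain ⟨sg, hsg⟩ := ex_seg R x
    obtain ⟨b, hb⟩ := ex_type sg
    have h1 := h b (bf_mk hR hc hsg hb) (erel_seg hR hr.2 ha hx hc hsg hb)
    obtain ⟨x', h2, h3⟩ := (erel_char hR' ha' hr' (seg_bfext hR (field_l hx) hsg) hb (seg_top hsg hc)).1 h1
    exact ⟨x', h2, sim_trans (sim_symm (seg_sim hsg (seg_self _ _))) h3⟩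
  · push Not at hm
    obtain ⟨x', h1, h2⟩ := (bit_char hR' ha' hr').1 (hbit ((bit_char hR ha hr).2 ⟨x, hx, hm⟩))
    exact ⟨x', h1, sim_min hm h2⟩

theorem eext {a a' : M} (ha : inBF a) (ha' : inBF a')
    (h : ∀ b, inBF b → (erel b a ↔ erel b a')) (hbit : bit a ↔ bit a') : a = a' := by
  obtain ⟨R, r, h1, h2, h3⟩ := bf_top ha
  obtain ⟨R', r', h1', h2', h3'⟩ := bf_top ha'
  refine type_eq h2 h2' (sim_iso h1 h1' h3 h3' (sim_intro
    (eext_aux h1 h2 h3 h1' h2' h3' (fun b hb => (h b hb).1) hbit.1) ?_))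
  intro y hy
  obtain ⟨x, hx, hs⟩ := eext_aux h1' h2' h3' h1 h2 h3 (fun b hb => (h b hb).2) hbit.2 y hy
  exact ⟨x, hx, sim_symm hs⟩

abbrev finR (R : M) : Prop := ∃ D, isFieldSetOf D R ∧ isFin D

theorem ex_field (R : M) : ∃ D, isFieldSetOf D R := comp _

theorem finR_iso {R S : M} (h : finR S) (e : relIso R S) : finR R := by
  obtain ⟨D, hD, hf⟩ := h
  obtain ⟨D', hD'⟩ := ex_field R
  refine ⟨D', hD', fin_eqp hf ?_⟩
  obtain ⟨f, hf⟩ := e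
  refine mkBij (fun a b => ⦅a,b⦆ ε f) ?_ ?_ ?_ ?_ ?_
  · intro a b h; rw [hD'.2, hD.2]; exact iso_field hf h
  · intro a h; exact hf.2.2.1 a ((hD'.2 a).1 h)
  · exact hf.2.2.2.1
  · exact hf.2.2.2.2.1
  · intro a h; exact hf.2.2.2.2.2.1 a ((hD.2 a).1 h)

theorem m0_char {m a R : M} (hm : isM0Set m) (hb : inBF a) (hR : isTypeOf a R) : a ε m ↔ finR R := by
  rw [hm.2]
  constructor
  · rintro ⟨-, S, D, c, hS, hD, hc, hn⟩
    exact finR_iso ⟨D, hD, c, hn, card_self hc⟩ (iso_symm ((hR.2 _).1 hS))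
  · rintro ⟨D, hD, c, hn, hc⟩
    exact ⟨hb, R, D, c, type_mem hR, hD, nat_card_mem hn hc, hn⟩

theorem m_closed {g : M} (hg : isMFun g) : ∀ n, isNat n → ∀ m, ⦅n,m⦆ ε g → sset m ∧ ∀ a, a ε m →
    inBF a ∧ ∀ b, inBF b → erel b a → b ε m := by
  obtain ⟨-, -, gt, gf, g0, gs⟩ := hg
  refine nat_ind _ ?_ ?_
  · intro z hz m hm
    have h0 := g0 z m hz hm
    refine ⟨h0.1, fun a ha => ?_⟩
    have haB := ((h0.2 a).1 ha).1
    refine ⟨haB, fun b hb hba => ?_⟩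
    obtain ⟨R, r, h1, h2, h3⟩ := bf_top haB
    obtain ⟨Q, q, k1, k2, k3⟩ := bf_top hb
    obtain ⟨x, hx, hs⟩ := (erel_char h1 h2 h3 k1 k2 k3).1 hba
    rw [m0_char h0 hb k2]
    obtain ⟨D, hD, hf⟩ := (m0_char h0 haB h2).1 ha
    obtain ⟨sg, hsg⟩ := ex_seg R x
    obtain ⟨c, hc⟩ := top_pred k1 k3
    obtain ⟨d, hd, -⟩ := sim_fwd hs hc
    obtain ⟨D', hD'⟩ := ex_field sg
    refine finR_iso ⟨D', hD', fin_sub D hf D' fun w hw => ?_⟩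
      (sim_iso k1 (seg_bfext h1 (field_l hx) hsg) k3 (seg_top hsg hd)
        (sim_trans hs (sim_symm (seg_sim hsg (seg_self _ _)))))
    exact (hD.2 w).2 (seg_field (field_l hx) (seg_field_seg hsg ((hD'.2 w).1 hw)))
  · intro n n' hn hs ih m' hm'
    obtain ⟨m, hm⟩ := gt n hn
    have h1 := gs n n' m m' hn hs hm hm'
    refine ⟨h1.1, fun a ha => ?_⟩
    have h2 := (h1.2 a).1 ha
    refine ⟨h2.1, fun b hb hba => ?_⟩
    exact (h1.2 b).2 ⟨hb, (((ih m hm).2) b (h2.2 b hb hba)).2⟩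

end Types
end NFUweak

open FirstOrder Language
namespace NFUweak

section MainInd
set_option linter.all false
variable {M : Type} [LNFU.Structure M] [NFUModel M]

theorem ex_iota (A : M) : ∃ B, isIotaImageOf B A := comp _

theorem iota_eqp {A B A' B' : M} (h : equipollent A A') (hB : isIotaImageOf B A) (hB' : isIotaImageOf B' A') :
    equipollent B B' := by
  obtain ⟨f, hf, hs⟩ := h
  refine mkBij (fun s t => ∃ a b, ⦅a,b⦆ ε f ∧ isSingletonOf s a ∧ isSingletonOf t b) ?_ ?_ ?_ ?_ ?_
  · rintro s t ⟨a, b, h1, h2, h3⟩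
    have := bij_mem hf h1
    exact ⟨(hB.2 s).2 ⟨a, this.1, h2⟩, (hB'.2 t).2 ⟨b, this.2, h3⟩⟩
  · intro s hs
    obtain ⟨a, ha, hsa⟩ := (hB.2 s).1 hs
    obtain ⟨b, hb⟩ := hf.1.2.2.1 a ha
    obtain ⟨t, ht⟩ := ex_sing b
    exact ⟨t, a, b, hb, hsa, ht⟩
  · rintro s t t' ⟨a, b, h1, h2, h3⟩ ⟨a', b', h1', h2', h3'⟩
    obtain rfl := sing_inj h2 h2'
    obtain rfl := hf.1.2.2.2 _ _ _ h1 h1'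
    exact sing_uniq h3 h3'
  · rintro s t t' ⟨a, b, h1, h2, h3⟩ ⟨a', b', h1', h2', h3'⟩
    obtain rfl := sing_inj h3 h3'
    obtain rfl := hf.2 _ _ _ h1 h1'
    exact sing_uniq h2 h2'
  · intro t ht
    obtain ⟨b, hb, htb⟩ := (hB'.2 t).1 ht
    obtain ⟨a, ha⟩ := hs b hb
    obtain ⟨s, hs⟩ := ex_sing a
    exact ⟨s, a, b, ha, hs, htb⟩

theorem iota_eqp' {A B A' B' : M} (h : equipollent B B') (hB : isIotaImageOf B A) (hB' : isIotaImageOf B' A') :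
    equipollent A A' := by
  obtain ⟨f, hf, hs⟩ := h
  refine mkBij (fun a b => ∃ s t, ⦅s,t⦆ ε f ∧ isSingletonOf s a ∧ isSingletonOf t b) ?_ ?_ ?_ ?_ ?_
  · rintro a b ⟨s, t, h1, h2, h3⟩
    have := bij_mem hf h1
    obtain ⟨a', ha', e⟩ := (hB.2 s).1 this.1
    obtain ⟨b', hb', e'⟩ := (hB'.2 t).1 this.2
    obtain rfl := sing_inj h2 e
    obtain rfl := sing_inj h3 e'
    exact ⟨ha', hb'⟩
  · intro a ha
    obtain ⟨s, hs⟩ := ex_sing a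
    obtain ⟨t, ht⟩ := hf.1.2.2.1 s ((hB.2 s).2 ⟨a, ha, hs⟩)
    obtain ⟨b, hb, htb⟩ := (hB'.2 t).1 (bij_mem hf ht).2
    exact ⟨b, s, t, ht, hs, htb⟩
  · rintro a b b' ⟨s, t, h1, h2, h3⟩ ⟨s', t', h1', h2', h3'⟩
    obtain rfl := sing_uniq h2 h2'
    obtain rfl := hf.1.2.2.2 _ _ _ h1 h1'
    exact sing_inj h3 h3'
  · rintro a b b' ⟨s, t, h1, h2, h3⟩ ⟨s', t', h1', h2', h3'⟩
    obtain rfl := sing_uniq h3 h3'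
    obtain rfl := hf.2 _ _ _ h1 h1'
    exact sing_inj h2 h2'
  · intro b hb
    obtain ⟨t, ht⟩ := ex_sing b
    obtain ⟨s, hs'⟩ := hs t ((hB'.2 t).2 ⟨b, hb, ht⟩)
    obtain ⟨a, ha, hsa⟩ := (hB.2 s).1 (bij_mem hf hs').1
    exact ⟨a, s, t, hs', hsa, ht⟩

abbrev Tn (n q : M) : Prop := isNat n ∧ isNat q ∧ ∃ A B, isCardOf q A ∧ isIotaImageOf B A ∧ isCardOf n B

theorem tn_inj {n q q' : M} (h : Tn n q) (h' : Tn n q') : q = q' := by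
  obtain ⟨-, -, A, B, h1, h2, h3⟩ := h
  obtain ⟨-, -, A', B', h1', h2', h3'⟩ := h'
  have e : equipollent B B' := (h3'.2 B).1 (card_self h3)
  exact card_uniq (card_of_eqp h1 (iota_eqp' e h2 h2')) h1'

theorem tn_tot : ∀ q : M, isNat q → ∃ n, Tn n q := by
  refine nat_ind _ ?_ ?_
  · intro z hz
    obtain ⟨A, hA⟩ := ex_empty (M := M)
    obtain ⟨B, hB⟩ := ex_iota A
    obtain ⟨z', hz'⟩ := ex_zero (M := M)
    refine ⟨z', nat_zero hz', nat_zero hz, A, B, zero_card hz hA.2, hB, zero_card hz' fun w hw => ?_⟩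
    obtain ⟨x, hx, -⟩ := (hB.2 w).1 hw
    exact hA.2 x hx
  · rintro q s hq hs ⟨n, hn, -, A, B, h1, h2, h3⟩
    obtain ⟨A2, d, hA2, hd⟩ := nat_room q hq
    obtain ⟨A3, h31, h32⟩ := ex_adj A2 d
    obtain ⟨B2, hB2⟩ := ex_iota A2
    obtain ⟨B3, hB3⟩ := ex_iota A3
    obtain ⟨sd, hsd⟩ := ex_sing d
    obtain ⟨n', hn'⟩ := ex_succ n
    have e : isCardOf n B2 := card_of_eqp h3 (iota_eqp ((hA2.2 A).1 (card_self h1)) h2 hB2)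
    refine ⟨n', nat_succ hn hn', nat_succ hq hs, A3, B3, succ_card hA2 hd hs h32, hB3,
      succ_card (d := sd) e ?_ hn' ?_⟩
    · intro h
      obtain ⟨x, hx, hx'⟩ := (hB2.2 _).1 h
      obtain rfl := sing_inj hsd hx'
      exact hd hx
    · intro w
      rw [hB3.2, hB2.2]
      constructor
      · rintro ⟨x, hx, hw⟩
        rcases (h32 x).1 hx with h | rfl
        · exact Or.inl ⟨x, h, hw⟩
        · exact Or.inr (sing_uniq hw hsd)
      · rintro (⟨x, hx, hw⟩ | rfl)
        · exact ⟨x, (h32 x).2 (Or.inl hx), hw⟩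
        · exact ⟨d, (h32 d).2 (Or.inr rfl), hsd⟩

abbrev Code (c X m : M) : Prop :=
  (∀ a, a ε m → ∃ x s, x ε X ∧ isSingletonOf s x ∧ ⦅a,s⦆ ε c) ∧
  (∀ a a', a ε m → a' ε m →
    (∀ x s, x ε X → isSingletonOf s x → (⦅a,s⦆ ε c ↔ ⦅a',s⦆ ε c)) → a = a')

abbrev codes (Ed q R h : M) : Prop :=
  (∀ a b b', ⦅a,b⦆ ε h → ⦅a,b'⦆ ε h → b = b') ∧ (∀ a a' b, ⦅a,b⦆ ε h → ⦅a',b⦆ ε h → a = a') ∧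
  (∀ x, inField x R → ∃ i, ⦅x,i⦆ ε h) ∧
  ∀ p, ⦅q,p⦆ ε Ed ↔ ∃ x y i j, ⦅x,y⦆ ε R ∧ ⦅x,i⦆ ε h ∧ ⦅y,j⦆ ε h ∧ p = ⦅i,j⦆

theorem codes_rel {Ed q R h R' h' x y x' y' i j : M} (H : codes Ed q R h) (H' : codes Ed q R' h')
    (hx : ⦅x,i⦆ ε h) (hx' : ⦅x',i⦆ ε h') (hy : ⦅y,j⦆ ε h) (hy' : ⦅y',j⦆ ε h') (hR : ⦅x,y⦆ ε R) :
    ⦅x',y'⦆ ε R' := by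
  obtain ⟨x2, y2, i2, j2, h1, h2, h3, e⟩ := (H'.2.2.2 _).1 ((H.2.2.2 ⦅i,j⦆).2 ⟨x, y, i, j, hR, hx, hy, rfl⟩)
  obtain ⟨rfl, rfl⟩ := spair_inj e
  rwa [H'.2.1 _ _ _ hx' h2, H'.2.1 _ _ _ hy' h3]

theorem codes_tot {Ed q R h R' h' x : M} (H : codes Ed q R h) (H' : codes Ed q R' h')
    (hx : inField x R) : ∃ x' i, inField x' R' ∧ ⦅x,i⦆ ε h ∧ ⦅x',i⦆ ε h' := by
  obtain ⟨i, hi⟩ := H.2.2.1 x hx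
  obtain ⟨y, hy | hy⟩ := hx
  · obtain ⟨j, hj⟩ := H.2.2.1 y (field_r hy)
    obtain ⟨x2, y2, i2, j2, h1, h2, h3, e⟩ := (H'.2.2.2 _).1 ((H.2.2.2 ⦅i,j⦆).2 ⟨x, y, i, j, hy, hi, hj, rfl⟩)
    obtain ⟨rfl, rfl⟩ := spair_inj e
    exact ⟨x2, i, field_l h1, hi, h2⟩
  · obtain ⟨j, hj⟩ := H.2.2.1 y (field_l hy)
    obtain ⟨x2, y2, i2, j2, h1, h2, h3, e⟩ := (H'.2.2.2 _).1 ((H.2.2.2 ⦅j,i⦆).2 ⟨y, x, j, i, hy, hj, hi, rfl⟩)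
    obtain ⟨rfl, rfl⟩ := spair_inj e
    exact ⟨y2, i, field_r h1, hi, h3⟩

theorem codes_iso {Ed q R h R' h' : M} (H : codes Ed q R h) (H' : codes Ed q R' h') : relIso R R' := by
  refine mkIso (fun x x' => inField x R ∧ inField x' R' ∧ ∃ i, ⦅x,i⦆ ε h ∧ ⦅x',i⦆ ε h') (compR _) ?_ ?_ ?_ ?_ ?_ ?_
  · exact fun x y h => ⟨h.1, h.2.1⟩
  · intro x hx
    obtain ⟨x', i, h1, h2, h3⟩ := codes_tot H H' hx
    exact ⟨x', hx, h1, i, h2, h3⟩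
  · rintro x y y' ⟨_, _, i, h1, h2⟩ ⟨_, _, j, h3, h4⟩
    obtain rfl := H.1 _ _ _ h1 h3
    exact H'.2.1 _ _ _ h2 h4
  · rintro x y y' ⟨_, _, i, h1, h2⟩ ⟨_, _, j, h3, h4⟩
    obtain rfl := H'.1 _ _ _ h2 h4
    exact H.2.1 _ _ _ h1 h3
  · intro x hx
    obtain ⟨x', i, h1, h2, h3⟩ := codes_tot H' H hx
    exact ⟨x', h1, hx, i, h3, h2⟩
  · rintro x y x' y' ⟨_, _, i, h1, h2⟩ ⟨_, _, j, h3, h4⟩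
    exact ⟨codes_rel H H' h1 h2 h3 h4, codes_rel H' H h2 h1 h4 h3⟩

theorem code_base {N m : M} (hN : isNatSet N) (hm : isM0Set m) : ∃ c, Code c N m := by
  obtain ⟨Ed, hEd0, hEd⟩ := coding (M := M)
  obtain ⟨Cd, -, -, hCd⟩ := compR (fun R sq : M => ∃ q, isSingletonOf sq q ∧ isNat q ∧ ∃ h, codes Ed q R h)
  obtain ⟨TS, -, -, hTS⟩ := compR (fun n sq : M => ∃ q, isSingletonOf sq q ∧ Tn n q)
  obtain ⟨c, -, -, hc⟩ := compR (fun a s : M => ∃ n sq R, isSingletonOf s n ∧ ⦅n,sq⦆ ε TS ∧ R ε a ∧ ⦅R,sq⦆ ε Cd)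
  have tot : ∀ a, a ε m → ∃ n q R s h, isNat n ∧ isSingletonOf s n ∧ Tn n q ∧ isTypeOf a R ∧ codes Ed q R h ∧
      ⦅a,s⦆ ε c := by
    intro a ha
    obtain ⟨R, r, h1, h2, h3⟩ := bf_top ((hm.2 a).1 ha).1
    obtain ⟨D, hD, hf⟩ := (m0_char hm ((hm.2 a).1 ha).1 h2).1 ha
    obtain ⟨h, hh⟩ := fin_inj hN D hf
    obtain ⟨q, hq, hq'⟩ := fin_code hEd0 hEd R h D hf (fun x hx => by
      obtain ⟨i, hi⟩ := hh.1.2.2.1 x hx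
      exact ⟨i, (hN.2 i).1 (bij_mem hh hi).2, hi⟩) hh.1.2.2.2
    obtain ⟨n, hn⟩ := tn_tot q hq
    obtain ⟨s, hs⟩ := ex_sing n
    obtain ⟨sq, hsq⟩ := ex_sing q
    have hcod : codes Ed q R h := by
      refine ⟨hh.1.2.2.2, hh.2, fun x hx => hh.1.2.2.1 x ((hD.2 x).2 hx), fun p => ?_⟩
      rw [hq']
      constructor
      · rintro ⟨x, y, i, j, -, -, h⟩
        exact ⟨x, y, i, j, h⟩
      · rintro ⟨x, y, i, j, h⟩
        exact ⟨x, y, i, j, (hD.2 x).2 (field_l h.1), (hD.2 y).2 (field_r h.1), h⟩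
    refine ⟨n, q, R, s, h, hn.1, hs, hn, h2, hcod, ?_⟩
    exact (hc _ _).2 ⟨n, sq, R, hs, (hTS _ _).2 ⟨q, hsq, hn⟩, type_mem h2, (hCd _ _).2 ⟨q, hsq, hq, h, hcod⟩⟩
  refine ⟨c, fun a ha => ?_, fun a a' ha ha' hE => ?_⟩
  · obtain ⟨n, q, R, s, h, h1, h2, h3, h4, h5, h6⟩ := tot a ha
    exact ⟨n, s, (hN.2 n).2 h1, h2, h6⟩
  · obtain ⟨n, q, R, s, h, h1, h2, h3, h4, h5, h6⟩ := tot a ha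
    obtain ⟨n', sq', R', k1, k2, k3, k4⟩ := (hc _ _).1 ((hE n s ((hN.2 n).2 h1) h2).1 h6)
    obtain rfl := sing_inj h2 k1
    obtain ⟨q1, l1, l2⟩ := (hTS _ _).1 k2
    obtain ⟨q2, l3, l4, h', l5⟩ := (hCd _ _).1 k4
    obtain rfl := sing_inj l1 l3
    obtain rfl := tn_inj h3 l2
    obtain ⟨R2, -, -, l6, -⟩ := bf_top ((hm.2 a').1 ha').1
    exact type_eq h4 l6 (iso_trans (codes_iso h5 l5) ((l6.2 _).1 k3))

end MainInd
end NFUweak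

open FirstOrder Language
namespace NFUweak

section StepInd
set_option linter.all false
variable {M : Type} [LNFU.Structure M] [NFUModel M]

abbrev KA (c β b A : M) : Prop := sset A ∧ ∀ w, w ε A ↔
  ∃ x sx sw, isSingletonOf sx x ∧ isSingletonOf sw w ∧ ⦅b,sx⦆ ε c ∧ ⦅x,sw⦆ ε β

theorem ex_KA (c β b : M) : ∃ A, KA c β b A := comp _

theorem code_step {m m' c X W Y P : M} (hm : ∀ a, a ε m → inBF a) (hC : Code c X m)
    (hm' : ∀ a, a ε m' ↔ (inBF a ∧ ∀ b, inBF b → erel b a → b ε m))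
    (hY : isIotaImageOf Y W) (hP : isPowerSetOf P W) (hXY : equipollent X Y) : ∃ c', Code c' P m' := by
  obtain ⟨β, hβ, hβs⟩ := hXY
  have KAne : ∀ b A, b ε m → KA c β b A → ∃ w, w ε A := by
    intro b A hb hA
    obtain ⟨x, s, hx, hs, hbs⟩ := hC.1 b hb
    obtain ⟨t, ht⟩ := hβ.1.2.2.1 x hx
    obtain ⟨w, hw, htw⟩ := (hY.2 t).1 (bij_mem hβ ht).2
    exact ⟨w, (hA.2 w).2 ⟨x, s, t, hs, htw, hbs, ht⟩⟩
  have KAinj1 : ∀ b b' A x s, KA c β b A → KA c β b' A → x ε X → isSingletonOf s x →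
      ⦅b,s⦆ ε c → ⦅b',s⦆ ε c := by
    intro b b' A x s hA hA' hx hs hbs
    obtain ⟨t, ht⟩ := hβ.1.2.2.1 x hx
    obtain ⟨w, hw, htw⟩ := (hY.2 t).1 (bij_mem hβ ht).2
    have h1 := (hA.2 w).2 ⟨x, s, t, hs, htw, hbs, ht⟩
    obtain ⟨x', s', t', h2, h3, h4, h5⟩ := (hA'.2 w).1 h1
    obtain rfl := sing_uniq htw h3
    obtain rfl := hβ.2 _ _ _ ht h5
    obtain rfl := sing_uniq hs h2
    exact h4
  have KAinj : ∀ b b' A, b ε m → b' ε m → KA c β b A → KA c β b' A → b = b' := by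
    intro b b' A hb hb' hA hA'
    exact hC.2 b b' hb hb' fun x s hx hs =>
      ⟨KAinj1 b b' A x s hA hA' hx hs, KAinj1 b' b A x s hA' hA hx hs⟩
  have KAP : ∀ b A, KA c β b A → A ε P := by
    intro b A hA
    refine (hP.2 A).2 ⟨hA.1, fun w hw => ?_⟩
    obtain ⟨x, sx, sw, h1, h2, h3, h4⟩ := (hA.2 w).1 hw
    obtain ⟨w', hw', e⟩ := (hY.2 sw).1 (bij_mem hβ h4).2
    rwa [sing_inj h2 e]
  have EP : ∀ A, isEmptySet A → A ε P := fun A hA => (hP.2 A).2 ⟨hA.1, fun w hw => (hA.2 w hw).elim⟩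
  obtain ⟨c', -, -, hc'⟩ := compR (fun a s : M => ∃ A, isSingletonOf s A ∧
    ((bit a ∧ isEmptySet A) ∨ ∃ b, inBF b ∧ erel b a ∧ KA c β b A))
  have trans1 : ∀ a a', a ε m' → a' ε m' →
      (∀ x s, x ε P → isSingletonOf s x → (⦅a,s⦆ ε c' ↔ ⦅a',s⦆ ε c')) →
      (bit a → bit a') ∧ ∀ b, inBF b → erel b a → erel b a' := by
    intro a a' ha ha' h
    have k := (hm' a).1 ha
    have k' := (hm' a').1 ha'
    refine ⟨fun hb => ?_, fun b hb hba => ?_⟩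
    · obtain ⟨A, hA⟩ := ex_empty (M := M)
      obtain ⟨s, hs⟩ := ex_sing A
      obtain ⟨A', h1, h2⟩ := (hc' _ _).1 ((h A s (EP A hA) hs).1 ((hc' _ _).2 ⟨A, hs, Or.inl ⟨hb, hA⟩⟩))
      obtain rfl := sing_inj hs h1
      rcases h2 with h2 | ⟨b, h3, h4, h5⟩
      · exact h2.1
      · obtain ⟨w, hw⟩ := KAne b A (k'.2 b h3 h4) h5
        exact (hA.2 w hw).elim
    · obtain ⟨A, hA⟩ := ex_KA c β b
      obtain ⟨s, hs⟩ := ex_sing A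
      obtain ⟨w, hw⟩ := KAne b A (k.2 b hb hba) hA
      obtain ⟨A', h1, h2⟩ := (hc' _ _).1 ((h A s (KAP b A hA) hs).1
        ((hc' _ _).2 ⟨A, hs, Or.inr ⟨b, hb, hba, hA⟩⟩))
      obtain rfl := sing_inj hs h1
      rcases h2 with h2 | ⟨b', h3, h4, h5⟩
      · exact (h2.2.2 w hw).elim
      · rwa [KAinj b b' A (k.2 b hb hba) (k'.2 b' h3 h4) hA h5]
  refine ⟨c', fun a ha => ?_, fun a a' ha ha' h => ?_⟩
  · obtain ⟨R, r, h1, h2, h3⟩ := bf_top ((hm' a).1 ha).1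
    obtain ⟨x, hx⟩ := top_pred h1 h3
    by_cases hmin : ∃ c, ⦅c,x⦆ ε R
    · obtain ⟨d, hd⟩ := hmin
      obtain ⟨sg, hsg⟩ := ex_seg R x
      obtain ⟨b, hb⟩ := ex_type sg
      obtain ⟨A, hA⟩ := ex_KA c β b
      obtain ⟨s, hs⟩ := ex_sing A
      exact ⟨A, s, KAP b A hA, hs, (hc' _ _).2 ⟨A, hs, Or.inr ⟨b, bf_mk h1 hd hsg hb,
        erel_seg h1 h3.2 h2 hx hd hsg hb, hA⟩⟩⟩
    · push Not at hmin
      obtain ⟨A, hA⟩ := ex_empty (M := M)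
      obtain ⟨s, hs⟩ := ex_sing A
      exact ⟨A, s, EP A hA, hs, (hc' _ _).2 ⟨A, hs, Or.inl ⟨(bit_char h1 h2 h3).2 ⟨x, hx, hmin⟩, hA⟩⟩⟩
  · have t1 := trans1 a a' ha ha' h
    have t2 := trans1 a' a ha' ha fun x s hx hs => (h x s hx hs).symm
    exact eext ((hm' a).1 ha).1 ((hm' a').1 ha').1 (fun b hb => ⟨t1.2 b hb, t2.2 b hb⟩) ⟨t1.1, t2.1⟩

theorem main_code {g f : M} (hg : isMFun g) (hf : isBethFun f) : ∀ n, isNat n → ∀ y, ⦅n,y⦆ ε f →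
    ¬ isEmptySet y → ∃ X c m, isCardOf y X ∧ ⦅n,m⦆ ε g ∧ Code c X m := by
  have hcl := m_closed hg
  obtain ⟨-, -, gt, gf, g0, gs⟩ := hg
  obtain ⟨-, -, ft, ff, f0, fs⟩ := hf
  refine nat_ind _ ?_ ?_
  · intro z hz y hy hne
    obtain ⟨N, hN, hyN⟩ := f0 z y hz hy
    obtain ⟨m, hm⟩ := gt z (nat_zero hz)
    obtain ⟨c, hc⟩ := code_base hN (g0 z m hz hm)
    exact ⟨N, c, m, hyN, hm, hc⟩
  · intro n n' hn hs ih y' hy' hne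
    obtain ⟨y, hy⟩ := ft n hn
    rcases fs n n' y y' hn hs hy hy' with h | ⟨h1, h2 | h2⟩
    · exact (hne h.2).elim
    · obtain ⟨X, c, m, k1, k2, k3⟩ := ih y hy h1
      obtain ⟨W, Y, P, l1, l2, l3, l4⟩ := h2
      obtain ⟨m', hm'⟩ := gt n' (nat_succ hn hs)
      obtain ⟨c', hc'⟩ := code_step (fun a ha => (((hcl n hn m k2).2 a ha)).1) k3
        (gs n n' m m' hn hs k2 hm').2 l1 l3 ((l2.2 X).1 (card_self k1))
      exact ⟨P, c', m', l4, hm', hc'⟩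
    · exact (hne h2.1).elim

end StepInd
end NFUweak

open FirstOrder Language
namespace NFUweak

section Final
set_option linter.all false
variable {M : Type} [LNFU.Structure M] [NFUModel M]

abbrev GG (H R y x : M) : Prop := inField x R ∧ sset y ∧ ∀ w, w ε y ↔
  ∃ q3 q2 q1, ⦅x,q3⦆ ε H ∧ isSingletonOf q3 q2 ∧ isSingletonOf q2 q1 ∧ isSingletonOf q1 w

theorem shrink {R H a : M} (hR : inOmega R) (ha : isTypeOf a R)
    (h1 : ∀ x q, ⦅x,q⦆ ε H → ∃ q2 q1 w, isSingletonOf q q2 ∧ isSingletonOf q2 q1 ∧ isSingletonOf q1 w)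
    (h4 : ∀ x x', inField x R → inField x' R → (∀ q, ⦅x,q⦆ ε H ↔ ⦅x',q⦆ ε H) → x = x') :
    ∃ b' u, inBF b' ∧ isTTypeOf u b' ∧ isTTypeOf a u := by
  obtain ⟨hRb, r, hr⟩ := hR
  have Gtot : ∀ x, inField x R → ∃ y, GG H R y x := by
    intro x hx
    obtain ⟨y, hy, hy'⟩ := comp (fun w : M => ∃ q3 q2 q1, ⦅x,q3⦆ ε H ∧ isSingletonOf q3 q2 ∧
      isSingletonOf q2 q1 ∧ isSingletonOf q1 w)
    exact ⟨y, hx, hy, hy'⟩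
  have Gfun : ∀ x y y', GG H R y x → GG H R y' x → y = y' := by
    intro x y y' h h'
    exact ext h.2.1 h'.2.1 fun w => (h.2.2 w).trans (h'.2.2 w).symm
  have Ginj1 : ∀ x x' y, GG H R y x → GG H R y x' → ∀ q, ⦅x,q⦆ ε H → ⦅x',q⦆ ε H := by
    intro x x' y h h' q hq
    obtain ⟨q2, q1, w, k1, k2, k3⟩ := h1 x q hq
    obtain ⟨q', q2', q1', k0, k1', k2', k3'⟩ := (h'.2.2 w).1 ((h.2.2 w).2 ⟨q, q2, q1, hq, k1, k2, k3⟩)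
    obtain rfl := sing_uniq k3 k3'
    obtain rfl := sing_uniq k2 k2'
    obtain rfl := sing_uniq k1 k1'
    exact k0
  have Ginj : ∀ x x' y, GG H R y x → GG H R y x' → x = x' := by
    intro x x' y h h'
    exact h4 x x' h.1 h'.1 fun q => ⟨Ginj1 x x' y h h' q, Ginj1 x' x y h' h q⟩
  obtain ⟨S, hS, hSp, hSr⟩ := compR (fun y y' : M => ∃ x x', ⦅x,x'⦆ ε R ∧ GG H R y x ∧ GG H R y' x')
  have Srel : ∀ x x' y y', GG H R y x → GG H R y' x' → (⦅y,y'⦆ ε S ↔ ⦅x,x'⦆ ε R) := by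
    intro x x' y y' h h'
    rw [hSr]
    constructor
    · rintro ⟨x1, x1', k, k1, k2⟩
      rwa [Ginj _ _ _ h k1, Ginj _ _ _ h' k2]
    · intro k
      exact ⟨x, x', k, h, h'⟩
  have Sfield : ∀ y, inField y S → ∃ x, GG H R y x := by
    rintro y ⟨z, h | h⟩
    · obtain ⟨x, x', -, h, -⟩ := (hSr _ _).1 h
      exact ⟨x, h⟩
    · obtain ⟨x, x', -, -, h⟩ := (hSr _ _).1 h
      exact ⟨x', h⟩
  have Sfield' : ∀ x y, GG H R y x → inField y S := by
    intro x y h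
    obtain ⟨x', k | k⟩ := h.1
    · obtain ⟨y', h'⟩ := Gtot x' (field_r k)
      exact field_l ((Srel _ _ _ _ h h').2 k)
    · obtain ⟨y', h'⟩ := Gtot x' (field_l k)
      exact field_r ((Srel _ _ _ _ h' h).2 k)
  have SB : isBFEXT S := by
    refine ⟨⟨hS, fun p hp => ?_⟩, fun B hB hne hsub => ?_, fun y1 y2 hy1 hy2 hE => ?_⟩
    · obtain ⟨x, y, e, -⟩ := hSp p hp
      exact ⟨x, y, e⟩
    · obtain ⟨B0, hB0, hB0'⟩ := comp (fun x : M => ∃ y, y ε B ∧ GG H R y x)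
      obtain ⟨y, hy⟩ := hne
      obtain ⟨x, hx⟩ := Sfield y (hsub y hy)
      obtain ⟨b, hb, hb'⟩ := hRb.2.1 B0 hB0 ⟨x, (hB0' x).2 ⟨y, hy, hx⟩⟩ (fun b hb => by
        obtain ⟨y, -, h⟩ := (hB0' b).1 hb
        exact h.1)
      obtain ⟨yb, hyb, hG⟩ := (hB0' b).1 hb
      refine ⟨yb, hyb, fun z hz hzb => ?_⟩
      obtain ⟨xz, hxz⟩ := Sfield z (hsub z hz)
      exact hb' xz ((hB0' xz).2 ⟨z, hz, hxz⟩) ((Srel _ _ _ _ hxz hG).1 hzb)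
    · obtain ⟨x1, hx1⟩ := Sfield y1 hy1
      obtain ⟨x2, hx2⟩ := Sfield y2 hy2
      have e : x1 = x2 := by
        refine hRb.2.2 x1 x2 hx1.1 hx2.1 fun d => ⟨fun hd => ?_, fun hd => ?_⟩
        · obtain ⟨yd, hyd⟩ := Gtot d (field_l hd)
          exact (Srel _ _ _ _ hyd hx2).1 ((hE yd).1 ((Srel _ _ _ _ hyd hx1).2 hd))
        · obtain ⟨yd, hyd⟩ := Gtot d (field_l hd)
          exact (Srel _ _ _ _ hyd hx1).1 ((hE yd).2 ((Srel _ _ _ _ hyd hx2).2 hd))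
      subst e
      exact Gfun _ _ _ hx1 hx2
  obtain ⟨t, ht⟩ := Gtot r hr.1
  have Sseg : ∀ x, inSeg x R r → inField x R ∧ ∀ y, GG H R y x → inSeg y S t := by
    refine seg_ind hr.1 (fun x => ∀ y, GG H R y x → inSeg y S t) (comp _) ?_ ?_
    · intro y hy
      rw [Gfun _ _ _ hy ht]
      exact seg_self _ _
    · intro b c hb ih hc y hy
      obtain ⟨yb, hyb⟩ := Gtot b hb
      exact seg_step (ih yb hyb) ((Srel _ _ _ _ hy hyb).2 hc)
  have Sseg' : ∀ y, inField y S → inSeg y S t := by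
    intro y hy
    obtain ⟨x, hx⟩ := Sfield y hy
    exact (Sseg x (top_all hr hx.1)).2 y hx
  have SO : inOmega S := by
    refine ⟨SB, t, Sfield' _ _ ht, hS, fun p => ⟨fun hp => ⟨hp, ?_⟩, fun h => h.1⟩⟩
    obtain ⟨x, y, rfl, -⟩ := hSp p hp
    exact ⟨x, y, rfl, Sseg' x (field_l hp), Sseg' y (field_r hp)⟩
  obtain ⟨S1, hS1⟩ : ∃ S1, isTRelOf S1 S := comp (fun p : M => ∃ x y sx sy, smem (spair x y) S ∧
    isSingletonOf sx x ∧ isSingletonOf sy y ∧ p = spair sx sy)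
  obtain ⟨S2, hS2⟩ : ∃ S2, isTRelOf S2 S1 := comp (fun p : M => ∃ x y sx sy, smem (spair x y) S1 ∧
    isSingletonOf sx x ∧ isSingletonOf sy y ∧ p = spair sx sy)
  obtain ⟨b', hb'⟩ := ex_type S
  obtain ⟨u, hu⟩ := ex_type S1
  have trel : ∀ A A' x y sx sy : M, isTRelOf A' A → isSingletonOf sx x → isSingletonOf sy y →
      (⦅sx,sy⦆ ε A' ↔ ⦅x,y⦆ ε A) := by
    intro A A' x y sx sy hA hx hy
    rw [hA.2]
    constructor
    · rintro ⟨x', y', sx', sy', k1, k2, k3, e⟩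
      obtain ⟨rfl, rfl⟩ := spair_inj e
      rwa [sing_inj hx k2, sing_inj hy k3]
    · intro k
      exact ⟨x, y, sx, sy, k, hx, hy, rfl⟩
  have tfield : ∀ A A' z : M, isTRelOf A' A → inField z A' → ∃ x, inField x A ∧ isSingletonOf z x := by
    rintro A A' z hA ⟨z', h | h⟩
    · obtain ⟨x', y', sx', sy', k1, k2, k3, e⟩ := (hA.2 _).1 h
      obtain ⟨rfl, rfl⟩ := spair_inj e
      exact ⟨x', field_l k1, k2⟩
    · obtain ⟨x', y', sx', sy', k1, k2, k3, e⟩ := (hA.2 _).1 h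
      obtain ⟨rfl, rfl⟩ := spair_inj e
      exact ⟨y', field_r k1, k3⟩
  have tfield' : ∀ A A' x z : M, isTRelOf A' A → inField x A → isSingletonOf z x → inField z A' := by
    rintro A A' x z hA ⟨x', h | h⟩ hz
    · obtain ⟨z', hz'⟩ := ex_sing x'
      exact field_l ((trel A A' _ _ _ _ hA hz hz').2 h)
    · obtain ⟨z', hz'⟩ := ex_sing x'
      exact field_r ((trel A A' _ _ _ _ hA hz' hz).2 h)
  have iso : relIso R S2 := by
    refine mkIso (fun x z => ∃ y sy, GG H R y x ∧ isSingletonOf sy y ∧ isSingletonOf z sy) (compR _) ?_ ?_ ?_ ?_ ?_ ?_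
    · rintro x z ⟨y, sy, k1, k2, k3⟩
      exact ⟨k1.1, tfield' S1 S2 _ _ hS2 (tfield' S S1 _ _ hS1 (Sfield' _ _ k1) k2) k3⟩
    · intro x hx
      obtain ⟨y, hy⟩ := Gtot x hx
      obtain ⟨sy, hsy⟩ := ex_sing y
      obtain ⟨z, hz⟩ := ex_sing sy
      exact ⟨z, y, sy, hy, hsy, hz⟩
    · rintro x z z' ⟨y, sy, k1, k2, k3⟩ ⟨y', sy', k1', k2', k3'⟩
      obtain rfl := Gfun _ _ _ k1 k1'
      obtain rfl := sing_uniq k2 k2'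
      exact sing_uniq k3 k3'
    · rintro x z z' ⟨y, sy, k1, k2, k3⟩ ⟨y', sy', k1', k2', k3'⟩
      obtain rfl := sing_inj k3 k3'
      obtain rfl := sing_inj k2 k2'
      exact Ginj _ _ _ k1 k1'
    · intro z hz
      obtain ⟨sy, h2, h3⟩ := tfield S1 S2 z hS2 hz
      obtain ⟨y, h5, h6⟩ := tfield S S1 sy hS1 h2
      obtain ⟨x, hx⟩ := Sfield y h5
      exact ⟨x, y, sy, hx, h6, h3⟩
    · rintro x x' z z' ⟨y, sy, k1, k2, k3⟩ ⟨y', sy', k1', k2', k3'⟩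
      rw [trel S1 S2 _ _ _ _ hS2 k3 k3', trel S S1 _ _ _ _ hS1 k2 k2', Srel _ _ _ _ k1 k1']
  exact ⟨b', u, ⟨S, SO, hb'⟩, ⟨S, S1, type_mem hb', hS1, hu⟩, ⟨S1, S2, type_mem hu, hS2, type_of_iso ha iso⟩⟩

theorem inj_trans {A B C f h : M} (hf : isInjFunc f A B) (hh : isInjFunc h B C) : ∃ k, isInjFunc k A C := by
  refine (mkInj (X := A) (Y := C) (fun x z => ∃ y, ⦅x,y⦆ ε f ∧ ⦅y,z⦆ ε h) ?_ ?_ ?_ ?_).imp fun _ x => x.1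
  · rintro x z ⟨y, h1, h2⟩
    exact ⟨(bij_mem hf h1).1, (bij_mem hh h2).2⟩
  · intro x hx
    obtain ⟨y, hy⟩ := hf.1.2.2.1 x hx
    obtain ⟨z, hz⟩ := hh.1.2.2.1 y (bij_mem hf hy).2
    exact ⟨z, y, hy, hz⟩
  · rintro x z z' ⟨y, h1, h2⟩ ⟨y', h1', h2'⟩
    obtain rfl := hf.1.2.2.2 _ _ _ h1 h1'
    exact hh.1.2.2.2 _ _ _ h2 h2'
  · rintro x z z' ⟨y, h1, h2⟩ ⟨y', h1', h2'⟩
    obtain rfl := hh.2 _ _ _ h2 h2'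
    exact hf.2 _ _ _ h1 h1'

theorem four {t4 cV X0 Y0 F X b : M} (h : isT4Of t4 cV) (hX0 : X0 ε b) (hX : isCardOf b X) (hY0 : Y0 ε t4)
    (hF : isInjFunc F X0 Y0) : ∃ J I4 I3 I2 I1 V, isInjFunc J X I4 ∧ isIotaImageOf I4 I3 ∧
      isIotaImageOf I3 I2 ∧ isIotaImageOf I2 I1 ∧ isIotaImageOf I1 V := by
  obtain ⟨t1, t2, t3, ⟨X1, Y1, -, a2, a3⟩, ⟨X2, Y2, b1, b2, b3⟩, ⟨X3, Y3, c1, c2, c3⟩, ⟨X4, Y4, d1, d2, d3⟩⟩ := h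
  have e1 : equipollent X2 Y1 := (a3.2 _).1 b1
  have e2 : equipollent X3 Y2 := (b3.2 _).1 c1
  have e3 : equipollent X4 Y3 := (c3.2 _).1 d1
  obtain ⟨f4, f4h⟩ : equipollent Y0 Y4 := (d3.2 _).1 hY0
  obtain ⟨f0, f0h⟩ : equipollent X X0 := eqp_symm ((hX.2 _).1 hX0)
  obtain ⟨k, hk⟩ := inj_trans f0h.1 hF
  obtain ⟨k, hk⟩ := inj_trans hk f4h.1
  obtain ⟨Z2, hZ2⟩ := ex_iota Y1
  obtain ⟨Z3, hZ3⟩ := ex_iota Z2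
  obtain ⟨Z4, hZ4⟩ := ex_iota Z3
  have e4 : equipollent Y2 Z2 := iota_eqp e1 b2 hZ2
  have e5 : equipollent Y3 Z3 := iota_eqp (eqp_trans e2 e4) c2 hZ3
  obtain ⟨f5, f5h⟩ : equipollent Y4 Z4 := iota_eqp (eqp_trans e3 e5) d2 hZ4
  obtain ⟨k, hk⟩ := inj_trans hk f5h.1
  exact ⟨k, Z4, Z3, Z2, Y1, X1, hk, hZ4, hZ3, hZ2, a2⟩

theorem seg_uniq {s s' R x : M} (h : isSegOf s R x) (h' : isSegOf s' R x) : s = s' :=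
  ext h.1 h'.1 fun p => (h.2 p).trans (h'.2 p).symm

theorem final {m a c X J I4 I3 I2 I1 V : M} (hm : ∀ a, a ε m → inBF a ∧ ∀ b, inBF b → erel b a → b ε m)
    (hC : Code c X m) (ha : a ε m) (hJ : isInjFunc J X I4) (hI4 : isIotaImageOf I4 I3)
    (hI3 : isIotaImageOf I3 I2) (hI2 : isIotaImageOf I2 I1) (hI1 : isIotaImageOf I1 V) :
    ∃ b' u, inBF b' ∧ isTTypeOf u b' ∧ isTTypeOf a u := by
  obtain ⟨R, ⟨hR, r, hr⟩, haR⟩ := (hm a ha).1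
  have hcl : ∀ x, inSeg x R r → inField x R ∧ ∀ d, ⦅d,x⦆ ε R → ∀ sg b, isSegOf sg R x → isTypeOf b sg → b ε m := by
    refine seg_ind hr.1 (fun x => ∀ d, ⦅d,x⦆ ε R → ∀ sg b, isSegOf sg R x → isTypeOf b sg → b ε m) (comp _) ?_ ?_
    · intro d hd sg b hsg hb
      obtain rfl := seg_uniq hsg hr.2
      rwa [type_eq hb haR (iso_refl _)]
    · intro x x' hx ih hx' d hd sg b hsg hb
      obtain ⟨sg1, hsg1⟩ := ex_seg R x
      obtain ⟨b1, hb1⟩ := ex_type sg1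
      exact (hm b1 (ih x' hx' sg1 b1 hsg1 hb1)).2 b (bf_mk hR hd hsg hb) (erel_seg hR hsg1 hb1 hx' hd hsg hb)
  have hcl' : ∀ x d sg b, ⦅d,x⦆ ε R → isSegOf sg R x → isTypeOf b sg → b ε m := fun x d sg b h1 h2 h3 =>
    (hcl x (top_all hr (field_r h1))).2 d h1 sg b h2 h3
  obtain ⟨H, -, -, hH⟩ := compR (fun x q3 : M => (∃ d, ⦅d,x⦆ ε R) ∧ ∃ b sg x' s q, isSegOf sg R x ∧ isTypeOf b sg ∧
    isSingletonOf s x' ∧ ⦅b,s⦆ ε c ∧ ⦅x',q⦆ ε J ∧ isSingletonOf q q3)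
  have Hne : ∀ x d, ⦅d,x⦆ ε R → ∃ q, ⦅x,q⦆ ε H := by
    intro x d hd
    obtain ⟨sg, hsg⟩ := ex_seg R x
    obtain ⟨b, hb⟩ := ex_type sg
    obtain ⟨x', s, h1, h2, h3⟩ := hC.1 b (hcl' x d sg b hd hsg hb)
    obtain ⟨q, hq⟩ := hJ.1.2.2.1 x' h1
    obtain ⟨q3, -, hq3⟩ := (hI4.2 q).1 (bij_mem hJ hq).2
    exact ⟨q3, (hH _ _).2 ⟨⟨d, hd⟩, b, sg, x', s, q, hsg, hb, h2, h3, hq, hq3⟩⟩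
  have half : ∀ x x' b b' sg sg', (∀ q, ⦅x,q⦆ ε H → ⦅x',q⦆ ε H) → (∃ d, ⦅d,x⦆ ε R) → isSegOf sg R x →
      isSegOf sg' R x' → isTypeOf b sg → isTypeOf b' sg' → ∀ x0 s, x0 ε X → isSingletonOf s x0 →
      ⦅b,s⦆ ε c → ⦅b',s⦆ ε c := by
    intro x x' b b' sg sg' h hd hsg hsg' hb hb' x0 s hx0 hs hbs
    obtain ⟨q, hq⟩ := hJ.1.2.2.1 x0 hx0
    obtain ⟨q3, -, hq3⟩ := (hI4.2 q).1 (bij_mem hJ hq).2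
    obtain ⟨-, b2, sg2, x2, s2, q2, k1, k2, k3, k4, k5, k6⟩ :=
      (hH _ _).1 (h q3 ((hH _ _).2 ⟨hd, b, sg, x0, s, q, hsg, hb, hs, hbs, hq, hq3⟩))
    obtain rfl := sing_uniq hq3 k6
    obtain rfl := hJ.2 _ _ _ hq k5
    obtain rfl := sing_uniq hs k3
    obtain rfl := seg_uniq hsg' k1
    rwa [type_eq hb' k2 (iso_refl _)]
  refine shrink (H := H) ⟨hR, r, hr⟩ haR ?_ ?_
  · intro x q h
    obtain ⟨-, b2, sg2, x2, s2, q2, k1, k2, k3, k4, k5, k6⟩ := (hH _ _).1 h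
    obtain ⟨q3, h3, e3⟩ := (hI4.2 _).1 (bij_mem hJ k5).2
    obtain rfl := sing_inj k6 e3
    obtain ⟨q4, h4, e4⟩ := (hI3.2 _).1 h3
    obtain ⟨q5, h5, e5⟩ := (hI2.2 _).1 h4
    obtain ⟨q6, h6, e6⟩ := (hI1.2 _).1 h5
    exact ⟨q4, q5, q6, e4, e5, e6⟩
  · intro x x' hx hx' h
    by_cases hd : ∃ d, ⦅d,x⦆ ε R <;> by_cases hd' : ∃ d, ⦅d,x'⦆ ε R
    · obtain ⟨d, hd1⟩ := id hd
      obtain ⟨d', hd1'⟩ := id hd'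
      obtain ⟨sg, hsg⟩ := ex_seg R x
      obtain ⟨sg', hsg'⟩ := ex_seg R x'
      obtain ⟨b, hb⟩ := ex_type sg
      obtain ⟨b', hb'⟩ := ex_type sg'
      have e : b = b' := hC.2 b b' (hcl' x d sg b hd1 hsg hb) (hcl' x' d' sg' b' hd1' hsg' hb')
        fun x0 s hx0 hs => ⟨half x x' b b' sg sg' (fun q => (h q).1) hd hsg hsg' hb hb' x0 s hx0 hs,
          half x' x b' b sg' sg (fun q => (h q).2) hd' hsg' hsg hb' hb x0 s hx0 hs⟩
      subst e
      obtain ⟨f, hf⟩ := (hb'.2 _).1 (type_mem hb)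
      have k := iso_top hf (seg_bfext hR hx hsg) (seg_top hsg hd1) (seg_top hsg' hd1')
      exact sim_eq_aux hR x hx x' hx' (sim_trans (sim_symm (seg_sim hsg (seg_self _ _)))
        (sim_trans (iso_sim hf k) (seg_sim hsg' (seg_self _ _))))
    · obtain ⟨d, hd⟩ := hd
      obtain ⟨q, hq⟩ := Hne x d hd
      exact (hd' ((hH _ _).1 ((h q).1 hq)).1).elim
    · obtain ⟨d, hd'⟩ := hd'
      obtain ⟨q, hq⟩ := Hne x' d hd'
      exact (hd ((hH _ _).1 ((h q).2 hq)).1).elim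
    · exact hR.2.2 x x' hx hx' fun d => ⟨fun k => (hd ⟨d, k⟩).elim, fun k => (hd' ⟨d, k⟩).elim⟩

end Final

theorem stmt16 :
    ∀ (M : Type) [LNFU.Structure M] [Nonempty M], M ⊨ NFUmAC →
      ∀ g f v cV t4 : M, isMFun g → isBethFun f → isUniverseOf v → isCardOf cV v →
        isT4Of t4 cV →
        ∀ n b : M, isNat n → smem (spair n b) f → ¬ isEmptySet b → cardLe b t4 →
          ∀ mn, smem (spair n mn) g → ∀ a, smem a mn →
            ∃ b' u, inBF b' ∧ isTTypeOf u b' ∧ isTTypeOf a u := by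
  intro M _ _ hM g f v cV t4 hg hf _ _ ht4 n b hn hb hne hle mn hmn a ha
  have : NFUModel M := ⟨hM, inferInstance⟩
  obtain ⟨X, c, m, h1, h2, h3⟩ := main_code hg hf n hn b hb hne
  obtain rfl := hg.2.2.2.1 _ _ _ hmn h2
  obtain ⟨X0, Y0, F, hX0, hY0, hF⟩ := hle
  obtain ⟨J, I4, I3, I2, I1, V, k1, k2, k3, k4, k5⟩ := four ht4 hX0 h1 hY0 hF
  exact final (m_closed hg n hn mn hmn).2 h3 ha k1 k2 k3 k4 k5

end NFUweak
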